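/- The partial order of the Solovay degrees of computably enumerable sets and the partial order of the K-degrees of computably enumerable sets are not elementarily equivalent: the Solovay degrees of c.e. sets contain a minimal pair, while the K-degrees of c.e. sets do not. -/

import Mathlib

open Part Filter

open scoped Classical

namespace KPaper

/-- Binary strings. -/
abbrev Str := List Bool

/-! ### Oracle (Turing) reducibility -/

/-- The functions `ℕ →. ℕ` that are partial recursive relative to an oracle `O : ℕ →. ℕ`.
This mirrors Mathlib's `Nat.Partrec`, with an extra base case for the oracle. -/
inductive RecursiveIn (O : ℕ →. ℕ) : (ℕ →. ℕ) → Prop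
  | oracle : RecursiveIn O O
  | zero : RecursiveIn O (pure 0)
  | succ : RecursiveIn O ↑Nat.succ
  | left : RecursiveIn O ↑fun n : ℕ => n.unpair.1
  | right : RecursiveIn O ↑fun n : ℕ => n.unpair.2
  | pair {f g} : RecursiveIn O f → RecursiveIn O g →
      RecursiveIn O fun n => Nat.pair <$> f n <*> g n
  | comp {f g} : RecursiveIn O f → RecursiveIn O g → RecursiveIn O fun n => g n >>= f
  | prec {f g} : RecursiveIn O f → RecursiveIn O g → RecursiveIn O (Nat.unpaired fun a n =>
      n.rec (f a) fun y IH => do let i ← IH; g (Nat.pair a (Nat.pair y i)))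
  | rfind {f} : RecursiveIn O f →
      RecursiveIn O fun a => Nat.rfind fun n => (fun m => m = 0) <$> f (Nat.pair a n)

/-- The characteristic (partial) function of a set of naturals, used as a Turing oracle. -/
noncomputable def chi (A : Set ℕ) : ℕ →. ℕ := fun n => Part.some (if n ∈ A then 1 else 0)

/-- The characteristic function of an infinite binary sequence, used as a Turing oracle. -/
def chiSeq (X : ℕ → Bool) : ℕ →. ℕ := fun n => Part.some (cond (X n) 1 0)

/-- `A` is Turing reducible to `B`. -/
noncomputable def TuringLeSet (A B : Set ℕ) : Prop := RecursiveIn (chi B) (chi A)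

/-- `A` is Turing equivalent to `B`. -/
noncomputable def TuringEquivSet (A B : Set ℕ) : Prop := TuringLeSet A B ∧ TuringLeSet B A

/-- Turing equivalence between a set and an infinite binary sequence. -/
noncomputable def TuringEquivSetSeq (A : Set ℕ) (X : ℕ → Bool) : Prop :=
  RecursiveIn (chiSeq X) (chi A) ∧ RecursiveIn (chi A) (chiSeq X)

/-- The halting problem `∅'`. -/
def haltingSet : Set ℕ := {n | ((Denumerable.ofNat Nat.Partrec.Code n).eval n).Dom}

/-- A set of naturals is computably enumerable iff it is the domain of a
partial computable function. -/
def CESet (A : Set ℕ) : Prop := ∃ f : ℕ →. ℕ, Nat.Partrec f ∧ ∀ n, n ∈ A ↔ (f n).Dom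

/-! ### Machines and Kolmogorov complexity -/

/-- A (plain) machine is a partial computable map from binary strings to binary strings. -/
def PlainMachine (M : Str →. Str) : Prop := Partrec M

/-- A prefix-free machine: a partial computable map on binary strings whose
domain is an antichain under the prefix relation. -/
def PFMachine (M : Str →. Str) : Prop :=
  Partrec M ∧ ∀ ρ₁ ρ₂ : Str, (M ρ₁).Dom → (M ρ₂).Dom → ρ₁ <+: ρ₂ → ρ₁ = ρ₂

/-- The Kolmogorov complexity of a string `σ` with respect to a machine `M`:
the least length of an `M`-description of `σ` (`⊤` if there is none). -/
noncomputable def KC (M : Str →. Str) (σ : Str) : ℕ∞ :=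
  ⨅ ρ : {ρ : Str // σ ∈ M ρ}, ((ρ : Str).length : ℕ∞)

/-- An optimal prefix-free machine: a prefix-free machine whose associated complexity
is minimal, up to an additive constant, among all prefix-free machines. -/
def OptimalPF (U : Str →. Str) : Prop :=
  PFMachine U ∧ ∀ M : Str →. Str, PFMachine M → ∃ c : ℕ, ∀ σ : Str, KC U σ ≤ KC M σ + c

/-- An optimal plain machine. -/
def OptimalPlain (V : Str →. Str) : Prop :=
  PlainMachine V ∧ ∀ M : Str →. Str, PlainMachine M → ∃ c : ℕ, ∀ σ : Str, KC V σ ≤ KC M σ + c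

/-! ### Initial segments -/

/-- The first `n` bits of the characteristic sequence of a set of naturals. -/
noncomputable def restrSet (A : Set ℕ) (n : ℕ) : Str :=
  (List.range n).map fun i => decide (i ∈ A)

/-- The first `n` bits of an infinite binary sequence. -/
def restrSeq (X : ℕ → Bool) (n : ℕ) : Str := (List.range n).map X

/-- The string `0^n`; `K(n)` is identified with `K(0^n)`. -/
def zeroStr (n : ℕ) : Str := List.replicate n false

/-! ### `≤_K`, `<_K`, `K`-triviality (and the `≤_C` analogues) -/

def KLeSet (U : Str →. Str) (A B : Set ℕ) : Prop :=
  ∃ c : ℕ, ∀ n, KC U (restrSet A n) ≤ KC U (restrSet B n) + c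

def KLtSet (U : Str →. Str) (A B : Set ℕ) : Prop := KLeSet U A B ∧ ¬ KLeSet U B A

def KTrivialSet (U : Str →. Str) (A : Set ℕ) : Prop :=
  ∃ c : ℕ, ∀ n, KC U (restrSet A n) ≤ KC U (zeroStr n) + c

def KLeSeq (U : Str →. Str) (X Y : ℕ → Bool) : Prop :=
  ∃ c : ℕ, ∀ n, KC U (restrSeq X n) ≤ KC U (restrSeq Y n) + c

def KLtSeq (U : Str →. Str) (X Y : ℕ → Bool) : Prop := KLeSeq U X Y ∧ ¬ KLeSeq U Y X

def KTrivialSeq (U : Str →. Str) (X : ℕ → Bool) : Prop :=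
  ∃ c : ℕ, ∀ n, KC U (restrSeq X n) ≤ KC U (zeroStr n) + c

/-! ### Computably enumerable reals -/

/-- The real number in `[0,1]` whose binary expansion is the sequence `X`. -/
noncomputable def realOfSeq (X : ℕ → Bool) : ℝ := ∑' i : ℕ, cond (X i) ((2 : ℝ) ^ (i + 1))⁻¹ 0

/-- `X` (identified with the real it is the binary expansion of) is a computably
enumerable real: it is the limit of a nondecreasing computable sequence of
(dyadic) rationals. -/
def CEReal (X : ℕ → Bool) : Prop :=
  ∃ f : ℕ → ℤ, Computable f ∧
    (∀ s, (f s : ℝ) / 2 ^ s ≤ (f (s + 1) : ℝ) / 2 ^ (s + 1)) ∧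
    Tendsto (fun s => (f s : ℝ) / 2 ^ s) atTop (nhds (realOfSeq X))

/-- The characteristic sequence of a set of naturals. -/
noncomputable def seqOfSet (A : Set ℕ) : ℕ → Bool := fun i => decide (i ∈ A)

/-! ### Solovay reducibility -/

/-- Solovay reducibility on c.e. reals: `X ≤_S Y` iff there are nondecreasing computable
rational approximations to `X` and `Y` and a constant `c` such that at each stage the
distance to `X` is bounded by `c` times the distance to `Y`. -/
def SolovayLe (X Y : ℕ → Bool) : Prop :=
  ∃ (c : ℕ) (f g : ℕ → ℤ), Computable f ∧ Computable g ∧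
    (∀ s, (f s : ℝ) / 2 ^ s ≤ (f (s + 1) : ℝ) / 2 ^ (s + 1)) ∧
    (∀ s, (g s : ℝ) / 2 ^ s ≤ (g (s + 1) : ℝ) / 2 ^ (s + 1)) ∧
    Tendsto (fun s => (f s : ℝ) / 2 ^ s) atTop (nhds (realOfSeq X)) ∧
    Tendsto (fun s => (g s : ℝ) / 2 ^ s) atTop (nhds (realOfSeq Y)) ∧
    ∀ s, realOfSeq X - (f s : ℝ) / 2 ^ s ≤ (c : ℝ) * (realOfSeq Y - (g s : ℝ) / 2 ^ s)


/-- Solovay reducibility on sets of naturals, via their characteristic sequences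
viewed as binary expansions of reals. -/
noncomputable def SolovayLeSet (A B : Set ℕ) : Prop := SolovayLe (seqOfSet A) (seqOfSet B)

/-- `A` lies in the least Solovay degree of c.e. sets. -/
noncomputable def SolovayLeastSet (A : Set ℕ) : Prop :=
  ∀ Y : Set ℕ, CESet Y → SolovayLeSet A Y


attribute [fun_prop] Primrec
attribute [fun_prop] Primrec.id Primrec.const Primrec.comp Primrec.pair Primrec.fst Primrec.snd

namespace PR

variable {α β γ σ : Type*} [Primcodable α] [Primcodable β] [Primcodable γ] [Primcodable σ]

@[fun_prop] theorem fst {f : α → β × γ} (hf : Primrec f) : Primrec fun a => (f a).1 :=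
  Primrec.fst.comp hf
@[fun_prop] theorem snd {f : α → β × γ} (hf : Primrec f) : Primrec fun a => (f a).2 :=
  Primrec.snd.comp hf
@[fun_prop] theorem succ {f : α → ℕ} (hf : Primrec f) : Primrec fun a => Nat.succ (f a) :=
  Primrec.succ.comp hf
@[fun_prop] theorem add {f g : α → ℕ} (hf : Primrec f) (hg : Primrec g) :
    Primrec fun a => f a + g a := Primrec.nat_add.comp hf hg
@[fun_prop] theorem mul {f g : α → ℕ} (hf : Primrec f) (hg : Primrec g) :
    Primrec fun a => f a * g a := Primrec.nat_mul.comp hf hg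
@[fun_prop] theorem sub {f g : α → ℕ} (hf : Primrec f) (hg : Primrec g) :
    Primrec fun a => f a - g a := Primrec.nat_sub.comp hf hg
@[fun_prop] theorem div {f g : α → ℕ} (hf : Primrec f) (hg : Primrec g) :
    Primrec fun a => f a / g a := Primrec.nat_div.comp hf hg
@[fun_prop] theorem mod {f g : α → ℕ} (hf : Primrec f) (hg : Primrec g) :
    Primrec fun a => f a % g a := Primrec.nat_mod.comp hf hg
@[fun_prop] theorem pow {f g : α → ℕ} (hf : Primrec f) (hg : Primrec g) :
    Primrec fun a => f a ^ g a := by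
  have : Primrec₂ fun a b : ℕ => a ^ b := by
    have h := Primrec.nat_iff.2 Nat.Primrec.pow
    have h2 : Primrec fun p : ℕ × ℕ => Nat.pair p.1 p.2 := Primrec₂.natPair
    refine (h.comp h2).of_eq ?_
    intro n; simp
  exact this.comp hf hg
@[fun_prop] theorem pair {f g : α → ℕ} (hf : Primrec f) (hg : Primrec g) :
    Primrec fun a => Nat.pair (f a) (g a) := Primrec₂.natPair.comp hf hg
@[fun_prop] theorem unpair {f : α → ℕ} (hf : Primrec f) :
    Primrec fun a => Nat.unpair (f a) := Primrec.unpair.comp hf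
@[fun_prop] theorem min {f g : α → ℕ} (hf : Primrec f) (hg : Primrec g) :
    Primrec fun a => Min.min (f a) (g a) := Primrec.nat_min.comp hf hg
@[fun_prop] theorem max {f g : α → ℕ} (hf : Primrec f) (hg : Primrec g) :
    Primrec fun a => Max.max (f a) (g a) := Primrec.nat_max.comp hf hg

@[fun_prop] theorem band {f g : α → Bool} (hf : Primrec f) (hg : Primrec g) :
    Primrec fun a => (f a && g a) := Primrec.and.comp hf hg
@[fun_prop] theorem bor {f g : α → Bool} (hf : Primrec f) (hg : Primrec g) :
    Primrec fun a => (f a || g a) := Primrec.or.comp hf hg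
@[fun_prop] theorem bnot {f : α → Bool} (hf : Primrec f) :
    Primrec fun a => (! f a) := Primrec.not.comp hf
@[fun_prop] theorem cond {c : α → Bool} {f g : α → σ} (hc : Primrec c) (hf : Primrec f)
    (hg : Primrec g) : Primrec fun a => cond (c a) (f a) (g a) := Primrec.cond hc hf hg

@[fun_prop] theorem dle {f g : α → ℕ} (hf : Primrec f) (hg : Primrec g) :
    Primrec fun a => decide (f a ≤ g a) :=
  ((Primrec.nat_le.comp hf hg).decide).of_eq fun a => by congr
@[fun_prop] theorem dlt {f g : α → ℕ} (hf : Primrec f) (hg : Primrec g) :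
    Primrec fun a => decide (f a < g a) :=
  ((Primrec.nat_lt.comp hf hg).decide).of_eq fun a => by congr
@[fun_prop] theorem deq [DecidableEq β] {f g : α → β} (hf : Primrec f) (hg : Primrec g) :
    Primrec fun a => decide (f a = g a) :=
  ((Primrec.eq.comp hf hg).decide).of_eq fun a => by congr

@[fun_prop] theorem some {f : α → β} (hf : Primrec f) : Primrec fun a => Option.some (f a) :=
  Primrec.option_some.comp hf
@[fun_prop] theorem isSome {f : α → Option β} (hf : Primrec f) :
    Primrec fun a => (f a).isSome := Primrec.option_isSome.comp hf
@[fun_prop] theorem getD {f : α → Option β} {g : α → β} (hf : Primrec f) (hg : Primrec g) :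
    Primrec fun a => (f a).getD (g a) := Primrec.option_getD.comp hf hg
@[fun_prop] theorem omap {f : α → Option β} {g : α → β → γ} (hf : Primrec f)
    (hg : Primrec fun p : α × β => g p.1 p.2) :
    Primrec fun a => (f a).map (fun b => g a b) := Primrec.option_map hf hg
@[fun_prop] theorem obind {f : α → Option β} {g : α → β → Option γ} (hf : Primrec f)
    (hg : Primrec fun p : α × β => g p.1 p.2) :
    Primrec fun a => (f a).bind (fun b => g a b) := Primrec.option_bind hf hg
@[fun_prop] theorem oelim {f : α → Option β} {d : α → γ} {g : α → β → γ} (hf : Primrec f)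
    (hd : Primrec d) (hg : Primrec fun p : α × β => g p.1 p.2) :
    Primrec fun a => (f a).elim (d a) (fun b => g a b) :=
  (Primrec.option_casesOn (o := f) (f := d) (g := g) hf hd hg).of_eq fun a => by
    cases f a <;> rfl

@[fun_prop] theorem encode {f : α → β} (hf : Primrec f) :
    Primrec fun a => Encodable.encode (f a) := Primrec.encode.comp hf
@[fun_prop] theorem decode {f : α → ℕ} (hf : Primrec f) :
    Primrec fun a => (Encodable.decode (f a) : Option β) := Primrec.decode.comp hf
@[fun_prop] theorem ofNat {δ : Type*} [Denumerable δ] {f : α → ℕ} (hf : Primrec f) :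
    Primrec fun a => (Denumerable.ofNat δ (f a)) := (Primrec.ofNat δ).comp hf

@[fun_prop] theorem cons {f : α → β} {g : α → List β} (hf : Primrec f) (hg : Primrec g) :
    Primrec fun a => f a :: g a := Primrec.list_cons.comp hf hg
@[fun_prop] theorem append {f g : α → List β} (hf : Primrec f) (hg : Primrec g) :
    Primrec fun a => f a ++ g a := Primrec.list_append.comp hf hg
@[fun_prop] theorem length {f : α → List β} (hf : Primrec f) :
    Primrec fun a => (f a).length := Primrec.list_length.comp hf
@[fun_prop] theorem lmap {f : α → List β} {g : α → β → γ} (hf : Primrec f)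
    (hg : Primrec fun p : α × β => g p.1 p.2) :
    Primrec fun a => (f a).map (fun b => g a b) := Primrec.list_map hf hg
@[fun_prop] theorem lflatMap {f : α → List β} {g : α → β → List γ} (hf : Primrec f)
    (hg : Primrec fun p : α × β => g p.1 p.2) :
    Primrec fun a => (f a).flatMap (fun b => g a b) := Primrec.list_flatMap hf hg
@[fun_prop] theorem lfilterMap {f : α → List β} {g : α → β → Option γ} (hf : Primrec f)
    (hg : Primrec fun p : α × β => g p.1 p.2) :
    Primrec fun a => (f a).filterMap (fun b => g a b) := Primrec.listFilterMap hf hg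
@[fun_prop] theorem range {f : α → ℕ} (hf : Primrec f) :
    Primrec fun a => List.range (f a) := Primrec.list_range.comp hf
@[fun_prop] theorem getElemQ {f : α → List β} {g : α → ℕ} (hf : Primrec f) (hg : Primrec g) :
    Primrec fun a => (f a)[g a]? := Primrec.list_getElem?.comp hf hg
@[fun_prop] theorem headQ {f : α → List β} (hf : Primrec f) :
    Primrec fun a => (f a).head? := Primrec.list_head?.comp hf
@[fun_prop] theorem tail {f : α → List β} (hf : Primrec f) :
    Primrec fun a => (f a).tail := Primrec.list_tail.comp hf
@[fun_prop] theorem take {f : α → List β} {g : α → ℕ} (hf : Primrec f) (hg : Primrec g) :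
    Primrec fun a => (f a).take (g a) := Primrec.list_take.comp hg hf
@[fun_prop] theorem foldl {f : α → List β} {g : α → σ} {h : α → σ → β → σ} (hf : Primrec f)
    (hg : Primrec g) (hh : Primrec fun p : α × σ × β => h p.1 p.2.1 p.2.2) :
    Primrec fun a => (f a).foldl (fun s b => h a s b) (g a) :=
  Primrec.list_foldl (f := f) (g := g) (h := fun a p => h a p.1 p.2) hf hg hh

@[fun_prop] theorem lany {f : α → List β} {g : α → β → Bool} (hf : Primrec f)
    (hg : Primrec fun p : α × β => g p.1 p.2) :
    Primrec fun a => (f a).any (fun b => g a b) := by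
  have : Primrec fun a => (f a).foldl (fun s b => s || g a b) false := by fun_prop
  refine this.of_eq fun a => ?_
  have : ∀ (l : List β) (c : Bool), l.foldl (fun s b => s || g a b) c = (c || l.any (g a)) := by
    intro l; induction l with
    | nil => simp
    | cons x l ih => intro c; simp [ih, Bool.or_assoc]
  simp [this]
@[fun_prop] theorem lall {f : α → List β} {g : α → β → Bool} (hf : Primrec f)
    (hg : Primrec fun p : α × β => g p.1 p.2) :
    Primrec fun a => (f a).all (fun b => g a b) := by
  have : Primrec fun a => (f a).foldl (fun s b => s && g a b) true := by fun_prop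
  refine this.of_eq fun a => ?_
  have : ∀ (l : List β) (c : Bool), l.foldl (fun s b => s && g a b) c = (c && l.all (g a)) := by
    intro l; induction l with
    | nil => simp
    | cons x l ih => intro c; simp [ih, Bool.and_assoc]
  simp [this]
@[fun_prop] theorem lfilter {f : α → List β} {g : α → β → Bool} (hf : Primrec f)
    (hg : Primrec fun p : α × β => g p.1 p.2) :
    Primrec fun a => (f a).filter (fun b => g a b) := by
  have : Primrec fun a => (f a).filterMap (fun b => _root_.cond (g a b) (Option.some b) none) := by
    fun_prop
  refine this.of_eq fun a => ?_
  induction f a with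
  | nil => simp
  | cons x l ih => cases h : g a x <;> simp [h, ih]
@[fun_prop] theorem lsum {f : α → List ℕ} (hf : Primrec f) :
    Primrec fun a => (f a).sum := by
  have : Primrec fun a => (f a).foldl (fun s b => s + b) 0 := by fun_prop
  refine this.of_eq fun a => ?_
  rw [← List.sum_eq_foldl]
@[fun_prop] theorem lfind {f : α → List β} {g : α → β → Bool} (hf : Primrec f)
    (hg : Primrec fun p : α × β => g p.1 p.2) :
    Primrec fun a => (f a).find? (fun b => g a b) := by
  have : Primrec fun a => ((f a).filter (fun b => g a b)).head? := by fun_prop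
  refine this.of_eq fun a => by rw [List.head?_filter]
@[fun_prop] theorem replicate {f : α → ℕ} {g : α → β} (hf : Primrec f) (hg : Primrec g) :
    Primrec fun a => List.replicate (f a) (g a) := by
  have : Primrec fun a => (List.range (f a)).map (fun _ => g a) := by fun_prop
  refine this.of_eq fun a => by simp
@[fun_prop] theorem natRec {f : α → ℕ} {g : α → σ} {h : α → ℕ → σ → σ} (hf : Primrec f)
    (hg : Primrec g) (hh : Primrec fun p : α × ℕ × σ => h p.1 p.2.1 p.2.2) :
    Primrec fun a => (Nat.rec (g a) (fun n s => h a n s) (f a) : σ) :=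
  Primrec.nat_rec' (f := f) (g := g) (h := fun a p => h a p.1 p.2) hf hg hh

@[fun_prop] theorem evaln {k : α → ℕ} {c : α → Nat.Partrec.Code} {n : α → ℕ}
    (hk : Primrec k) (hc : Primrec c) (hn : Primrec n) :
    Primrec fun a => Nat.Partrec.Code.evaln (k a) (c a) (n a) :=
  Nat.Partrec.Code.primrec_evaln.comp ((hk.pair hc).pair hn)

end PR


/-! ### Enumerations -/

/-- Stage enumeration of the domain of a code. -/
def en (c : Nat.Partrec.Code) (s n : ℕ) : Bool := (Nat.Partrec.Code.evaln s c n).isSome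

@[fun_prop] theorem en_prim {α : Type*} [Primcodable α] {k : α → ℕ} {c : α → Nat.Partrec.Code}
    {n : α → ℕ} (hk : Primrec k) (hc : Primrec c) (hn : Primrec n) :
    Primrec fun a => en (c a) (k a) (n a) := by unfold en; fun_prop

theorem en_mono {c : Nat.Partrec.Code} {s t n : ℕ} (h : s ≤ t) (hs : en c s n = true) :
    en c t n = true := by
  unfold en at *
  obtain ⟨x, hx⟩ := Option.isSome_iff_exists.1 hs
  exact Option.isSome_iff_exists.2 ⟨x, Nat.Partrec.Code.evaln_mono h hx⟩

theorem en_bound {c : Nat.Partrec.Code} {s n : ℕ} (hs : en c s n = true) : n < s := by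
  obtain ⟨x, hx⟩ := Option.isSome_iff_exists.1 hs
  exact Nat.Partrec.Code.evaln_bound hx

theorem en_dom (c : Nat.Partrec.Code) (n : ℕ) : (∃ s, en c s n = true) ↔ (c.eval n).Dom := by
  constructor
  · rintro ⟨s, hs⟩
    obtain ⟨x, hx⟩ := Option.isSome_iff_exists.1 hs
    exact Part.dom_iff_mem.2 ⟨x, Nat.Partrec.Code.evaln_sound hx⟩
  · intro h
    obtain ⟨x, hx⟩ := Part.dom_iff_mem.1 h
    obtain ⟨k, hk⟩ := Nat.Partrec.Code.evaln_complete.1 hx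
    exact ⟨k, Option.isSome_iff_exists.2 ⟨x, hk⟩⟩

theorem CESet.code {A : Set ℕ} (h : CESet A) :
    ∃ c : Nat.Partrec.Code, ∀ n, n ∈ A ↔ ∃ s, en c s n = true := by
  obtain ⟨f, hf, h⟩ := h
  obtain ⟨c, rfl⟩ := Nat.Partrec.Code.exists_code.1 hf
  exact ⟨c, fun n => by rw [h, en_dom]⟩

theorem ceset_of_code (c : Nat.Partrec.Code) : CESet {n | ∃ s, en c s n = true} :=
  ⟨c.eval, Nat.Partrec.Code.exists_code.2 ⟨c, rfl⟩, fun n => en_dom c n⟩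

theorem ceset_of_computable {e : ℕ → ℕ → Bool} (he : Computable fun p : ℕ × ℕ => e p.1 p.2)
    {A : Set ℕ} (h : ∀ n, n ∈ A ↔ ∃ s, e s n = true) : CESet A := by
  refine ⟨fun n => Nat.rfind (PFun.lift fun s => e s n), ?_, ?_⟩
  · refine Partrec.nat_iff.1 (Partrec.rfind (p := fun n => (PFun.lift fun s => e s n)) ?_)
    exact (Computable.partrec (he.comp (Computable.pair Computable.snd Computable.fst)))
  · intro n
    rw [h]
    refine Iff.trans ?_ Nat.rfind_dom.symm
    constructor
    · rintro ⟨s, hs⟩; exact ⟨s, by simp [PFun.lift, hs], fun _ => by simp [PFun.lift]⟩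
    · rintro ⟨s, hs, -⟩; exact ⟨s, (Part.mem_some_iff.1 hs).symm⟩

theorem ceset_of_primrec {e : ℕ → ℕ → Bool} (he : Primrec fun p : ℕ × ℕ => e p.1 p.2)
    {A : Set ℕ} (h : ∀ n, n ∈ A ↔ ∃ s, e s n = true) : CESet A :=
  ceset_of_computable he.to_comp h

/-! ### Integers, and dyadic values -/

theorem prim_int_ofNat : Primrec (fun n : ℕ => (n : ℤ)) := by
  have h : Primrec fun n : ℕ => Denumerable.ofNat ℤ (2 * n) := by fun_prop
  refine h.of_eq fun n => ?_
  apply Encodable.encode_injective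
  rw [Denumerable.encode_ofNat]
  rfl

theorem prim_int_pred : Primrec (fun n : ℕ => (n : ℤ) - 1) := by
  have h := Primrec.cond (c := fun n : ℕ => decide (n = 0)) (f := fun _ => (-1 : ℤ))
    (g := fun n => ((n - 1 : ℕ) : ℤ)) (by fun_prop) (Primrec.const _)
    (prim_int_ofNat.comp (show Primrec fun n : ℕ => n - 1 by fun_prop))
  refine h.of_eq fun n => ?_
  cases n <;> simp

theorem int_enc (z : ℤ) : Encodable.encode z = if 0 ≤ z then 2 * z.toNat
    else 2 * ((-z).toNat - 1) + 1 := by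
  cases z with
  | ofNat n => simp; rfl
  | negSucc n =>
    have : ¬ (0 ≤ Int.negSucc n) := by simp
    rw [if_neg this]
    have : (-(Int.negSucc n)).toNat - 1 = n := by simp [Int.neg_negSucc]
    rw [this]; rfl

theorem prim_toNat : Primrec (fun z : ℤ => z.toNat) := by
  have h : Primrec fun z : ℤ => cond (decide ((Encodable.encode z) % 2 = 0))
    (Encodable.encode z / 2) 0 := by fun_prop
  refine h.of_eq fun z => ?_
  rw [int_enc]
  split_ifs with h
  · simp
  · have : (2 * ((-z).toNat - 1) + 1) % 2 = 1 := by omega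
    simp only [this]; simp; omega

theorem prim_negToNat : Primrec (fun z : ℤ => (-z).toNat) := by
  have h : Primrec fun z : ℤ => cond (decide ((Encodable.encode z) % 2 = 0))
    0 (Encodable.encode z / 2 + 1) := by fun_prop
  refine h.of_eq fun z => ?_
  rw [int_enc]
  split_ifs with h
  · simp; omega
  · have h1 : (2 * ((-z).toNat - 1) + 1) % 2 = 1 := by omega
    simp only [h1]; simp; omega

/-- value of the first `n` bits as a natural number. -/
def val (e : ℕ → Bool) : ℕ → ℕ
  | 0 => 0
  | n + 1 => 2 * val e n + cond (e n) 1 0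

@[fun_prop] theorem val_prim {α : Type*} [Primcodable α] {e : α → ℕ → Bool} {n : α → ℕ}
    (he : Primrec fun p : α × ℕ => e p.1 p.2) (hn : Primrec n) :
    Primrec fun a => val (e a) (n a) := by
  have h : Primrec fun a => (Nat.rec 0 (fun i s => 2 * s + cond (e a i) 1 0) (n a) : ℕ) := by
    fun_prop
  refine h.of_eq fun a => ?_
  induction n a with
  | zero => rfl
  | succ k ih => simp only [ih, val]

theorem val_comp {α : Type*} [Primcodable α] {e : α → ℕ → Bool} {n : α → ℕ}
    (he : Computable fun p : α × ℕ => e p.1 p.2) (hn : Computable n) :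
    Computable fun a => val (e a) (n a) := by
  have h : Computable fun a => (Nat.rec 0 (fun i s => 2 * s + cond (e a i) 1 0) (n a) : ℕ) := by
    refine Computable.nat_rec (h := fun a q => 2 * q.2 + cond (e a q.1) 1 0) hn
      (Computable.const 0) ?_
    have h1 : Primrec fun q : ℕ × Bool => 2 * q.1 + cond q.2 1 0 := by fun_prop
    refine h1.to_comp.comp (Computable.pair (Computable.snd.comp Computable.snd) ?_)
    exact he.comp (Computable.pair Computable.fst (Computable.fst.comp Computable.snd))
  refine h.of_eq fun a => ?_
  induction n a with
  | zero => rfl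
  | succ k ih => simp only [ih, val]

noncomputable def bt (e : ℕ → Bool) (i : ℕ) : ℝ := cond (e i) ((2 : ℝ) ^ (i + 1))⁻¹ 0

theorem bt_nonneg (e : ℕ → Bool) (i : ℕ) : 0 ≤ bt e i := by
  unfold bt; cases e i <;> simp
theorem bt_le (e : ℕ → Bool) (i : ℕ) : bt e i ≤ 1 / 2 / 2 ^ i := by
  unfold bt; cases e i
  · simp only [cond_false]; positivity
  · simp only [cond_true]; rw [pow_succ]; field_simp; rfl

theorem bt_summable (e : ℕ → Bool) : Summable (bt e) :=
  Summable.of_nonneg_of_le (bt_nonneg e) (bt_le e) (summable_geometric_two' 1)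

theorem real_eq (e : ℕ → Bool) : realOfSeq e = ∑' i, bt e i := rfl

theorem val_sum (e : ℕ → Bool) (n : ℕ) : (val e n : ℝ) / 2 ^ n = ∑ i ∈ Finset.range n, bt e i := by
  induction n with
  | zero => simp [val]
  | succ n ih =>
    rw [Finset.sum_range_succ, ← ih]; simp only [val, bt]
    cases e n <;> simp [pow_succ] <;> field_simp

theorem real_split (e : ℕ → Bool) (n : ℕ) :
    realOfSeq e = (val e n : ℝ) / 2 ^ n + ∑' i, bt e (i + n) := by
  rw [real_eq, val_sum, (bt_summable e).sum_add_tsum_nat_add]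

theorem val_le_real (e : ℕ → Bool) (n : ℕ) : (val e n : ℝ) / 2 ^ n ≤ realOfSeq e := by
  rw [real_split e n]
  have : 0 ≤ ∑' i, bt e (i + n) := tsum_nonneg fun i => bt_nonneg _ _
  linarith

theorem tail_le (e : ℕ → Bool) (n : ℕ) : ∑' i, bt e (i + n) ≤ 1 / 2 ^ n := by
  have h1 : ∑' i, bt e (i + n) ≤ ∑' i : ℕ, (1 / 2 ^ n : ℝ) / 2 / 2 ^ i := by
    refine Summable.tsum_le_tsum ?_ ((summable_nat_add_iff n).2 (bt_summable e))
      (summable_geometric_two' _)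
    intro i
    refine (bt_le e (i + n)).trans (le_of_eq ?_)
    rw [pow_add]; field_simp
  rwa [tsum_geometric_two'] at h1

theorem real_le_val (e : ℕ → Bool) (n : ℕ) : realOfSeq e ≤ ((val e n : ℝ) + 1) / 2 ^ n := by
  rw [real_split e n, add_div]
  have := tail_le e n
  linarith

theorem real_bdd (e : ℕ → Bool) (n : ℕ) (h : ∀ i, n ≤ i → e i = false) :
    realOfSeq e = (val e n : ℝ) / 2 ^ n := by
  rw [real_split e n]
  have : ∀ i, bt e (i + n) = 0 := by intro i; simp [bt, h (i + n) (by omega)]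
  simp [this]

theorem bt_mono {e e' : ℕ → Bool} {i : ℕ} (h : e i = true → e' i = true) : bt e i ≤ bt e' i := by
  cases h1 : e i
  · have : bt e i = 0 := by simp [bt, h1]
    rw [this]; exact bt_nonneg _ _
  · simp [bt, h1, h h1]

theorem real_mono {e e' : ℕ → Bool} (h : ∀ i, e i = true → e' i = true) :
    realOfSeq e ≤ realOfSeq e' :=
  Summable.tsum_le_tsum (fun i => bt_mono (h i)) (bt_summable e) (bt_summable e')

theorem val_congr {e e' : ℕ → Bool} {n : ℕ} (h : ∀ i < n, e i = e' i) : val e n = val e' n := by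
  induction n with
  | zero => rfl
  | succ n ih => simp only [val]; rw [ih fun i hi => h i (by omega), h n (by omega)]

theorem real_agree {e e' : ℕ → Bool} {n : ℕ} (h : ∀ i < n, e i = e' i) :
    realOfSeq e' - realOfSeq e ≤ 1 / 2 ^ n := by
  have h1 := real_le_val e' n
  have h2 := val_le_real e n
  rw [val_congr h] at h2
  rw [add_div] at h1
  linarith

theorem agree_of_real {e e' : ℕ → Bool} (hm : ∀ i, e i = true → e' i = true) {n : ℕ}
    (h : realOfSeq e' - realOfSeq e < 1 / 2 ^ n) : ∀ i < n, e i = e' i := by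
  intro i hi
  by_contra hne
  have he : e i = false := by
    cases h1 : e i
    · rfl
    · exact absurd (h1.trans (hm i h1).symm) hne
  have he' : e' i = true := by
    cases h1 : e' i
    · exact absurd (he.trans h1.symm) hne
    · rfl
  have hs := ((bt_summable e').sub (bt_summable e)).sum_le_tsum {i}
    (fun j _ => sub_nonneg.2 (bt_mono (hm j)))
  rw [(bt_summable e').tsum_sub (bt_summable e), ← real_eq, ← real_eq] at hs
  simp only [Finset.sum_singleton] at hs
  have h1 : bt e' i - bt e i = 1 / 2 ^ (i + 1) := by simp [bt, he, he']
  have h2 : (1 : ℝ) / 2 ^ n ≤ 1 / 2 ^ (i + 1) := by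
    apply one_div_le_one_div_of_le (by positivity)
    exact pow_le_pow_right₀ (by norm_num) hi
  linarith

/-- `e` is a computable, monotone, bounded enumeration of `A`. -/
structure Enum (e : ℕ → ℕ → Bool) (A : Set ℕ) : Prop where
  comp : Computable fun p : ℕ × ℕ => e p.1 p.2
  mono : ∀ s t n, s ≤ t → e s n = true → e t n = true
  bdd : ∀ s n, e s n = true → n < s
  mem : ∀ n, n ∈ A ↔ ∃ s, e s n = true

theorem enum_code (c : Nat.Partrec.Code) {A : Set ℕ} (h : ∀ n, n ∈ A ↔ ∃ s, en c s n = true) :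
    Enum (en c) A :=
  ⟨Primrec.to_comp (by fun_prop), fun _ _ _ h => en_mono h, fun _ _ h => en_bound h, h⟩

theorem Enum.le {e : ℕ → ℕ → Bool} {A : Set ℕ} (h : Enum e A) (s i : ℕ) (hs : e s i = true) :
    seqOfSet A i = true := by
  have : i ∈ A := (h.mem i).2 ⟨s, hs⟩
  simpa [seqOfSet] using this

/-- finite stabilization -/
theorem Enum.stab {e : ℕ → ℕ → Bool} {A : Set ℕ} (h : Enum e A) (n : ℕ) :
    ∃ s, ∀ t, s ≤ t → ∀ i < n, e t i = seqOfSet A i := by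
  induction n with
  | zero => exact ⟨0, by simp⟩
  | succ n ih =>
    obtain ⟨s, hs⟩ := ih
    by_cases hn : n ∈ A
    · obtain ⟨s', hs'⟩ := (h.mem n).1 hn
      refine ⟨max s s', fun t ht i hi => ?_⟩
      rcases Nat.lt_succ_iff_lt_or_eq.1 hi with hi | rfl
      · exact hs t (le_trans (le_max_left _ _) ht) i hi
      · rw [h.mono _ _ _ (le_trans (le_max_right _ _) ht) hs']; simp [seqOfSet, hn]
    · refine ⟨s, fun t ht i hi => ?_⟩
      rcases Nat.lt_succ_iff_lt_or_eq.1 hi with hi | rfl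
      · exact hs t ht i hi
      · have : e t i = false := by
          by_contra hh
          exact hn ((h.mem i).2 ⟨t, by simpa using hh⟩)
        rw [this]; simp [seqOfSet, hn]

theorem Enum.real (e : ℕ → ℕ → Bool) (A : Set ℕ) (h : Enum e A) (s : ℕ) :
    realOfSeq (e s) = (val (e s) s : ℝ) / 2 ^ s := by
  apply real_bdd
  intro i hi
  by_contra hh
  have := h.bdd s i (by simpa using hh)
  omega

theorem Enum.lim {e : ℕ → ℕ → Bool} {A : Set ℕ} (h : Enum e A) {r : ℝ}
    (hr : r < realOfSeq (seqOfSet A)) : ∃ s, r ≤ realOfSeq (e s) := by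
  obtain ⟨n, hn⟩ := exists_pow_lt_of_lt_one (sub_pos.2 hr) (by norm_num : (1 / 2 : ℝ) < 1)
  obtain ⟨s, hs⟩ := h.stab n
  have := real_agree (hs s le_rfl)
  rw [one_div_pow] at hn
  exact ⟨s, by linarith⟩

theorem computable_search {p : ℕ → ℕ → Bool} (hp : Computable fun q : ℕ × ℕ => p q.1 q.2)
    (h : ∀ s, ∃ u, p s u = true) : ∃ v : ℕ → ℕ, Computable v ∧ ∀ s, p s (v s) = true := by
  refine ⟨fun s => Nat.find (h s), ?_, fun s => Nat.find_spec (h s)⟩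
  have h1 : Partrec fun s => Nat.rfind (PFun.lift fun u => p s u) :=
    Partrec.rfind (p := fun n => (PFun.lift fun u => p n u)) (Computable.partrec hp)
  refine h1.of_eq fun s => ?_
  refine Part.eq_some_iff.2 ?_
  refine Nat.mem_rfind.2 ⟨?_, ?_⟩
  · exact Part.mem_some_iff.2 (Nat.find_spec (h s)).symm
  · intro m hm
    refine Part.mem_some_iff.2 ?_
    have := Nat.find_min (h s) hm
    simpa using this

/-- the key combinatorial consequence of Solovay reducibility -/
def Star (eX eA : ℕ → ℕ → Bool) (X A : Set ℕ) (c : ℕ) (v : ℕ → ℕ) : Prop :=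
  ∀ s n, n ≤ s → (∀ i < n + c, eA s i = seqOfSet A i) → ∀ i < n, eX (v s) i = seqOfSet X i

theorem star_of_solovay {eX eA : ℕ → ℕ → Bool} {X A : Set ℕ} (hX : Enum eX X) (hA : Enum eA A)
    (h : SolovayLeSet X A) : ∃ c v, Computable v ∧ Star eX eA X A c v := by
  obtain ⟨c0, f, g, hf, hg, hfm, hgm, hfl, hgl, hfg⟩ := h
  set RX := realOfSeq (seqOfSet X) with hRX
  set RA := realOfSeq (seqOfSet A) with hRA
  have hfle : ∀ s, (f s : ℝ) / 2 ^ s ≤ RX := (monotone_nat_of_le_succ hfm).ge_of_tendsto hfl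
  obtain ⟨c, hc⟩ : ∃ c, c = c0 + 2 := ⟨_, rfl⟩
  -- first search
  obtain ⟨u, hu, hu2⟩ : ∃ u : ℕ → ℕ, Computable u ∧ ∀ s, realOfSeq (eA s) - 1 / 2 ^ (s + c) ≤
      (g (u s) : ℝ) / 2 ^ (u s) := by
    let p : ℕ → ℕ → Bool := fun s u => decide (val (eA s) s * 2 ^ c * 2 ^ u +
      (-(g u)).toNat * 2 ^ (s + c) ≤ 2 ^ u + (g u).toNat * 2 ^ (s + c))
    have hiff : ∀ s u, p s u = true ↔ realOfSeq (eA s) - 1 / 2 ^ (s + c) ≤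
      (g u : ℝ) / 2 ^ u := by
      intro s u
      rw [hA.real]
      have h1 : ((g u : ℤ) : ℝ) = ((g u).toNat : ℝ) - ((-(g u)).toNat : ℝ) := by
        have : (g u) = ((g u).toNat : ℤ) - ((-(g u)).toNat : ℤ) := by omega
        exact_mod_cast this
      rw [h1]
      simp only [p, decide_eq_true_eq]
      rw [← Nat.cast_le (α := ℝ)]
      push_cast
      have e1 : (val (eA s) s : ℝ) / 2 ^ s - 1 / 2 ^ (s + c) =
        ((val (eA s) s : ℝ) * 2 ^ c - 1) / 2 ^ (s + c) := by
        rw [pow_add]; field_simp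
      rw [e1, div_le_div_iff₀ (by positivity) (by positivity)]
      constructor <;> intro h <;> linarith
    have hp : Computable fun q : ℕ × ℕ => p q.1 q.2 := by
      have h1 : Primrec fun q : (ℕ × ℕ) × ℕ × ℤ => decide (q.2.1 * 2 ^ c * 2 ^ q.1.2 +
        (-(q.2.2)).toNat * 2 ^ (q.1.1 + c) ≤ 2 ^ q.1.2 + (q.2.2).toNat * 2 ^ (q.1.1 + c)) := by
        have h1 := prim_toNat
        have h2 := prim_negToNat
        have h3 : Primrec fun q : (ℕ × ℕ) × ℕ × ℤ => (-(q.2.2)).toNat :=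
          h2.comp (by fun_prop)
        have h4 : Primrec fun q : (ℕ × ℕ) × ℕ × ℤ => ((q.2.2)).toNat :=
          h1.comp (by fun_prop)
        fun_prop
      have h5 : Computable fun q : ℕ × ℕ => val (eA q.1) q.1 :=
        val_comp (e := fun q : ℕ × ℕ => eA q.1) (n := fun q => q.1)
          (hA.comp.comp (Computable.pair (Computable.fst.comp Computable.fst) Computable.snd))
          Computable.fst
      have h6 : Computable fun q : ℕ × ℕ => g q.2 := hg.comp Computable.snd
      have h7 : Computable fun q : ℕ × ℕ => (q, val (eA q.1) q.1, g q.2) :=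
        Computable.pair Computable.id (Computable.pair h5 h6)
      exact (h1.to_comp.comp h7).of_eq fun q => by simp only [p]
    obtain ⟨u, hu, hu2⟩ := computable_search hp (fun s => by
      have h1 : realOfSeq (eA s) - 1 / 2 ^ (s + c) < RA := by
        have := real_mono (hA.le s)
        have h2 : (0 : ℝ) < 1 / 2 ^ (s + c) := by positivity
        linarith
      obtain ⟨u, hu⟩ := (hgl.eventually (lt_mem_nhds h1)).exists
      exact ⟨u, (hiff s u).2 hu.le⟩)
    exact ⟨u, hu, fun s => (hiff _ _).1 (hu2 s)⟩
  obtain ⟨v, hv, hv2⟩ : ∃ v : ℕ → ℕ, Computable v ∧ ∀ s, (f (u s) : ℝ) / 2 ^ (u s) -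
      1 / 2 ^ (s + 1) ≤ realOfSeq (eX (v s)) := by
    let p : ℕ → ℕ → Bool := fun s w => decide (
      (f (u s)).toNat * 2 ^ (s + 1) * 2 ^ w ≤
      2 ^ (u s) * 2 ^ w + (-(f (u s))).toNat * 2 ^ (s + 1) * 2 ^ w +
        val (eX w) w * 2 ^ (u s) * 2 ^ (s + 1))
    have hiff : ∀ s w, p s w = true ↔ (f (u s) : ℝ) / 2 ^ (u s) -
      1 / 2 ^ (s + 1) ≤ realOfSeq (eX w) := by
      intro s w
      rw [hX.real]
      have h1 : ((f (u s) : ℤ) : ℝ) = ((f (u s)).toNat : ℝ) - ((-(f (u s))).toNat : ℝ) := by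
        have : (f (u s)) = ((f (u s)).toNat : ℤ) - ((-(f (u s))).toNat : ℤ) := by omega
        exact_mod_cast this
      rw [h1]
      simp only [p, decide_eq_true_eq]
      rw [← Nat.cast_le (α := ℝ)]
      push_cast
      rw [div_sub_div _ _ (by positivity) (by positivity),
        div_le_div_iff₀ (by positivity) (by positivity)]
      constructor <;> intro h <;> linarith
    have hp : Computable fun q : ℕ × ℕ => p q.1 q.2 := by
      have h1 : Primrec fun q : (ℕ × ℕ) × (ℕ × ℤ) × ℕ => decide (
        (q.2.1.2).toNat * 2 ^ (q.1.1 + 1) * 2 ^ q.1.2 ≤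
        2 ^ (q.2.1.1) * 2 ^ q.1.2 + (-(q.2.1.2)).toNat * 2 ^ (q.1.1 + 1) * 2 ^ q.1.2 +
        q.2.2 * 2 ^ (q.2.1.1) * 2 ^ (q.1.1 + 1)) := by
        have h1 := prim_toNat
        have h2 := prim_negToNat
        have h3 : Primrec fun q : (ℕ × ℕ) × (ℕ × ℤ) × ℕ => (-(q.2.1.2)).toNat :=
          h2.comp (by fun_prop)
        have h4 : Primrec fun q : (ℕ × ℕ) × (ℕ × ℤ) × ℕ => ((q.2.1.2)).toNat :=
          h1.comp (by fun_prop)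
        fun_prop
      have h5 : Computable fun q : ℕ × ℕ => val (eX q.2) q.2 :=
        val_comp (e := fun q : ℕ × ℕ => eX q.2) (n := fun q => q.2)
          (hX.comp.comp (Computable.pair (Computable.snd.comp Computable.fst) Computable.snd))
          Computable.snd
      have h7 : Computable fun q : ℕ × ℕ => (q, (u q.1, f (u q.1)), val (eX q.2) q.2) :=
        Computable.pair Computable.id (Computable.pair
        (Computable.pair (hu.comp Computable.fst) (hf.comp (hu.comp Computable.fst))) h5)
      exact (h1.to_comp.comp h7).of_eq fun q => by simp only [p]
    obtain ⟨v, hv, hv2⟩ := computable_search hp (fun s => by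
      have h1 : (f (u s) : ℝ) / 2 ^ (u s) - 1 / 2 ^ (s + 1) < RX := by
        have := hfle (u s)
        have h2 : (0 : ℝ) < 1 / 2 ^ (s + 1) := by positivity
        linarith
      obtain ⟨w, hw⟩ := hX.lim h1
      exact ⟨w, (hiff s w).2 hw⟩)
    exact ⟨v, hv, fun s => (hiff _ _).1 (hv2 s)⟩
  refine ⟨c, v, hv, ?_⟩
  intro s n hn hagree
  refine agree_of_real (hX.le _) ?_
  have h1 := hv2 s
  have h2 := hfg (u s)
  have h3 := hu2 s
  have h4 := real_agree hagree
  rw [← hRX] at *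
  rw [← hRA] at *
  have h5 : (c0 : ℝ) * (RA - (g (u s) : ℝ) / 2 ^ (u s)) ≤
      (c0 : ℝ) * (1 / 2 ^ (n + c) + 1 / 2 ^ (n + c)) := by
    have h6 : (1 : ℝ) / 2 ^ (s + c) ≤ 1 / 2 ^ (n + c) := by
      apply one_div_le_one_div_of_le (by positivity)
      exact pow_le_pow_right₀ (by norm_num) (by omega)
    apply mul_le_mul_of_nonneg_left _ (Nat.cast_nonneg _)
    linarith
  have h7 : (c0 : ℝ) * (1 / 2 ^ (n + c) + 1 / 2 ^ (n + c)) < 1 / 2 ^ (n + 1) := by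
    have : (c0 : ℝ) < 2 ^ c0 := by exact_mod_cast c0.lt_two_pow_self
    rw [hc, ← add_assoc, pow_add, pow_add, pow_add]
    have e : (c0 : ℝ) * (1 / (2 ^ n * 2 ^ c0 * 2 ^ 2) + 1 / (2 ^ n * 2 ^ c0 * 2 ^ 2)) =
      (1 / (2 ^ n * 2 ^ 1)) * (c0 / 2 ^ c0) := by field_simp; ring
    rw [e]
    apply mul_lt_of_lt_one_right (by positivity)
    rw [div_lt_one (by positivity)]; exact this
  have h8 : (1 : ℝ) / 2 ^ (s + 1) ≤ 1 / 2 ^ (n + 1) := by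
    apply one_div_le_one_div_of_le (by positivity)
    exact pow_le_pow_right₀ (by norm_num) (by omega)
  have h9 : (1 : ℝ) / 2 ^ (n + 1) + 1 / 2 ^ (n + 1) = 1 / 2 ^ n := by
    rw [pow_succ]; field_simp; norm_num
  linarith

theorem least_of_computable {X : Set ℕ} (h : Computable (seqOfSet X)) : SolovayLeastSet X := by
  intro Y hY
  obtain ⟨c, hc⟩ := hY.code
  have hE := enum_code c hc
  refine ⟨1, fun s => (val (seqOfSet X) s : ℤ), fun s => (val (en c s) s : ℤ) - 1, ?_, ?_, ?_, ?_,
    ?_, ?_, ?_⟩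
  · exact prim_int_ofNat.to_comp.comp
      (val_comp (e := fun _ => seqOfSet X) (h.comp Computable.snd) Computable.id)
  · exact prim_int_pred.to_comp.comp (Primrec.to_comp (by fun_prop))
  · intro s
    have := val_sum (seqOfSet X) (s + 1)
    rw [Finset.sum_range_succ, ← val_sum] at this
    have h2 := bt_nonneg (seqOfSet X) s
    push_cast at *
    linarith
  · intro s
    have h0 : val (en c s) s ≤ val (en c (s + 1)) s := by
      have h1 := hE.real _ _ s
      have : (val (en c s) s : ℝ) / 2 ^ s ≤ (val (en c (s + 1)) s : ℝ) / 2 ^ s := by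
        rw [val_sum, val_sum]
        exact Finset.sum_le_sum fun i _ => bt_mono (hE.mono _ _ _ (by omega))
      rw [div_le_div_iff_of_pos_right (by positivity)] at this
      exact_mod_cast this
    have h1 : ((val (en c s) s : ℕ) : ℝ) ≤ (val (en c (s + 1)) s : ℕ) := by exact_mod_cast h0
    have h2 : (val (en c (s + 1)) (s + 1) : ℝ) ≥ 2 * (val (en c (s + 1)) s : ℕ) := by
      simp only [val]; push_cast
      have : (0 : ℝ) ≤ ((cond (en c (s + 1) s) 1 0 : ℕ) : ℝ) := Nat.cast_nonneg _
      linarith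
    push_cast
    rw [div_le_div_iff₀ (by positivity) (by positivity), pow_succ]
    have : (0 : ℝ) < 2 ^ s := by positivity
    nlinarith
  · have := (bt_summable (seqOfSet X)).hasSum.tendsto_sum_nat
    refine this.congr fun n => ?_
    rw [← val_sum]; push_cast; rfl
  · have hz : Tendsto (fun s : ℕ => (1 / 2 : ℝ) ^ s) atTop (nhds 0) :=
      tendsto_pow_atTop_nhds_zero_of_lt_one (by norm_num) (by norm_num)
    have hr : Tendsto (fun s => realOfSeq (en c s)) atTop (nhds (realOfSeq (seqOfSet Y))) := by
      refine tendsto_order.2 ⟨fun r hr => ?_, fun r hr => ?_⟩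
      · obtain ⟨r', h1, h2⟩ := exists_between hr
        obtain ⟨s, hs⟩ := hE.lim h2
        filter_upwards [eventually_ge_atTop s] with t ht
        have := real_mono (fun i => hE.mono s t i ht)
        linarith
      · filter_upwards with t
        have := real_mono (hE.le t)
        linarith
    have := hr.sub hz
    rw [sub_zero] at this
    refine this.congr fun s => ?_
    rw [hE.real, one_div_pow]; push_cast; rw [sub_div]
  · intro s
    have h1 := real_le_val (seqOfSet X) s
    have h2 := real_mono (hE.le s)
    rw [hE.real] at h2
    rw [add_div] at h1
    push_cast
    rw [sub_div]
    linarith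

theorem computable_of_least {A : Set ℕ} {eA : ℕ → ℕ → Bool} (hA : Enum eA A)
    (h : SolovayLeastSet A) : Computable (seqOfSet A) := by
  have h0 : CESet (∅ : Set ℕ) := ceset_of_primrec (e := fun _ _ => false) (by fun_prop) (by simp)
  have hE : Enum (fun _ _ => false) (∅ : Set ℕ) :=
    ⟨Primrec.to_comp (by fun_prop), by simp, by simp, by simp⟩
  obtain ⟨c, v, hv, hs⟩ := star_of_solovay hA hE (h ∅ h0)
  have : ∀ n, eA (v (n + 1)) n = seqOfSet A n := fun n =>
    hs (n + 1) (n + 1) le_rfl (by simp [seqOfSet]) n (by omega)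
  exact (hA.comp.comp (Computable.pair (hv.comp Computable.succ) Computable.id)).of_eq this

/-! ### The minimal pair construction -/

namespace MP

/-- history: for each past stage, the guess string and the enumerated number -/
abbrev Hist := List (Str × Option ℕ)

def inB (H : Hist) (x : ℕ) : Bool := H.any fun h => decide (h.2 = Option.some x)

/-- side `b` (true: even columns, false: odd columns) -/
def inS (b : Bool) (H : Hist) (x : ℕ) : Bool := decide (decide (x.unpair.1 % 2 = 0) = b) && inB H x

def agr (e e' : ℕ → Bool) (n : ℕ) : Bool := (List.range n).all fun i => decide (e i = e' i)

theorem agr_iff {e e' : ℕ → Bool} {n : ℕ} : agr e e' n = true ↔ ∀ i < n, e i = e' i := by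
  simp [agr]

def pre (τ σ : Str) : Bool := decide (σ.take τ.length = τ)

theorem pre_iff {τ σ : Str} : pre τ σ = true ↔ τ <+: σ := by
  rw [List.prefix_iff_eq_take]; simp [pre, eq_comm]

@[fun_prop] theorem inB_prim {α : Type*} [Primcodable α] {H : α → Hist} {x : α → ℕ}
    (hH : Primrec H) (hx : Primrec x) : Primrec fun a => inB (H a) (x a) := by
  unfold inB; fun_prop
@[fun_prop] theorem inS_prim {α : Type*} [Primcodable α] {b : α → Bool} {H : α → Hist} {x : α → ℕ}
    (hb : Primrec b) (hH : Primrec H) (hx : Primrec x) :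
    Primrec fun a => inS (b a) (H a) (x a) := by
  unfold inS; fun_prop
@[fun_prop] theorem agr_prim {α : Type*} [Primcodable α] {e e' : α → ℕ → Bool} {n : α → ℕ}
    (he : Primrec fun p : α × ℕ => e p.1 p.2) (he' : Primrec fun p : α × ℕ => e' p.1 p.2)
    (hn : Primrec n) : Primrec fun a => agr (e a) (e' a) (n a) := by
  unfold agr; fun_prop
@[fun_prop] theorem pre_prim {α : Type*} [Primcodable α] {σ τ : α → Str}
    (hσ : Primrec σ) (hτ : Primrec τ) : Primrec fun a => pre (σ a) (τ a) := by
  unfold pre; fun_prop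

def cX (e : ℕ) : Nat.Partrec.Code := Denumerable.ofNat _ e.unpair.1
def cV (e : ℕ) : Nat.Partrec.Code := Denumerable.ofNat _ e.unpair.2.unpair.1
def cC (e : ℕ) : ℕ := e.unpair.2.unpair.2

/-- the local test at an earlier expansionary stage `u` -/
def test1 (H : Hist) (e u w : ℕ) : Bool :=
  decide (w ≤ H.length) && (List.range (u + 2)).all fun n =>
    !(agr (inS true H) (inS true (H.take (u + 1))) (n + cC e) ||
      agr (inS false H) (inS false (H.take (u + 1))) (n + cC e)) ||
    agr (en (cX e) H.length) (en (cX e) w) n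

def test (H : Hist) (τ : Str) : Bool :=
  (List.range H.length).all fun u =>
    !(pre (τ ++ [true]) ((H[u]?.getD ([], Option.none)).1)) ||
    (Nat.Partrec.Code.evaln H.length (cV τ.length) (u + 1)).elim false
      fun w => test1 H τ.length u w

def delta (H : Hist) : Str :=
  Nat.rec [] (fun _ τ => τ ++ [test H τ]) H.length

def colUsed (H : Hist) (i : ℕ) : Bool :=
  H.any fun h => h.2.elim false fun y => decide (y.unpair.1 = i)

def elig (H : Hist) (δ : Str) (x : ℕ) : Bool :=
  decide (x.unpair.1 < H.length) && !(colUsed H x.unpair.1) &&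
  en (Denumerable.ofNat _ (x.unpair.1 / 2)) H.length x &&
  (List.range H.length).all fun u => (List.range x.unpair.1).all fun e =>
    !(decide (δ[e]? = Option.some false) && pre (δ.take e ++ [true]) ((H[u]?.getD ([], Option.none)).1)) ||
    decide (u < x)

def act (H : Hist) : Option ℕ := (List.range H.length).find? fun x => elig H (delta H) x

def hist (t : ℕ) : Hist := Nat.rec [] (fun _ H => H ++ [(delta H, act H)]) t

section prim
variable {α : Type*} [Primcodable α]
@[fun_prop] theorem cX_prim {e : α → ℕ} (he : Primrec e) : Primrec fun a => cX (e a) := by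
  unfold cX; fun_prop
@[fun_prop] theorem cV_prim {e : α → ℕ} (he : Primrec e) : Primrec fun a => cV (e a) := by
  unfold cV; fun_prop
@[fun_prop] theorem cC_prim {e : α → ℕ} (he : Primrec e) : Primrec fun a => cC (e a) := by
  unfold cC; fun_prop
@[fun_prop] theorem test1_prim {H : α → Hist} {e u w : α → ℕ} (hH : Primrec H) (he : Primrec e)
    (hu : Primrec u) (hw : Primrec w) : Primrec fun a => test1 (H a) (e a) (u a) (w a) := by
  unfold test1; fun_prop
@[fun_prop] theorem test_prim {H : α → Hist} {τ : α → Str} (hH : Primrec H) (hτ : Primrec τ) :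
    Primrec fun a => test (H a) (τ a) := by
  unfold test; fun_prop
@[fun_prop] theorem delta_prim {H : α → Hist} (hH : Primrec H) :
    Primrec fun a => delta (H a) := by
  unfold delta; fun_prop
@[fun_prop] theorem colUsed_prim {H : α → Hist} {e : α → ℕ} (hH : Primrec H) (he : Primrec e) :
    Primrec fun a => colUsed (H a) (e a) := by
  unfold colUsed; fun_prop
@[fun_prop] theorem elig_prim {H : α → Hist} {δ : α → Str} {e : α → ℕ} (hH : Primrec H)
    (hδ : Primrec δ) (he : Primrec e) : Primrec fun a => elig (H a) (δ a) (e a) := by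
  unfold elig; fun_prop
@[fun_prop] theorem act_prim {H : α → Hist} (hH : Primrec H) :
    Primrec fun a => act (H a) := by
  unfold act; fun_prop
@[fun_prop] theorem hist_prim {t : α → ℕ} (ht : Primrec t) :
    Primrec fun a => hist (t a) := by
  unfold hist; fun_prop
end prim

def dl (t : ℕ) : Str := delta (hist t)
def ac (t : ℕ) : Option ℕ := act (hist t)

theorem hist_eq (t : ℕ) : hist t = (List.range t).map fun u => (dl u, ac u) := by
  induction t with
  | zero => rfl
  | succ t ih =>
    have : hist (t + 1) = hist t ++ [(dl t, ac t)] := rfl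
    rw [this, ih, List.range_succ, List.map_append]; rfl

theorem hist_len (t : ℕ) : (hist t).length = t := by simp [hist_eq]

theorem hist_take {r t : ℕ} (h : r ≤ t) : (hist t).take r = hist r := by
  rw [hist_eq, hist_eq, ← List.map_take, List.take_range, min_eq_left h]

theorem hist_get {u t : ℕ} (h : u < t) : ((hist t)[u]?.getD ([], Option.none)).1 = dl u := by
  simp [hist_eq, h]

/-- elements on side `b` enumerated before stage `t` -/
def eS (b : Bool) (t x : ℕ) : Bool := inS b (hist t) x

theorem inB_iff {t x : ℕ} : inB (hist t) x = true ↔ ∃ u < t, ac u = Option.some x := by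
  simp [inB, hist_eq]

theorem eS_iff {b : Bool} {t x : ℕ} :
    eS b t x = true ↔ (decide (x.unpair.1 % 2 = 0) = b) ∧ ∃ u < t, ac u = Option.some x := by
  unfold eS inS
  rw [Bool.and_eq_true, inB_iff, decide_eq_true_iff]

def Test (t : ℕ) (τ : Str) : Prop := ∀ u < t, τ ++ [true] <+: dl u →
  ∃ w ≤ t, Nat.Partrec.Code.evaln t (cV τ.length) (u + 1) = Option.some w ∧ ∀ n ≤ u + 1,
    ((∀ i < n + cC τ.length, eS true t i = eS true (u + 1) i) ∨
      (∀ i < n + cC τ.length, eS false t i = eS false (u + 1) i)) →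
    ∀ i < n, en (cX τ.length) t i = en (cX τ.length) w i

theorem test_iff (t : ℕ) (τ : Str) : test (hist t) τ = true ↔ Test t τ := by
  unfold test Test
  rw [List.all_eq_true, hist_len]
  refine forall_congr' fun u => ?_
  rw [List.mem_range]
  refine forall_congr' fun hu => ?_
  rw [hist_get hu, Bool.or_eq_true, ← pre_iff]
  have h1 : ((Nat.Partrec.Code.evaln t (cV τ.length) (u + 1)).elim false fun w =>
      test1 (hist t) τ.length u w) = true ↔ ∃ w ≤ t,
        Nat.Partrec.Code.evaln t (cV τ.length) (u + 1) = Option.some w ∧ ∀ n ≤ u + 1,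
    ((∀ i < n + cC τ.length, eS true t i = eS true (u + 1) i) ∨
      (∀ i < n + cC τ.length, eS false t i = eS false (u + 1) i)) →
    ∀ i < n, en (cX τ.length) t i = en (cX τ.length) w i := by
    cases Nat.Partrec.Code.evaln t (cV τ.length) (u + 1) with
    | none => simp
    | some w =>
      have h2 : test1 (hist t) τ.length u w = true ↔ w ≤ t ∧ ∀ n ≤ u + 1,
    ((∀ i < n + cC τ.length, eS true t i = eS true (u + 1) i) ∨
      (∀ i < n + cC τ.length, eS false t i = eS false (u + 1) i)) →
    ∀ i < n, en (cX τ.length) t i = en (cX τ.length) w i := by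
        unfold test1
        rw [Bool.and_eq_true, decide_eq_true_iff, hist_len, List.all_eq_true, hist_take hu]
        refine and_congr Iff.rfl (forall_congr' fun n => ?_)
        rw [List.mem_range]
        refine imp_congr (by omega) ?_
        rw [Bool.or_eq_true, agr_iff, Bool.not_eq_true', ← Bool.not_eq_true, Bool.or_eq_true,
          agr_iff, agr_iff, ← imp_iff_not_or]
        rfl
      simp only [Option.elim_some]
      rw [h2]
      constructor
      · rintro ⟨a, b⟩; exact ⟨w, a, rfl, b⟩
      · rintro ⟨w', a, b, c⟩
        obtain rfl : w = w' := by simpa using b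
        exact ⟨a, c⟩
  rw [h1, Bool.not_eq_true', ← Bool.not_eq_true, ← imp_iff_not_or]

theorem dl_aux (H : Hist) (n : ℕ) :
    (Nat.rec [] (fun _ τ => τ ++ [test H τ]) n : Str).length = n ∧
    ∀ e < n, ∃ b, (Nat.rec [] (fun _ τ => τ ++ [test H τ]) n : Str)[e]? = Option.some b ∧
      b = test H ((Nat.rec [] (fun _ τ => τ ++ [test H τ]) n : Str).take e) := by
  induction n with
  | zero => simp
  | succ n ih =>
    obtain ⟨h1, h2⟩ := ih
    refine ⟨by simp [h1], fun e he => ?_⟩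
    rcases Nat.lt_succ_iff_lt_or_eq.1 he with he | rfl
    · obtain ⟨b, hb, hb2⟩ := h2 e he
      refine ⟨b, ?_, ?_⟩
      · show (_ ++ _ : List Bool)[e]? = _
        rw [List.getElem?_append_left (by omega), hb]
      · show _ = test H ((_ ++ _ : List Bool).take e)
        rw [List.take_append_of_le_length (by omega)]
        exact hb2
    · refine ⟨_, ?_, rfl⟩
      show (_ ++ _ : List Bool)[e]? = Option.some (test H ((_ ++ _ : List Bool).take e))
      rw [List.getElem?_append_right (by omega), List.take_append_of_le_length (by omega),
        List.take_of_length_le (by omega)]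
      simp [h1]

theorem dl_len (t : ℕ) : (dl t).length = t := by
  have := (dl_aux (hist t) (hist t).length).1
  exact this.trans (hist_len t)

theorem dl_bit {t e : ℕ} (h : e < t) :
    ∃ b, (dl t)[e]? = Option.some b ∧ (b = true ↔ Test t ((dl t).take e)) := by
  obtain ⟨b, hb, hb2⟩ := (dl_aux (hist t) (hist t).length).2 e (by rwa [hist_len])
  refine ⟨b, hb, ?_⟩
  rw [hb2, test_iff]; rfl

theorem pre_bit {τ : Str} {t : ℕ} {b : Bool} : τ ++ [b] <+: dl t ↔
    τ <+: dl t ∧ (dl t)[τ.length]? = Option.some b := by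
  constructor
  · intro h
    refine ⟨(List.prefix_append _ _).trans h, ?_⟩
    obtain ⟨l, hl⟩ := h
    rw [← hl]; simp
  · rintro ⟨⟨l, hl⟩, h2⟩
    rw [← hl] at h2 ⊢
    cases l with
    | nil => simp at h2
    | cons x l => simp at h2; subst h2; simp

theorem take_of_pre {τ : Str} {t : ℕ} (h : τ <+: dl t) : (dl t).take τ.length = τ :=
  (List.prefix_iff_eq_take.1 h).symm

theorem pre_true_iff {τ : Str} {t : ℕ} (h : τ <+: dl t) (ht : τ.length < t) :
    τ ++ [true] <+: dl t ↔ Test t τ := by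
  obtain ⟨b, hb, hb2⟩ := dl_bit ht
  rw [take_of_pre h] at hb2
  rw [pre_bit, hb, ← hb2]
  simp [h]

theorem pre_or {τ : Str} {t : ℕ} (h : τ <+: dl t) (ht : τ.length < t) :
    τ ++ [true] <+: dl t ∨ τ ++ [false] <+: dl t := by
  obtain ⟨b, hb, -⟩ := dl_bit ht
  rw [pre_bit, pre_bit, hb]
  cases b <;> simp [h]

def Elig (t x : ℕ) : Prop := x.unpair.1 < t ∧ (∀ u < t, ∀ y, ac u = Option.some y →
    y.unpair.1 ≠ x.unpair.1) ∧ en (Denumerable.ofNat _ (x.unpair.1 / 2)) t x = true ∧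
    ∀ u < t, ∀ e < x.unpair.1, (dl t)[e]? = Option.some false → (dl t).take e ++ [true] <+: dl u → u < x

theorem elig_iff (t x : ℕ) : elig (hist t) (dl t) x = true ↔ Elig t x := by
  unfold elig Elig
  rw [Bool.and_eq_true, Bool.and_eq_true, Bool.and_eq_true, hist_len, decide_eq_true_iff,
    and_assoc, and_assoc]
  refine and_congr Iff.rfl (and_congr ?_ (and_congr Iff.rfl ?_))
  · unfold colUsed
    rw [Bool.not_eq_true', List.any_eq_false, hist_eq]
    simp only [List.mem_map, List.mem_range]
    constructor
    · intro h u hu y hy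
      have := h _ ⟨u, hu, rfl⟩
      simpa [hy] using this
    · rintro h _ ⟨u, hu, rfl⟩
      simp only
      cases hy : ac u with
      | none => simp
      | some y => simpa using h u hu y hy
  · rw [List.all_eq_true]
    refine forall_congr' fun u => ?_
    rw [List.mem_range]
    refine forall_congr' fun hu => ?_
    rw [List.all_eq_true]
    refine forall_congr' fun e => ?_
    rw [List.mem_range]
    refine forall_congr' fun he => ?_
    rw [hist_get hu, Bool.or_eq_true, decide_eq_true_iff, Bool.not_eq_true', ← Bool.not_eq_true,
      Bool.and_eq_true, decide_eq_true_iff, pre_iff, ← imp_iff_not_or, and_imp]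

theorem ac_elig {t x : ℕ} (h : ac t = Option.some x) : Elig t x ∧ x < t := by
  unfold ac act at h
  have h1 := List.find?_some h
  have h2 := List.mem_of_find?_eq_some h
  rw [List.mem_range, hist_len] at h2
  exact ⟨(elig_iff t x).1 h1, h2⟩

theorem ac_least {t x : ℕ} (h : Elig t x) (hx : x < t) : ∃ y ≤ x, ac t = Option.some y := by
  have h1 := (elig_iff t x).2 h
  have hm : x ∈ List.range (hist t).length := by rw [hist_len]; simpa
  cases hy : ac t with
  | none =>
    have := List.find?_eq_none.1 hy x hm
    exact absurd h1 this
  | some y =>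
    refine ⟨y, ?_, rfl⟩
    have h3 : ac t = Option.some y := hy
    unfold ac act at h3
    rw [List.find?_range_eq_some] at h3
    by_contra hlt
    have := h3.2.2 x (by omega)
    rw [show delta (hist t) = dl t from rfl, h1] at this
    simp at this

/-- each column is used at most once -/
theorem ac_col {t u x y : ℕ} (hx : ac t = Option.some x) (hy : ac u = Option.some y)
    (h : x.unpair.1 = y.unpair.1) : t = u := by
  rcases lt_trichotomy t u with hlt | rfl | hlt
  · exact absurd h ((ac_elig hy).1.2.1 t hlt x hx)
  · rfl
  · exact absurd h.symm ((ac_elig hx).1.2.1 u hlt y hy)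

def S (b : Bool) : Set ℕ := {x | ∃ t, eS b t x = true}

theorem eS_mono (b : Bool) {s t n : ℕ} (h : s ≤ t) (hs : eS b s n = true) : eS b t n = true := by
  rw [eS_iff] at *
  obtain ⟨h1, u, hu, h2⟩ := hs
  exact ⟨h1, u, by omega, h2⟩

theorem eS_enum (b : Bool) : Enum (eS b) (S b) := by
  refine ⟨?_, fun s t n => eS_mono b, ?_, fun n => Iff.rfl⟩
  · unfold eS; exact Primrec.to_comp (by fun_prop)
  · intro s n h
    rw [eS_iff] at h
    obtain ⟨h1, u, hu, h2⟩ := h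
    have := (ac_elig h2).2
    omega

theorem S_ce (b : Bool) : CESet (S b) := by
  refine ceset_of_computable (e := eS b) (eS_enum b).comp (eS_enum b).mem

/-! true path -/

noncomputable def TP : ℕ → Str
  | 0 => []
  | e + 1 => TP e ++ [decide (∃ᶠ t in atTop, TP e ++ [true] <+: dl t)]

theorem TP_len (e : ℕ) : (TP e).length = e := by
  induction e with
  | zero => rfl
  | succ e ih => simp [TP, ih]

theorem TP_inf (e : ℕ) : ∃ᶠ t in atTop, TP e <+: dl t := by
  induction e with
  | zero => exact Frequently.of_forall fun _ => ⟨_, rfl⟩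
  | succ e ih =>
    simp only [TP]
    by_cases h : ∃ᶠ t in atTop, TP e ++ [true] <+: dl t
    · simp [h]
    · simp only [h, decide_false]
      rw [not_frequently] at h
      have h2 := (ih.and_eventually h).and_eventually (eventually_gt_atTop e)
      refine h2.mono ?_
      rintro t ⟨⟨h3, h4⟩, h5⟩
      exact (pre_or h3 (by rwa [TP_len])).resolve_left h4

theorem TP_pre {e e' : ℕ} (h : e ≤ e') : TP e <+: TP e' := by
  induction e', h using Nat.le_induction with
  | base => exact List.prefix_rfl
  | succ n _ ih => exact ih.trans (by simp [TP])

theorem TP_take {e e' : ℕ} (h : e ≤ e') : (TP e').take e = TP e := by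
  have := List.prefix_iff_eq_take.1 (TP_pre h)
  rw [TP_len] at this; exact this.symm

theorem TP_bit (e : ℕ) : (TP (e + 1)) = TP e ++ [true] ∧ (∃ᶠ t in atTop, TP e ++ [true] <+: dl t) ∨
    (TP (e + 1)) = TP e ++ [false] ∧ ∃ b, ∀ t, TP e ++ [true] <+: dl t → t < b := by
  by_cases h : ∃ᶠ t in atTop, TP e ++ [true] <+: dl t
  · left; exact ⟨by simp [TP, h], h⟩
  · right
    refine ⟨by simp [TP, h], ?_⟩
    rw [not_frequently, eventually_atTop] at h
    obtain ⟨b, hb⟩ := h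
    refine ⟨b, fun t ht => ?_⟩
    by_contra hh
    exact hb t (by omega) ht

/-- uniform bound for the false nodes -/
theorem TP_bound (i : ℕ) : ∃ b, ∀ e < i, TP (e + 1) = TP e ++ [false] →
    ∀ t, TP e ++ [true] <+: dl t → t < b := by
  induction i with
  | zero => exact ⟨0, by simp⟩
  | succ i ih =>
    obtain ⟨b, hb⟩ := ih
    obtain ⟨b', hb'⟩ : ∃ b', TP (i + 1) = TP i ++ [false] → ∀ t, TP i ++ [true] <+: dl t →
        t < b' := by
      rcases TP_bit i with ⟨h, -⟩ | ⟨-, b', h⟩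
      · exact ⟨0, fun h' => by rw [h] at h'; simp at h'⟩
      · exact ⟨b', fun _ => h⟩
    refine ⟨max b b', fun e he h t ht => ?_⟩
    rcases Nat.lt_succ_iff_lt_or_eq.1 he with he | rfl
    · exact lt_of_lt_of_le (hb e he h t ht) (le_max_left _ _)
    · exact lt_of_lt_of_le (hb' h t ht) (le_max_right _ _)

theorem dl_bit_of_TP {t i e : ℕ} (h : TP i <+: dl t) (he : e < i) (b : Bool) :
    (dl t)[e]? = Option.some b ↔ TP (e + 1) = TP e ++ [b] := by
  have h1 : TP (e + 1) <+: dl t := (TP_pre he).trans h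
  have h2 : ∃ b', TP (e + 1) = TP e ++ [b'] := ⟨_, rfl⟩
  obtain ⟨b', hb'⟩ := h2
  rw [hb', pre_bit, TP_len] at h1
  rw [h1.2, hb']
  simp

theorem dl_take_of_TP {t i e : ℕ} (h : TP i <+: dl t) (he : e ≤ i) :
    (dl t).take e = TP e := by
  have := take_of_pre ((TP_pre he).trans h)
  rwa [TP_len] at this

/-- the positive requirements -/
theorem P_acts (i : ℕ) (hW : ∀ b, ∃ x, b ≤ x ∧ x.unpair.1 = i ∧
    ∃ s, en (Denumerable.ofNat _ (i / 2)) s x = true) :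
    ∃ t x, ac t = Option.some x ∧ x.unpair.1 = i := by
  by_contra hno
  push Not at hno
  obtain ⟨b, hb⟩ := TP_bound i
  obtain ⟨x, hbx, hxi, s, hs⟩ := hW b
  obtain ⟨t0, ht0⟩ : ∃ t0, t0 = max (max s (x + 1)) (i + 1) := ⟨_, rfl⟩
  have key : ∀ t, t0 ≤ t → TP i <+: dl t → ∃ y ≤ x, ac t = Option.some y := by
    intro t ht hpre
    apply ac_least _ (by omega)
    refine ⟨by omega, fun u _ y hy => by rw [hxi]; exact hno u y hy, ?_, ?_⟩
    · rw [hxi]; exact en_mono (by omega) hs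
    · intro u hu e he hfalse hp
      rw [hxi] at he
      rw [dl_take_of_TP hpre he.le] at hp
      rw [dl_bit_of_TP hpre he] at hfalse
      exact lt_of_lt_of_le (hb e he hfalse u hp) hbx
  have hinf : {t | t0 ≤ t ∧ TP i <+: dl t}.Infinite := by
    rw [← Nat.frequently_atTop_iff_infinite]
    exact ((TP_inf i).and_eventually (eventually_ge_atTop t0)).mono fun t h => ⟨h.2, h.1⟩
  have hmaps : Set.MapsTo (fun t => (ac t).getD 0) {t | t0 ≤ t ∧ TP i <+: dl t} (Set.Iic x) := by
    rintro t ⟨h1, h2⟩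
    obtain ⟨y, hy, h3⟩ := key t h1 h2
    simpa [h3] using hy
  obtain ⟨t, ⟨h1, h2⟩, u, ⟨h3, h4⟩, hne, heq⟩ := hinf.exists_ne_map_eq_of_mapsTo hmaps
    (Set.finite_Iic x)
  obtain ⟨y, -, hy⟩ := key t h1 h2
  obtain ⟨z, -, hz⟩ := key u h3 h4
  simp only [hy, hz, Option.getD_some] at heq
  exact hne (ac_col hy hz (by rw [heq]))

theorem S_not_computable (b : Bool) : ¬ Computable (seqOfSet (S b)) := by
  intro h
  have hc : CESet (S b)ᶜ := by
    refine ceset_of_computable (e := fun _ n => ! seqOfSet (S b) n)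
      (Primrec.not.to_comp.comp (h.comp Computable.snd)) ?_
    intro n; simp [seqOfSet]
  obtain ⟨c, hc⟩ := hc.code
  obtain ⟨i, hi, hib⟩ : ∃ i, i / 2 = Encodable.encode c ∧ decide (i % 2 = 0) = b := by
    cases b
    · exact ⟨2 * Encodable.encode c + 1, by omega, by simp⟩
    · exact ⟨2 * Encodable.encode c, by omega, by simp⟩
  have hW : Denumerable.ofNat Nat.Partrec.Code (i / 2) = c := by rw [hi]; simp
  have hmemb : ∀ x, x.unpair.1 = i → (x ∈ S b ↔ ∃ t, ac t = Option.some x) := by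
    intro x hx
    constructor
    · rintro ⟨t, ht⟩
      obtain ⟨-, u, -, hu⟩ := eS_iff.1 ht
      exact ⟨u, hu⟩
    · rintro ⟨t, ht⟩
      exact ⟨t + 1, eS_iff.2 ⟨by rw [hx]; exact hib, t, by omega, ht⟩⟩
  obtain ⟨t, x, hx, hxi⟩ := P_acts i (by
    intro m
    rw [hW]
    by_cases h1 : Nat.pair i m ∈ S b
    · refine ⟨Nat.pair i (m + 1), (by have := Nat.right_le_pair i (m + 1); omega), by simp, ?_⟩
      rw [← hc]
      intro h2
      rw [hmemb _ (by simp)] at h1 h2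
      obtain ⟨t, ht⟩ := h1
      obtain ⟨u, hu⟩ := h2
      have := ac_col ht hu (by simp)
      subst this
      rw [ht] at hu
      simp at hu
    · refine ⟨Nat.pair i m, Nat.right_le_pair i m, by simp, ?_⟩
      rw [← hc]; exact h1)
  have h1 : x ∈ S b := (hmemb x hxi).2 ⟨t, hx⟩
  have h2 : x ∈ (S b)ᶜ := by
    rw [hc]
    have := (ac_elig hx).1.2.2.1
    rw [hxi, hW] at this
    exact ⟨t, this⟩
  exact h2 h1

/-- eventually, elements not enumerated at expansionary stages are large -/
theorem eventually_large (e : ℕ) (hE : TP (e + 1) = TP e ++ [true]) :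
    ∃ T, ∀ t ≥ T, ∀ x, ac t = Option.some x → ¬ TP e ++ [true] <+: dl t →
      ∀ u < t, TP e ++ [true] <+: dl u → u < x := by
  obtain ⟨b, hb⟩ := TP_bound e
  obtain ⟨T, hT⟩ : ∃ T, ∀ t ≥ T, ∀ x, ac t = Option.some x → e < x.unpair.1 := by
    have : ∀ m, ∃ T, ∀ t ≥ T, ∀ x, ac t = Option.some x → m ≤ x.unpair.1 := by
      intro m
      induction m with
      | zero => exact ⟨0, by simp⟩
      | succ m ih =>
        obtain ⟨T, hT⟩ := ih
        by_cases h : ∃ t x, ac t = Option.some x ∧ x.unpair.1 = m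
        · obtain ⟨t, x, hx, hm⟩ := h
          refine ⟨max T (t + 1), fun t' ht' y hy => ?_⟩
          have h1 := hT t' (le_trans (le_max_left _ _) ht') y hy
          rcases Nat.lt_or_eq_of_le h1 with h1 | h1
          · exact h1
          · have := ac_col hx hy (by omega)
            have h2 := le_trans (le_max_right _ _) ht'
            omega
        · push Not at h
          refine ⟨T, fun t ht x hx => ?_⟩
          have h1 := hT t ht x hx
          have h2 := h t x hx
          omega
    exact this (e + 1)
  refine ⟨max (max T b) (e + 1), ?_⟩
  intro t ht x hx hnE u hu huE
  have htT : T ≤ t := le_trans (le_trans (le_max_left _ _) (le_max_left _ _)) ht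
  have htb : b ≤ t := le_trans (le_trans (le_max_right _ _) (le_max_left _ _)) ht
  have hte : e + 1 ≤ t := le_trans (le_max_right _ _) ht
  have hcol := hT t htT x hx
  -- the first disagreement
  have hex : ∃ k, ¬ TP k <+: dl t := ⟨e + 1, by rwa [hE]⟩
  obtain ⟨k, hk, hkm⟩ : ∃ k, ¬ TP k <+: dl t ∧ ∀ j < k, TP j <+: dl t :=
    ⟨Nat.find hex, Nat.find_spec hex, fun j hj => by
      have := Nat.find_min hex hj; simpa using this⟩
  have hke : k ≤ e + 1 := by
    by_contra hh
    exact hnE (hE ▸ hkm (e + 1) (by omega))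
  cases k with
  | zero => simp [TP] at hk
  | succ k =>
    have hpk := hkm k (by omega)
    have huk : TP (k + 1) <+: dl u := by
      refine (TP_pre hke).trans ?_
      rwa [hE]
    rcases TP_bit k with ⟨h1, -⟩ | ⟨h1, -⟩
    · have hfalse := (pre_or hpk (by rw [TP_len]; omega)).resolve_left (by rwa [← h1])
      rw [pre_bit, TP_len] at hfalse
      refine (ac_elig hx).1.2.2.2 u hu k (by omega) hfalse.2 ?_
      rw [dl_take_of_TP hpk le_rfl, ← h1]
      exact huk
    · have htrue := (pre_or hpk (by rw [TP_len]; omega)).resolve_right (by rwa [← h1])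
      have hk' : k < e := by
        rcases Nat.lt_or_eq_of_le hke with h | h
        · omega
        · obtain rfl : k = e := by omega
          exact absurd htrue hnE
      have := hb k hk' h1 t htrue
      omega

/-- The negative requirements. -/
theorem N_req {X : Set ℕ} {c : Nat.Partrec.Code} (hc : ∀ n, n ∈ X ↔ ∃ s, en c s n = true)
    {k : ℕ} {v : ℕ → ℕ} (hv : Computable v)
    (hS : ∀ b, Star (en c) (eS b) X (S b) k v) : Computable (seqOfSet X) := by
  have hX := enum_code c hc
  obtain ⟨cv, hcv⟩ := Nat.Partrec.Code.exists_code.1 (Partrec.nat_iff.1 hv.partrec)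
  obtain ⟨e, he1, he2, he3⟩ : ∃ e, cX e = c ∧ cV e = cv ∧ cC e = k :=
    ⟨Nat.pair (Encodable.encode c) (Nat.pair (Encodable.encode cv) k), by simp [cX],
      by simp [cV], by simp [cC]⟩
  have hev : ∀ n, v n ∈ cv.eval n := by intro n; rw [hcv]; simp
  have hTest : ∀ t, Test t (TP e) ↔ ∀ u < t, TP e ++ [true] <+: dl u →
      ∃ w ≤ t, Nat.Partrec.Code.evaln t cv (u + 1) = Option.some w ∧ ∀ n ≤ u + 1,
      ((∀ i < n + k, eS true t i = eS true (u + 1) i) ∨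
        (∀ i < n + k, eS false t i = eS false (u + 1) i)) →
      ∀ i < n, en c t i = en c w i := by
    intro t; unfold Test; rw [TP_len, he1, he2, he3]
  -- the node is infinitary
  have hinf : TP (e + 1) = TP e ++ [true] ∧ (∃ᶠ t in atTop, TP e ++ [true] <+: dl t) := by
    rcases TP_bit e with h | ⟨-, b, hb⟩
    · exact h
    exfalso
    -- for all large t the test holds
    have hlarge : ∃ T, ∀ t ≥ T, Test t (TP e) := by
      have h1 : ∀ u, ∃ T, ∀ t ≥ T, v (u + 1) ≤ t ∧
          Nat.Partrec.Code.evaln t cv (u + 1) = Option.some (v (u + 1)) := by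
        intro u
        obtain ⟨T, hT⟩ := Nat.Partrec.Code.evaln_complete.1 (hev (u + 1))
        refine ⟨max T (v (u + 1)), fun t ht => ⟨le_trans (le_max_right _ _) ht, ?_⟩⟩
        exact Nat.Partrec.Code.evaln_mono (le_trans (le_max_left _ _) ht) hT
      have h2 : ∀ m, ∃ T, ∀ t ≥ T, ∀ u < m, v (u + 1) ≤ t ∧
          Nat.Partrec.Code.evaln t cv (u + 1) = Option.some (v (u + 1)) := by
        intro m
        induction m with
        | zero => exact ⟨0, by simp⟩
        | succ m ih =>
          obtain ⟨T, hT⟩ := ih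
          obtain ⟨T', hT'⟩ := h1 m
          refine ⟨max T T', fun t ht u hu => ?_⟩
          rcases Nat.lt_succ_iff_lt_or_eq.1 hu with hu | rfl
          · exact hT t (le_trans (le_max_left _ _) ht) u hu
          · exact hT' t (le_trans (le_max_right _ _) ht)
      obtain ⟨T1, hT1⟩ := h2 b
      obtain ⟨T2, hT2⟩ := (eS_enum true).stab (b + 1 + k)
      obtain ⟨T3, hT3⟩ := (eS_enum false).stab (b + 1 + k)
      obtain ⟨T4, hT4⟩ := hX.stab (b + 1)
      refine ⟨max (max T1 T2) (max T3 T4), fun t ht => ?_⟩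
      have ht1 : T1 ≤ t := le_trans (le_trans (le_max_left _ _) (le_max_left _ _)) ht
      have ht2 : T2 ≤ t := le_trans (le_trans (le_max_right _ _) (le_max_left _ _)) ht
      have ht3 : T3 ≤ t := le_trans (le_trans (le_max_left _ _) (le_max_right _ _)) ht
      have ht4 : T4 ≤ t := le_trans (le_trans (le_max_right _ _) (le_max_right _ _)) ht
      rw [hTest]
      intro u hu huE
      have hub := hb u huE
      obtain ⟨ha, hb'⟩ := hT1 t ht1 u hub
      refine ⟨v (u + 1), ha, hb', fun n hn hor i hi => ?_⟩
      rw [hT4 t ht4 i (by omega)]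
      rcases hor with hor | hor
      · refine (hS true (u + 1) n hn (fun j hj => ?_) i hi).symm
        rw [← hor j hj, hT2 t ht2 j (by omega)]
      · refine (hS false (u + 1) n hn (fun j hj => ?_) i hi).symm
        rw [← hor j hj, hT3 t ht3 j (by omega)]
    obtain ⟨T, hT⟩ := hlarge
    obtain ⟨t, ht, hpre⟩ := (frequently_atTop.1 (TP_inf e)) (max (max T b) (e + 1))
    have h1 : T ≤ t := le_trans (le_trans (le_max_left _ _) (le_max_left _ _)) ht
    have h2 : b ≤ t := le_trans (le_trans (le_max_right _ _) (le_max_left _ _)) ht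
    have h3 : e + 1 ≤ t := le_trans (le_max_right _ _) ht
    have := hb t ((pre_true_iff hpre (by rw [TP_len]; omega)).2 (hT t h1))
    omega
  obtain ⟨hE, hfreq⟩ := hinf
  obtain ⟨T, hT⟩ := eventually_large e hE
  set τ := TP e ++ [true] with hτ
  have hE_test : ∀ t, τ <+: dl t → Test t (TP e) := by
    intro t ht
    have hp : TP e <+: dl t := (List.prefix_append _ _).trans ht
    have hlen := ht.length_le
    rw [dl_len, hτ, List.length_append, TP_len] at hlen
    exact (pre_true_iff hp (by rw [TP_len]; simp at hlen; omega)).1 ht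
  -- no small change outside E
  have quiet : ∀ b u t, T ≤ u → τ <+: dl u → u < t → (∀ w, u < w → w < t → ¬ τ <+: dl w) →
      ∀ i ≤ u, eS b t i = eS b (u + 1) i := by
    intro b u t hu huE hut hno i hi
    cases h1 : eS b (u + 1) i
    · by_contra h2
      have h2 : eS b t i = true := by simpa using h2
      obtain ⟨ha, w, hw, hb⟩ := eS_iff.1 h2
      have hwu : u + 1 ≤ w := by
        by_contra hlt
        have : eS b (u + 1) i = true := eS_iff.2 ⟨ha, w, by omega, hb⟩
        rw [h1] at this; simp at this
      have := hT w (by omega) i hb (hno w (by omega) hw) u (by omega) huE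
      omega
    · exact eS_mono b (by omega) h1
  have step : ∀ n u0 u1 u2, T ≤ u0 → n + k ≤ u0 → u0 < u1 → u1 < u2 → τ <+: dl u0 →
      τ <+: dl u1 → τ <+: dl u2 → (∀ w, u0 < w → w < u1 → ¬ τ <+: dl w) →
      (∀ w, u1 < w → w < u2 → ¬ τ <+: dl w) → ∀ i < n, en c u2 i = en c u1 i := by
    intro n u0 u1 u2 hT0 hn h01 h12 hE0 hE1 hE2 hno1 hno2
    obtain ⟨w, -, hw, hw2⟩ := (hTest u1).1 (hE_test u1 hE1) u0 h01 hE0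
    obtain ⟨w', -, hw', hw2'⟩ := (hTest u2).1 (hE_test u2 hE2) u0 (by omega) hE0
    obtain rfl : w = w' := by
      have := Nat.Partrec.Code.evaln_mono h12.le hw
      rw [hw'] at this; simpa using this.symm
    have q1 : ∀ b, ∀ i < n + k, eS b u1 i = eS b (u0 + 1) i := fun b i hi =>
      quiet b u0 u1 hT0 hE0 h01 hno1 i (by omega)
    have q2 : ∀ b, ∀ i < n + k, eS b u2 i = eS b (u1 + 1) i := fun b i hi =>
      quiet b u1 u2 (by omega) hE1 h12 hno2 i (by omega)
    -- at stage u1 only one side changes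
    have q3 : (∀ i, eS true (u1 + 1) i = eS true u1 i) ∨
        (∀ i, eS false (u1 + 1) i = eS false u1 i) := by
      have key : ∀ b, (∀ x, ac u1 = Option.some x → decide (x.unpair.1 % 2 = 0) ≠ b) →
          ∀ i, eS b (u1 + 1) i = eS b u1 i := by
        intro b hb i
        cases h1 : eS b u1 i
        · by_contra h2
          have h2 : eS b (u1 + 1) i = true := by simpa using h2
          obtain ⟨ha, w, hw, hac⟩ := eS_iff.1 h2
          rcases Nat.lt_succ_iff_lt_or_eq.1 hw with hw | rfl
          · have : eS b u1 i = true := eS_iff.2 ⟨ha, w, hw, hac⟩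
            rw [h1] at this; simp at this
          · exact hb i hac ha
        · exact eS_mono b (by omega) h1
      cases h : ac u1 with
      | none => left; exact key true (by simp [h])
      | some x =>
        cases hx : decide (x.unpair.1 % 2 = 0)
        · left; apply key true; intro y hy; rw [h] at hy
          obtain rfl : x = y := by simpa using hy
          rw [hx]; simp
        · right; apply key false; intro y hy; rw [h] at hy
          obtain rfl : x = y := by simpa using hy
          rw [hx]; simp
    intro i hi
    rw [hw2 n (by omega) (Or.inl (q1 true)) i hi]
    refine hw2' n (by omega) ?_ i hi
    rcases q3 with q3 | q3
    · left; intro j hj; rw [q2 true j hj, q3 j, q1 true j hj]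
    · right; intro j hj; rw [q2 false j hj, q3 j, q1 false j hj]
  -- all later expansionary stages agree
  have pred : ∀ u' u0, τ <+: dl u0 → u0 < u' → ∃ m, u0 ≤ m ∧ m < u' ∧ τ <+: dl m ∧
      ∀ w, m < w → w < u' → ¬ τ <+: dl w := by
    intro u'
    induction u' with
    | zero => intro u0 _ h; omega
    | succ u' ih =>
      intro u0 h0 hlt
      by_cases h : τ <+: dl u'
      · exact ⟨u', by omega, by omega, h, fun w h1 h2 => by omega⟩
      · have : u0 < u' := by
          rcases Nat.lt_succ_iff_lt_or_eq.1 hlt with h1 | rfl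
          · exact h1
          · exact absurd h0 h
        obtain ⟨m, h1, h2, h3, h4⟩ := ih u0 h0 this
        refine ⟨m, h1, by omega, h3, fun w h5 h6 => ?_⟩
        rcases Nat.lt_succ_iff_lt_or_eq.1 h6 with h7 | rfl
        · exact h4 w h5 h7
        · exact h
  have all : ∀ n u0, T ≤ u0 → n + k ≤ u0 → τ <+: dl u0 → ∀ u2 u1, u0 < u1 → u1 ≤ u2 →
      τ <+: dl u1 → τ <+: dl u2 → ∀ i < n, en c u2 i = en c u1 i := by
    intro n u0 hT0 hn hE0 u2
    induction u2 using Nat.strong_induction_on with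
    | _ u2 ih =>
      intro u1 h01 h12 hE1 hE2 i hi
      rcases Nat.lt_or_eq_of_le h12 with h12 | rfl
      · obtain ⟨m, h1, h2, h3, h4⟩ := pred u2 u1 hE1 h12
        obtain ⟨p, h5, h6, h7, h8⟩ := pred m u0 hE0 (by omega)
        rw [step n p m u2 (by omega) (by omega) h6 h2 h7 h3 hE2 h8 h4 i hi]
        exact ih m h2 u1 h01 h1 hE1 h3 i hi
      · rfl
  -- compute X
  let p : ℕ → ℕ → Bool := fun n q => decide (T + n + 1 + k ≤ q.unpair.1) &&
    decide (q.unpair.1 < q.unpair.2) && pre τ (dl q.unpair.1) && pre τ (dl q.unpair.2)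
  have hp : Computable fun q : ℕ × ℕ => p q.1 q.2 := by
    refine Primrec.to_comp ?_
    simp only [p]; unfold dl; fun_prop
  obtain ⟨f, hf, hf2⟩ := computable_search hp (by
    intro n
    obtain ⟨u0, h0, h0E⟩ := (frequently_atTop.1 hfreq) (T + n + 1 + k)
    obtain ⟨u1, h1, h1E⟩ := (frequently_atTop.1 hfreq) (u0 + 1)
    refine ⟨Nat.pair u0 u1, ?_⟩
    simp only [p, Nat.unpair_pair, Bool.and_eq_true, decide_eq_true_iff, pre_iff]
    exact ⟨⟨⟨h0, h1⟩, h0E⟩, h1E⟩)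
  have hfin : ∀ n, en c (f n).unpair.2 n = seqOfSet X n := by
    intro n
    have := hf2 n
    simp only [p, Bool.and_eq_true, decide_eq_true_iff, pre_iff] at this
    obtain ⟨⟨⟨h0, h1⟩, h0E⟩, h1E⟩ := this
    obtain ⟨s, hs⟩ := hX.stab (n + 1)
    obtain ⟨u2, h2, h2E⟩ := (frequently_atTop.1 hfreq) (max s (f n).unpair.2)
    rw [← hs u2 (le_trans (le_max_left _ _) h2) n (by omega)]
    exact (all (n + 1) (f n).unpair.1 (by omega) (by omega) h0E u2 (f n).unpair.2 h1
      (le_trans (le_max_right _ _) h2) h1E h2E n (by omega)).symm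
  have h1 : Primrec fun q : ℕ × ℕ => en c q.1.unpair.2 q.2 := by fun_prop
  exact (h1.to_comp.comp (Computable.pair hf Computable.id)).of_eq hfin

theorem minimal_pair : ∃ A D : Set ℕ, CESet A ∧ CESet D ∧ ¬ SolovayLeastSet A ∧
    ¬ SolovayLeastSet D ∧
    ∀ X : Set ℕ, CESet X → SolovayLeSet X A → SolovayLeSet X D → SolovayLeastSet X := by
  refine ⟨S true, S false, S_ce _, S_ce _,
    fun h => S_not_computable _ (computable_of_least (eS_enum _) h),
    fun h => S_not_computable _ (computable_of_least (eS_enum _) h), ?_⟩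
  intro X hX hA hD
  obtain ⟨c, hc⟩ := hX.code
  have hE := enum_code c hc
  obtain ⟨k1, v1, hv1, hs1⟩ := star_of_solovay hE (eS_enum true) hA
  obtain ⟨k2, v2, hv2, hs2⟩ := star_of_solovay hE (eS_enum false) hD
  apply least_of_computable
  have hmax : Computable fun n => max (v1 n) (v2 n) := by
    have h1 : Primrec fun q : ℕ × ℕ => max q.1 q.2 := by fun_prop
    exact h1.to_comp.comp (Computable.pair hv1 hv2)
  have mono : ∀ s t i, s ≤ t → en c s i = seqOfSet X i → en c t i = seqOfSet X i := by
    intro s t i hst h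
    cases h1 : seqOfSet X i
    · by_contra h2
      have := hE.le t i (by simpa using h2)
      rw [h1] at this; simp at this
    · rw [h1] at h; exact hE.mono s t i hst h
  refine N_req hc (k := max k1 k2) (v := fun n => max (v1 n) (v2 n)) hmax ?_
  intro b s n hn hag i hi
  cases b
  · refine mono (v2 s) _ i (le_max_right _ _) (hs2 s n hn (fun j hj => hag j ?_) i hi)
    exact lt_of_lt_of_le hj (by have := le_max_right k1 k2; omega)
  · refine mono (v1 s) _ i (le_max_left _ _) (hs1 s n hn (fun j hj => hag j ?_) i hi)
    exact lt_of_lt_of_le hj (by have := le_max_left k1 k2; omega)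


end MP

/-! ### Stagewise evaluation of the universal machine, and Kraft measure -/

/-- Stage evaluation of a code on strings. -/
def us (c : Nat.Partrec.Code) (t : ℕ) (ρ : Str) : Option Str :=
  (Nat.Partrec.Code.evaln t c (Encodable.encode ρ)).bind fun n => Encodable.decode n

@[fun_prop] theorem us_prim {α : Type*} [Primcodable α] {t : α → ℕ} {ρ : α → Str}
    (c : Nat.Partrec.Code) (ht : Primrec t) (hρ : Primrec ρ) :
    Primrec fun a => us c (t a) (ρ a) := by unfold us; fun_prop

theorem us_mono {c : Nat.Partrec.Code} {s t : ℕ} {ρ σ : Str} (h : s ≤ t)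
    (hs : us c s ρ = Option.some σ) : us c t ρ = Option.some σ := by
  unfold us at *
  rw [Option.bind_eq_some_iff] at *
  obtain ⟨x, hx, hx2⟩ := hs
  exact ⟨x, Nat.Partrec.Code.evaln_mono h hx, hx2⟩

theorem us_bound {c : Nat.Partrec.Code} {t : ℕ} {ρ σ : Str}
    (hs : us c t ρ = Option.some σ) : Encodable.encode ρ < t := by
  unfold us at *
  rw [Option.bind_eq_some_iff] at *
  obtain ⟨x, hx, -⟩ := hs
  exact Nat.Partrec.Code.evaln_bound hx

theorem us_uniq {c : Nat.Partrec.Code} {s t : ℕ} {ρ σ τ : Str}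
    (hs : us c s ρ = Option.some σ) (ht : us c t ρ = Option.some τ) : σ = τ := by
  have h1 := us_mono (le_max_left s t) hs
  have h2 := us_mono (le_max_right s t) ht
  rw [h1] at h2
  exact Option.some_injective _ h2

/-- `c` is a code for `U`. -/
def UC (U : Str →. Str) (c : Nat.Partrec.Code) : Prop :=
  ∀ ρ σ, σ ∈ U ρ ↔ ∃ t, us c t ρ = Option.some σ

theorem exists_uc {U : Str →. Str} (h : Partrec U) : ∃ c, UC U c := by
  obtain ⟨c, hc⟩ := Nat.Partrec.Code.exists_code.1 h
  refine ⟨c, fun ρ σ => ?_⟩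
  have e : c.eval (Encodable.encode ρ) = (U ρ).map Encodable.encode := by
    rw [hc]; simp
  have e2 : σ ∈ U ρ ↔ Encodable.encode σ ∈ c.eval (Encodable.encode ρ) := by
    rw [e]; simp
  rw [e2, Nat.Partrec.Code.evaln_complete]
  constructor
  · rintro ⟨k, hk⟩
    exact ⟨k, by unfold us; rw [Option.mem_def.1 hk]; simp⟩
  · rintro ⟨k, hk⟩
    unfold us at hk
    rw [Option.bind_eq_some_iff] at hk
    obtain ⟨x, hx, hx2⟩ := hk
    have h3 := Nat.Partrec.Code.evaln_sound hx
    rw [e] at h3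
    obtain ⟨τ, -, rfl⟩ := (Part.mem_map_iff _).1 h3
    simp only [Encodable.encodek, Option.some.injEq] at hx2
    subst hx2
    exact ⟨k, hx⟩

theorem UC.dom {U : Str →. Str} {c : Nat.Partrec.Code} (h : UC U c) {t : ℕ} {ρ σ : Str}
    (hs : us c t ρ = Option.some σ) : (U ρ).Dom :=
  Part.dom_iff_mem.2 ⟨σ, (h ρ σ).2 ⟨t, hs⟩⟩

/-- Prefix-free domain. -/
def PFD (U : Str →. Str) : Prop :=
  ∀ ρ₁ ρ₂ : Str, (U ρ₁).Dom → (U ρ₂).Dom → ρ₁ <+: ρ₂ → ρ₁ = ρ₂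

theorem kraft {U : Str →. Str} (h : PFD U) (S : Finset Str) (hS : ∀ ρ ∈ S, (U ρ).Dom) :
    ∑ ρ ∈ S, (1 / 2 : ℝ) ^ ρ.length ≤ 1 := by
  by_cases hn : ([] : Str) ∈ S
  · have : S = {[]} := by
      ext ρ
      simp only [Finset.mem_singleton]
      constructor
      · intro hρ
        exact (h [] ρ (hS _ hn) (hS _ hρ) ⟨_, rfl⟩).symm
      · rintro rfl; exact hn
    rw [this]; simp
  · have hu : InformationTheory.UniquelyDecodable (S : Set Str) := by
      intro L₁
      induction L₁ with
      | nil =>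
        intro L₂ _ h2 h3
        cases L₂ with
        | nil => rfl
        | cons x l =>
          simp only [List.flatten_nil, List.flatten_cons] at h3
          have := (List.append_eq_nil_iff.1 h3.symm).1
          have hx := h2 x (by simp)
          rw [this] at hx
          exact absurd hx hn
      | cons x l ih =>
        intro L₂ h1 h2 h3
        cases L₂ with
        | nil =>
          simp only [List.flatten_nil, List.flatten_cons] at h3
          have := (List.append_eq_nil_iff.1 h3).1
          have hx := h1 x (by simp)
          rw [this] at hx
          exact absurd hx hn
        | cons y l' =>
          simp only [List.flatten_cons] at h3
          have hx := hS _ (h1 x (by simp))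
          have hy := hS _ (h2 y (by simp))
          have hxy : x = y := by
            have p1 : x <+: x ++ l.flatten := List.prefix_append _ _
            have p2 : y <+: x ++ l.flatten := h3 ▸ List.prefix_append _ _
            have pq : x <+: y ∨ y <+: x := by
              rcases le_total x.length y.length with hl | hl
              · exact Or.inl (List.prefix_of_prefix_length_le p1 p2 hl)
              · exact Or.inr (List.prefix_of_prefix_length_le p2 p1 hl)
            rcases pq with q | q
            · exact h _ _ hx hy q
            · exact (h _ _ hy hx q).symm
          subst hxy
          rw [ih l' (fun w hw => h1 w (by simp [hw])) (fun w hw => h2 w (by simp [hw]))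
            (List.append_cancel_left h3)]
    have := InformationTheory.kraft_mcmillan_inequality hu
    simpa using this

/-- Weight of a string. -/
noncomputable def wU (U : Str →. Str) (ρ : Str) : ℝ :=
  if (U ρ).Dom then (1 / 2 : ℝ) ^ ρ.length else 0

theorem wU_nonneg (U : Str →. Str) (ρ : Str) : 0 ≤ wU U ρ := by
  unfold wU; split_ifs <;> positivity

theorem wU_sum {U : Str →. Str} (h : PFD U) (S : Finset Str) : ∑ ρ ∈ S, wU U ρ ≤ 1 := by
  unfold wU
  rw [← Finset.sum_filter]
  exact kraft h _ (by simp)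

theorem wU_summable {U : Str →. Str} (h : PFD U) : Summable (wU U) :=
  summable_of_sum_le (wU_nonneg U) (wU_sum h)

/-- Kraft measure of a set of strings. -/
noncomputable def mu (U : Str →. Str) (P : Set Str) : ℝ := ∑' ρ, P.indicator (wU U) ρ

section
variable {U : Str →. Str}

theorem ind_summable (h : PFD U) (P : Set Str) : Summable (P.indicator (wU U)) :=
  (wU_summable h).indicator P

theorem mu_nonneg (P : Set Str) : 0 ≤ mu U P :=
  tsum_nonneg fun _ => Set.indicator_nonneg (fun ρ _ => wU_nonneg U ρ) _

theorem mu_mono (h : PFD U) {P Q : Set Str} (hPQ : P ⊆ Q) : mu U P ≤ mu U Q :=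
  (ind_summable h P).tsum_le_tsum
    (Set.indicator_le_indicator_of_subset hPQ (wU_nonneg U)) (ind_summable h Q)

theorem mu_le_one (h : PFD U) (P : Set Str) : mu U P ≤ 1 := by
  refine Real.tsum_le_of_sum_le (fun _ => Set.indicator_nonneg (fun ρ _ => wU_nonneg U ρ) _) ?_
  intro S
  exact (Finset.sum_le_sum fun ρ _ =>
    Set.indicator_le_self' (f := wU U) (fun x _ => wU_nonneg U x) ρ).trans (wU_sum h S)

theorem mu_union (h : PFD U) {P Q : Set Str} (hPQ : Disjoint P Q) :
    mu U (P ∪ Q) = mu U P + mu U Q := by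
  unfold mu
  rw [← (ind_summable h P).tsum_add (ind_summable h Q)]
  congr 1
  ext ρ
  rw [Set.indicator_union_of_disjoint hPQ]

theorem mu_add_le (h : PFD U) {P Q R : Set Str} (hP : P ⊆ R) (hQ : Q ⊆ R)
    (hd : ∀ ρ ∈ P, ρ ∉ Q) : mu U P + mu U Q ≤ mu U R := by
  rw [← mu_union h (Set.disjoint_left.2 hd)]
  exact mu_mono h (Set.union_subset hP hQ)

theorem mu_union_le (h : PFD U) (P Q : Set Str) : mu U (P ∪ Q) ≤ mu U P + mu U Q := by
  rw [← Set.union_sdiff_self, mu_union h Set.disjoint_sdiff_right]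
  linarith [mu_mono h (Set.sdiff_subset (s := Q) (t := P))]

theorem mu_empty : mu U ∅ = 0 := by simp [mu]

theorem mu_sum_le (h : PFD U) {ι : Type*} (S : Finset ι) (P : ι → Set Str) (R : Set Str)
    (hR : ∀ i ∈ S, P i ⊆ R) (hd : ∀ i ∈ S, ∀ j ∈ S, i ≠ j → ∀ ρ ∈ P i, ρ ∉ P j) :
    ∑ i ∈ S, mu U (P i) ≤ mu U R := by
  induction S using Finset.induction_on generalizing R with
  | empty => simpa using mu_nonneg R
  | insert a S ha ih =>
    rw [Finset.sum_insert ha]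
    have h1 := ih (R \ P a) (fun i hi ρ hρ => ⟨hR i (Finset.mem_insert_of_mem hi) hρ,
      hd i (Finset.mem_insert_of_mem hi) a (Finset.mem_insert_self _ _)
        (by rintro rfl; exact ha hi) ρ hρ⟩)
      (fun i hi j hj => hd i (Finset.mem_insert_of_mem hi) j (Finset.mem_insert_of_mem hj))
    have h2 := mu_add_le h (R := R) (P := P a) (Q := R \ P a) (hR a (Finset.mem_insert_self _ _))
      Set.sdiff_subset (fun ρ hρ hq => hq.2 hρ)
    linarith

theorem mu_single {ρ : Str} (hρ : (U ρ).Dom) : mu U {ρ} = (1 / 2 : ℝ) ^ ρ.length := by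
  unfold mu
  rw [tsum_eq_single ρ]
  · simp [wU, hρ]
  · intro σ hσ; simp [hσ]

end

/-! ### Weights of lists of exponents -/

/-- Weight of a list of exponents. -/
noncomputable def lw (l : List ℕ) : ℝ := (l.map fun x => (1 / 2 : ℝ) ^ x).sum

@[simp] theorem lw_nil : lw [] = 0 := by simp [lw]
@[simp] theorem lw_cons (x : ℕ) (l : List ℕ) : lw (x :: l) = (1 / 2 : ℝ) ^ x + lw l := by simp [lw]
@[simp] theorem lw_append (l l' : List ℕ) : lw (l ++ l') = lw l + lw l' := by simp [lw]
theorem lw_nonneg (l : List ℕ) : 0 ≤ lw l := by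
  induction l with
  | nil => simp
  | cons x l ih => rw [lw_cons]; positivity
theorem lw_add (l : List ℕ) (j : ℕ) : lw (l.map (· + j)) = lw l * (1 / 2) ^ j := by
  induction l with
  | nil => simp
  | cons x l ih => rw [List.map_cons, lw_cons, ih, lw_cons, pow_add]; ring

/-- Numerator of the weight at scale `E`. -/
def nw (E : ℕ) (l : List ℕ) : ℕ := (l.map fun x => 2 ^ (E - x)).sum

theorem nw_eq (E : ℕ) (l : List ℕ) (h : ∀ x ∈ l, x ≤ E) : (nw E l : ℝ) = lw l * 2 ^ E := by
  induction l with
  | nil => simp [nw]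
  | cons x l ih =>
    have h1 : (nw E (x :: l) : ℝ) = 2 ^ (E - x) + nw E l := by simp [nw]
    rw [h1, ih fun y hy => h y (by simp [hy]), lw_cons, add_mul]
    congr 1
    have hx := h x (by simp)
    rw [one_div, inv_pow, pow_sub₀ _ (by norm_num) hx]; ring

theorem nw_sum (l : List ℕ) : (nw l.sum l : ℝ) = lw l * 2 ^ l.sum :=
  nw_eq _ _ fun _ hx => List.le_sum_of_mem hx

/-- Comparison of weights. -/
def leW (l l' : List ℕ) : Bool :=
  decide (nw (l.sum + l'.sum) l ≤ nw (l.sum + l'.sum) l')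

theorem leW_iff (l l' : List ℕ) : leW l l' = true ↔ lw l ≤ lw l' := by
  unfold leW
  rw [decide_eq_true_iff, ← Nat.cast_le (α := ℝ),
    nw_eq _ _ fun x hx => (List.le_sum_of_mem hx).trans (Nat.le_add_right _ _),
    nw_eq _ _ fun x hx => (List.le_sum_of_mem hx).trans (Nat.le_add_left _ _)]
  exact mul_le_mul_iff_left₀ (by positivity)

@[fun_prop] theorem nw_prim {α : Type*} [Primcodable α] {f : α → ℕ} {g : α → List ℕ}
    (hf : Primrec f) (hg : Primrec g) : Primrec fun a => nw (f a) (g a) := by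
  unfold nw; fun_prop

@[fun_prop] theorem leW_prim {α : Type*} [Primcodable α] {f g : α → List ℕ}
    (hf : Primrec f) (hg : Primrec g) : Primrec fun a => leW (f a) (g a) := by
  unfold leW; fun_prop

/-- Weight of a duplicate-free list of strings in the domain. -/
theorem mu_list {U : Str →. Str} (h : PFD U) (l : List Str) (hn : l.Nodup)
    (hd : ∀ ρ ∈ l, (U ρ).Dom) : lw (l.map List.length) = mu U {ρ | ρ ∈ l} := by
  induction l with
  | nil => simp [mu]
  | cons x l ih =>
    rw [List.map_cons, lw_cons, ih (List.nodup_cons.1 hn).2 fun ρ hρ => hd ρ (by simp [hρ]),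
      ← mu_single (hd x (by simp)), ← mu_union h]
    · congr 1; ext ρ; simp
    · rw [Set.disjoint_left]
      rintro ρ rfl hρ
      exact (List.nodup_cons.1 hn).1 hρ

/-! ### Initial segments -/

@[fun_prop] theorem restrSeq_prim {α : Type*} [Primcodable α] {e : α → ℕ → Bool} {m : α → ℕ}
    (he : Primrec fun p : α × ℕ => e p.1 p.2) (hm : Primrec m) :
    Primrec fun a => restrSeq (e a) (m a) := by unfold restrSeq; fun_prop

theorem restrSeq_length (e : ℕ → Bool) (m : ℕ) : (restrSeq e m).length = m := by
  simp [restrSeq]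

theorem restrSeq_eq {e e' : ℕ → Bool} {m : ℕ} :
    restrSeq e m = restrSeq e' m ↔ ∀ i < m, e i = e' i := by
  simp [restrSeq, List.map_inj_left]

theorem restrSeq_inj {e e' : ℕ → Bool} {m m' : ℕ} (h : restrSeq e m = restrSeq e' m') : m = m' := by
  have := congrArg List.length h
  simpa [restrSeq_length] using this

theorem restrSet_eq (A : Set ℕ) (m : ℕ) : restrSet A m = restrSeq (seqOfSet A) m := rfl

theorem restrSeq_zero (m : ℕ) : restrSeq (fun _ => false) m = zeroStr m := by
  simp [restrSeq, zeroStr]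

/-- Monotone approximations. -/
def Mon (e : ℕ → ℕ → Bool) : Prop := ∀ s t i, s ≤ t → e s i = true → e t i = true

theorem Mon.mid {e : ℕ → ℕ → Bool} (h : Mon e) {r u t m : ℕ} (h1 : r ≤ u) (h2 : u ≤ t)
    (h3 : restrSeq (e r) m = restrSeq (e t) m) : restrSeq (e u) m = restrSeq (e t) m := by
  rw [restrSeq_eq] at *
  intro i hi
  have := h3 i hi
  cases hu : e u i
  · cases hr : e r i
    · rw [← this, hr]
    · rw [h r u i h1 hr] at hu; cases hu
  · exact (h u t i h2 hu).symm

theorem Mon.mid' {e : ℕ → ℕ → Bool} (h : Mon e) {r u t m : ℕ} (h1 : r ≤ u) (h2 : u ≤ t)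
    (h3 : restrSeq (e r) m = restrSeq (e t) m) : restrSeq (e r) m = restrSeq (e u) m :=
  h3.trans (h.mid h1 h2 h3).symm

theorem restrSeq_le {e e' : ℕ → Bool} {m m' : ℕ} (h : m ≤ m')
    (h3 : restrSeq e m' = restrSeq e' m') : restrSeq e m = restrSeq e' m := by
  rw [restrSeq_eq] at *
  intro i hi
  exact h3 i (by omega)

/-! ### Kraft–Chaitin machines -/

@[fun_prop] theorem PR.drop {α β : Type*} [Primcodable α] [Primcodable β] {f : α → List β}
    {g : α → ℕ} (hf : Primrec f) (hg : Primrec g) :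
    Primrec fun a => (f a).drop (g a) := Primrec.list_drop.comp hg hf

/-- Weight of an optional request. -/
noncomputable def wo (o : Option (ℕ × Str)) : ℝ := o.elim 0 fun p => (1 / 2 : ℝ) ^ p.1

@[simp] theorem wo_none : wo Option.none = 0 := rfl
@[simp] theorem wo_some (p : ℕ × Str) : wo (Option.some p) = (1 / 2 : ℝ) ^ p.1 := rfl
theorem wo_nonneg (o : Option (ℕ × Str)) : 0 ≤ wo o := by
  cases o <;> simp

/-- Exponents of the first requests. -/
def ks (f : ℕ → ℕ → Option (ℕ × Str)) (a i : ℕ) : List ℕ :=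
  (List.range i).filterMap fun j => (f a j).map fun p => p.1

theorem lw_ks (f : ℕ → ℕ → Option (ℕ × Str)) (a i : ℕ) :
    lw (ks f a i) = ∑ j ∈ Finset.range i, wo (f a j) := by
  induction i with
  | zero => simp [ks]
  | succ i ih =>
    rw [Finset.sum_range_succ, ← ih]
    unfold ks
    rw [List.range_succ, List.filterMap_append, lw_append]
    congr 1
    cases h : f a i <;> simp [h]

/-- Binary value. -/
def bval (τ : Str) : ℕ := τ.foldl (fun n b => cond b (2 * n + 1) (2 * n)) 0

theorem bval_append (τ τ' : Str) :
    bval τ * 2 ^ τ'.length ≤ bval (τ ++ τ') ∧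
      bval (τ ++ τ') + 1 ≤ (bval τ + 1) * 2 ^ τ'.length := by
  induction τ' using List.reverseRecOn with
  | nil => simp
  | append_singleton l b ih =>
    rw [← List.append_assoc]
    have : bval (τ ++ l ++ [b]) = cond b (2 * bval (τ ++ l) + 1) (2 * bval (τ ++ l)) := by
      simp [bval, List.foldl_append]
    rw [this, List.length_append, List.length_singleton, pow_succ]
    obtain ⟨h1, h2⟩ := ih
    constructor
    · cases b <;> simp <;> nlinarith
    · cases b <;> simp <;> nlinarith

theorem bval_inj {τ τ' : Str} (h : τ.length = τ'.length) (hb : bval τ = bval τ') : τ = τ' := by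
  induction τ using List.reverseRecOn generalizing τ' with
  | nil => exact (List.length_eq_zero_iff.1 h.symm).symm
  | append_singleton l b ih =>
    induction τ' using List.reverseRecOn with
    | nil => simp at h
    | append_singleton l' b' _ =>
      have e : ∀ (l : Str) b, bval (l ++ [b]) = cond b (2 * bval l + 1) (2 * bval l) := by
        intro l b; simp [bval, List.foldl_append]
      rw [e, e] at hb
      have h' : l.length = l'.length := by simpa using h
      have : bval l = bval l' ∧ b = b' := by
        cases b <;> cases b' <;> simp at hb ⊢ <;> omega
      rw [ih h' this.1, this.2]

theorem bval_exists (n v : ℕ) (h : v < 2 ^ n) : ∃ τ : Str, τ.length = n ∧ bval τ = v := by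
  induction n generalizing v with
  | zero => exact ⟨[], rfl, by simp at h; simp [h, bval]⟩
  | succ n ih =>
    obtain ⟨τ, h1, h2⟩ := ih (v / 2) (by rw [pow_succ] at h; omega)
    refine ⟨τ ++ [decide (v % 2 = 1)], by simp [h1], ?_⟩
    have e : ∀ (l : Str) b, bval (l ++ [b]) = cond b (2 * bval l + 1) (2 * bval l) := by
      intro l b; simp [bval, List.foldl_append]
    rw [e, h2]
    rcases Nat.mod_two_eq_zero_or_one v with h | h <;> simp [h] <;> omega

/-- The check made by the Kraft–Chaitin machine. -/
def kchk (f : ℕ → ℕ → Option (ℕ × Str)) (ρ : Str) (q : ℕ) : Bool :=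
  (f q.unpair.1 q.unpair.2).elim false fun p =>
    decide (ρ.take (q.unpair.1 + 1) = List.replicate q.unpair.1 false ++ [true]) &&
    decide (ρ.length = q.unpair.1 + 1 + (p.1 + 1)) &&
    leW (p.1 :: ks f q.unpair.1 q.unpair.2) [0] &&
    decide (bval (ρ.drop (q.unpair.1 + 1)) =
      (nw (ks f q.unpair.1 q.unpair.2).sum (ks f q.unpair.1 q.unpair.2) * 2 ^ (p.1 + 1) +
        2 ^ (ks f q.unpair.1 q.unpair.2).sum - 1) / 2 ^ (ks f q.unpair.1 q.unpair.2).sum)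

theorem kchk_prim {f : ℕ → ℕ → Option (ℕ × Str)}
    (hf : Primrec fun q : ℕ × ℕ => f q.1 q.2) : Primrec fun q : Str × ℕ => kchk f q.1 q.2 := by
  have hf' : ∀ {α : Type} [Primcodable α] {a b : α → ℕ}, Primrec a → Primrec b →
      Primrec fun x => f (a x) (b x) := fun ha hb => hf.comp (ha.pair hb)
  have hks : ∀ {α : Type} [Primcodable α] {a b : α → ℕ}, Primrec a → Primrec b →
      Primrec fun x => ks f (a x) (b x) := by
    intro α _ a b ha hb
    unfold ks
    have := hf' (α := α × ℕ) (a := fun p => a p.1) (b := fun p => p.2) (by fun_prop) (by fun_prop)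
    fun_prop
  have hbv : ∀ {α : Type} [Primcodable α] {a : α → Str}, Primrec a →
      Primrec fun x => bval (a x) := by
    intro α _ a ha
    unfold bval; fun_prop
  have h1 := hf' (α := Str × ℕ) (a := fun p => p.2.unpair.1) (b := fun p => p.2.unpair.2)
    (by fun_prop) (by fun_prop)
  have h2 := hks (α := (Str × ℕ) × (ℕ × Str)) (a := fun p => p.1.2.unpair.1)
    (b := fun p => p.1.2.unpair.2) (by fun_prop) (by fun_prop)
  have h3 := hbv (α := (Str × ℕ) × (ℕ × Str)) (a := fun p => p.1.1.drop (p.1.2.unpair.1 + 1))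
    (by fun_prop)
  unfold kchk
  fun_prop

/-- Unfolded check, in real terms. -/
theorem kchk_iff (f : ℕ → ℕ → Option (ℕ × Str)) (ρ : Str) (a i : ℕ) :
    kchk f ρ (Nat.pair a i) = true ↔ ∃ k σ, f a i = Option.some (k, σ) ∧
      ρ.take (a + 1) = List.replicate a false ++ [true] ∧ ρ.length = a + 1 + (k + 1) ∧
      (∑ j ∈ Finset.range i, wo (f a j)) + (1 / 2) ^ k ≤ 1 ∧
      (∑ j ∈ Finset.range i, wo (f a j)) * 2 ^ (k + 1) ≤ bval (ρ.drop (a + 1)) ∧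
      bval (ρ.drop (a + 1)) < (∑ j ∈ Finset.range i, wo (f a j)) * 2 ^ (k + 1) + 1 := by
  unfold kchk
  simp only [Nat.unpair_pair]
  cases h : f a i with
  | none => simp
  | some p =>
    obtain ⟨k, σ⟩ := p
    simp only [Option.elim_some, Bool.and_eq_true, decide_eq_true_eq, leW_iff, lw_cons, lw_nil,
      lw_ks, Option.some.injEq, Prod.mk.injEq]
    have key : ∀ v : ℕ, v = (nw (ks f a i).sum (ks f a i) * 2 ^ (k + 1) + 2 ^ (ks f a i).sum - 1) /
        2 ^ (ks f a i).sum ↔ (∑ j ∈ Finset.range i, wo (f a j)) * 2 ^ (k + 1) ≤ v ∧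
        v < (∑ j ∈ Finset.range i, wo (f a j)) * 2 ^ (k + 1) + 1 := by
      intro v
      have hn := nw_sum (ks f a i)
      rw [lw_ks] at hn
      set n := nw (ks f a i).sum (ks f a i)
      set E := (ks f a i).sum
      set S := ∑ j ∈ Finset.range i, wo (f a j)
      have hE : 0 < 2 ^ E := by positivity
      have hER : (0 : ℝ) < 2 ^ E := by positivity
      rw [eq_comm, Nat.div_eq_iff hE]
      have c1 : S * 2 ^ (k + 1) ≤ v ↔ n * 2 ^ (k + 1) ≤ v * 2 ^ E := by
        rw [← Nat.cast_le (α := ℝ)]; push_cast; rw [hn, ← mul_le_mul_iff_left₀ hER]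
        ring_nf
      have c2 : (v : ℝ) < S * 2 ^ (k + 1) + 1 ↔ v * 2 ^ E < n * 2 ^ (k + 1) + 2 ^ E := by
        rw [← Nat.cast_lt (α := ℝ)]; push_cast; rw [hn, ← mul_lt_mul_iff_left₀ hER]
        ring_nf
      rw [c1, c2]
      omega
    constructor
    · rintro ⟨⟨⟨h1, h2⟩, h3⟩, h4⟩
      exact ⟨k, σ, ⟨rfl, rfl⟩, h1, h2, by simpa [add_comm] using h3, (key _).1 h4⟩
    · rintro ⟨k', σ', ⟨rfl, rfl⟩, h1, h2, h3, h4⟩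
      exact ⟨⟨⟨h1, h2⟩, by simpa [add_comm] using h3⟩, (key _).2 h4⟩

theorem code_inj {a a' : ℕ} {ρ ρ' : Str} (h : ρ.take (a + 1) = List.replicate a false ++ [true])
    (h' : ρ'.take (a' + 1) = List.replicate a' false ++ [true]) (hp : ρ <+: ρ') : a = a' := by
  have g : ∀ {b : ℕ} {τ : Str}, τ.take (b + 1) = List.replicate b false ++ [true] →
      (∀ i < b, τ[i]? = Option.some false) ∧ τ[b]? = Option.some true := by
    intro b τ hb
    have e : ∀ i < b + 1, τ[i]? = (List.replicate b false ++ [true])[i]? := by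
      intro i hi
      rw [← hb, List.getElem?_take_of_lt hi]
    constructor
    · intro i hi
      rw [e i (by omega), List.getElem?_append_left (by simpa using hi)]
      simp [hi]
    · rw [e b (by omega), List.getElem?_append_right (by simp)]
      simp
  obtain ⟨g1, g2⟩ := g h
  obtain ⟨g3, g4⟩ := g h'
  obtain ⟨τ, rfl⟩ := hp
  have e : ∀ (i : ℕ) (b : Bool), ρ[i]? = Option.some b → (ρ ++ τ)[i]? = Option.some b := by
    intro i b hi
    rw [List.getElem?_append_left (List.getElem?_eq_some_iff.1 hi).1, hi]
  rcases lt_trichotomy a a' with q | q | q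
  · have := e _ _ g2; rw [g3 a q] at this; simp at this
  · exact q
  · have := e _ _ (g1 a' q); rw [g4] at this; simp at this

theorem kchk_pf (f : ℕ → ℕ → Option (ℕ × Str)) {ρ ρ' : Str} {q q' : ℕ}
    (h : kchk f ρ q = true) (h' : kchk f ρ' q' = true) (hp : ρ <+: ρ') : ρ = ρ' ∧ q = q' := by
  obtain ⟨a, i, rfl⟩ : ∃ a i, q = Nat.pair a i := ⟨q.unpair.1, q.unpair.2, by simp⟩
  obtain ⟨a', i', rfl⟩ : ∃ a i, q' = Nat.pair a i := ⟨q'.unpair.1, q'.unpair.2, by simp⟩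
  obtain ⟨k, σ, h0, h1, h2, -, h4, h5⟩ := (kchk_iff f ρ a i).1 h
  obtain ⟨k', σ', h0', h1', h2', -, h4', h5'⟩ := (kchk_iff f ρ' a' i').1 h'
  obtain rfl := code_inj h1 h1' hp
  have hmono : ∀ i j k σ, f a i = Option.some (k, σ) → i < j →
      (∑ j ∈ Finset.range i, wo (f a j)) + (1 / 2) ^ k ≤ ∑ j ∈ Finset.range j, wo (f a j) := by
    intro i j k σ hf hij
    have : (∑ j ∈ Finset.range i, wo (f a j)) + (1 / 2) ^ k =
        ∑ j ∈ Finset.range (i + 1), wo (f a j) := by rw [Finset.sum_range_succ, hf]; rfl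
    rw [this]
    exact Finset.sum_le_sum_of_subset_of_nonneg (Finset.range_mono hij)
      fun _ _ _ => wo_nonneg _
  obtain ⟨τ, rfl⟩ := hp
  have ha : a + 1 ≤ ρ.length := by omega
  rw [List.drop_append_of_le_length ha] at h4' h5'
  obtain ⟨b1, b2⟩ := bval_append (ρ.drop (a + 1)) τ
  set v := bval (ρ.drop (a + 1))
  set v' := bval (ρ.drop (a + 1) ++ τ)
  have hl : k' = k + τ.length := by
    rw [List.length_append] at h2'; omega
  subst hl
  have b1' : (v : ℝ) * 2 ^ τ.length ≤ v' := by exact_mod_cast b1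
  have b2' : (v' : ℝ) + 1 ≤ (v + 1) * 2 ^ τ.length := by exact_mod_cast b2
  have p1 : (0 : ℝ) < 2 ^ τ.length := by positivity
  have p2 : (0 : ℝ) < 2 ^ (k + 1) := by positivity
  have e1 : (2 : ℝ) ^ (k + τ.length + 1) = 2 ^ (k + 1) * 2 ^ τ.length := by rw [← pow_add]; congr 1; omega
  have e2 : (1 / 2 : ℝ) ^ k * 2 ^ (k + 1) = 2 := by
    rw [pow_succ, ← mul_assoc, ← mul_pow]; norm_num
  have e3 : (1 / 2 : ℝ) ^ (k + τ.length) * (2 ^ (k + 1) * 2 ^ τ.length) = 2 := by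
    rw [← e1, pow_succ, ← mul_assoc, ← mul_pow]; norm_num
  rw [e1] at h4' h5'
  rcases lt_trichotomy i i' with q | rfl | q
  · exfalso
    have := hmono i i' k σ h0 q
    have m1 := mul_le_mul_of_nonneg_right this (mul_pos p2 p1).le
    have m2 : ((∑ j ∈ Finset.range i, wo (f a j)) + (1 / 2) ^ k) * (2 ^ (k + 1) * 2 ^ τ.length) =
      ((∑ j ∈ Finset.range i, wo (f a j)) * 2 ^ (k + 1) + 2) * 2 ^ τ.length := by
      rw [add_mul, ← mul_assoc ((1 / 2 : ℝ) ^ k), e2]; ring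
    have m3 := mul_lt_mul_of_pos_right h5 p1
    nlinarith
  · have hk : k = k + τ.length := by
      rw [h0] at h0'; simpa using (congrArg (Prod.fst) (Option.some_injective _ h0'))
    have : τ = [] := List.length_eq_zero_iff.1 (by omega)
    subst this
    simp
  · exfalso
    have := hmono i' i _ σ' h0' q
    have m1 := mul_le_mul_of_nonneg_right this (mul_pos p2 p1).le
    have m3 := mul_le_mul_of_nonneg_right h4 p1.le
    rw [add_mul, e3] at m1
    nlinarith

theorem KC_le_of_mem {M : Str →. Str} {σ ρ : Str} (h : σ ∈ M ρ) : KC M σ ≤ ρ.length :=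
  iInf_le (fun ρ : {ρ : Str // σ ∈ M ρ} => ((ρ : Str).length : ℕ∞)) ⟨ρ, h⟩

theorem KC_exists {M : Str →. Str} {σ : Str} {n : ℕ} (h : KC M σ ≤ n) :
    ∃ ρ, σ ∈ M ρ ∧ ρ.length ≤ n := by
  by_contra hc
  push Not at hc
  have : ((n + 1 : ℕ) : ℕ∞) ≤ KC M σ := by
    refine le_iInf fun ρ => ?_
    exact_mod_cast hc ρ.1 ρ.2
  have h2 := this.trans h
  have h3 : n + 1 ≤ n := by exact_mod_cast h2
  omega

/-- Kraft–Chaitin. -/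
theorem kraft_chaitin {U : Str →. Str} (hU : OptimalPF U) {f : ℕ → ℕ → Option (ℕ × Str)}
    (hf : Primrec fun q : ℕ × ℕ => f q.1 q.2) :
    ∃ c : ℕ, ∀ a i k σ, f a i = Option.some (k, σ) →
      (∑ j ∈ Finset.range i, wo (f a j)) + (1 / 2) ^ k ≤ 1 → KC U σ ≤ (k + a + c : ℕ) := by
  let out : ℕ → Str := fun q => (f q.unpair.1 q.unpair.2).elim [] fun p => p.2
  have hout : Primrec out := by
    have h1 : Primrec fun q : ℕ => f q.unpair.1 q.unpair.2 :=
      hf.comp (f := fun q => f q.1 q.2) (g := fun q : ℕ => (q.unpair.1, q.unpair.2))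
        (by fun_prop)
    exact PR.oelim h1 (by fun_prop) (by fun_prop)
  let M : Str →. Str := fun ρ => (Nat.rfind (fun q => Part.some (kchk f ρ q))).map out
  have hM : Partrec M := by
    refine Partrec.map (Partrec.rfind (p := fun ρ q => Part.some (kchk f ρ q)) ?_) ?_
    · exact (kchk_prim hf).to_comp.partrec
    · exact (hout.to_comp.comp Computable.snd)
  have hdom : ∀ ρ, (M ρ).Dom → ∃ q, kchk f ρ q = true := by
    intro ρ h
    have h : (Nat.rfind (fun q => Part.some (kchk f ρ q))).Dom := h
    obtain ⟨q, hq⟩ := Part.dom_iff_mem.1 h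
    exact ⟨q, (Part.mem_some_iff.1 (Nat.rfind_spec hq)).symm⟩
  have hval : ∀ ρ q, kchk f ρ q = true → out q ∈ M ρ := by
    intro ρ q hq
    refine Part.mem_map _ ?_
    refine Nat.mem_rfind.2 ⟨by simp [hq], fun {m} hm => ?_⟩
    cases hmm : kchk f ρ m
    · simp
    · have := (kchk_pf f hq hmm (List.prefix_refl _)).2
      omega
  obtain ⟨c, hc⟩ := hU.2 M ⟨hM, fun ρ₁ ρ₂ h1 h2 hp => by
    obtain ⟨q, hq⟩ := hdom _ h1
    obtain ⟨q', hq'⟩ := hdom _ h2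
    exact (kchk_pf f hq hq' hp).1⟩
  refine ⟨c + 2, fun a i k σ hfa hS => ?_⟩
  set S := ∑ j ∈ Finset.range i, wo (f a j) with hSd
  have hS0 : 0 ≤ S := Finset.sum_nonneg fun _ _ => wo_nonneg _
  obtain ⟨τ, t1, t2⟩ := bval_exists (k + 1) ⌈S * 2 ^ (k + 1)⌉₊ (by
    have e2 : (1 / 2 : ℝ) ^ k * 2 ^ (k + 1) = 2 := by
      rw [pow_succ, ← mul_assoc, ← mul_pow]; norm_num
    have := Nat.ceil_lt_add_one (a := S * 2 ^ (k + 1)) (by positivity)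
    have p2 : (0 : ℝ) < 2 ^ (k + 1) := by positivity
    have h3 := mul_le_mul_of_nonneg_right hS p2.le
    rw [add_mul, e2] at h3
    have : (⌈S * 2 ^ (k + 1)⌉₊ : ℝ) < ((2 ^ (k + 1) : ℕ) : ℝ) := by push_cast; linarith
    exact_mod_cast this)
  have hchk : kchk f (List.replicate a false ++ [true] ++ τ) (Nat.pair a i) = true := by
    rw [kchk_iff]
    have e1 : (List.replicate a false ++ [true]).length = a + 1 := by simp
    refine ⟨k, σ, hfa, ?_, ?_, hS, ?_⟩
    · rw [List.take_append_of_le_length (by simp), List.take_of_length_le (by simp)]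
    · rw [List.length_append, e1, t1]
    · rw [List.drop_append_of_le_length (by simp), List.drop_of_length_le (by simp), List.nil_append, t2]
      exact ⟨Nat.le_ceil _, Nat.ceil_lt_add_one (by positivity)⟩
  have hmem := hval _ _ hchk
  have ho : out (Nat.pair a i) = σ := by simp [out, hfa]
  rw [ho] at hmem
  have := (hc σ).trans (add_le_add_left (KC_le_of_mem hmem) _)
  refine this.trans ?_
  have e : (List.replicate a false ++ [true] ++ τ).length = a + 1 + (k + 1) := by simp [t1]; omega
  rw [e]
  norm_cast
  omega

/-! ### Transformations of descriptions -/

/-- Injective decoding of strings. -/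
def dc (n : ℕ) : Option Str :=
  (Encodable.decode n : Option Str).bind fun ρ =>
    cond (decide (Encodable.encode ρ = n)) (Option.some ρ) Option.none

@[fun_prop] theorem dc_prim {α : Type*} [Primcodable α] {f : α → ℕ} (hf : Primrec f) :
    Primrec fun a => dc (f a) := by unfold dc; fun_prop

theorem dc_iff {n : ℕ} {ρ : Str} : dc n = Option.some ρ ↔ n = Encodable.encode ρ := by
  unfold dc
  rw [Option.bind_eq_some_iff]
  constructor
  · rintro ⟨τ, h1, h2⟩
    by_cases h : Encodable.encode τ = n
    · simp [h] at h2; rw [← h2, h]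
    · simp [h] at h2
  · rintro rfl
    exact ⟨ρ, by simp, by simp⟩

theorem sum_dc_le {U : Str →. Str} (h : PFD U) (P : Set Str) (I : ℕ) :
    ∑ n ∈ Finset.range I, (dc n).elim 0 (P.indicator (wU U)) ≤ mu U P := by
  have e : ∀ n, (dc n).elim 0 (P.indicator (wU U)) =
      ∑ ρ ∈ (dc n).toFinset, P.indicator (wU U) ρ := by
    intro n; cases dc n <;> simp
  simp_rw [e]
  rw [← Finset.sum_biUnion]
  · exact (ind_summable h P).sum_le_tsum _
      fun _ _ => Set.indicator_nonneg (fun ρ _ => wU_nonneg U ρ) _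
  · intro i _ j _ hij
    rw [Function.onFun, Finset.disjoint_left]
    intro ρ h1 h2
    rw [Option.mem_toFinset, Option.mem_def, dc_iff] at h1 h2
    exact hij (h1.trans h2.symm)

theorem sum_unpair_le {w : ℕ → ℕ → ℝ} (hw : ∀ t n, 0 ≤ w t n) (I : ℕ) :
    ∑ i ∈ Finset.range I, w i.unpair.1 i.unpair.2 ≤
      ∑ t ∈ Finset.range I, ∑ n ∈ Finset.range I, w t n := by
  rw [← Finset.sum_product']
  have : ∑ i ∈ Finset.range I, w i.unpair.1 i.unpair.2 =
      ∑ p ∈ (Finset.range I).image Nat.unpair, w p.1 p.2 := by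
    rw [Finset.sum_image]
    intro x _ y _ hxy
    have := congrArg (fun p : ℕ × ℕ => Nat.pair p.1 p.2) hxy
    simpa using this
  rw [this]
  refine Finset.sum_le_sum_of_subset_of_nonneg ?_ fun _ _ _ => hw _ _
  intro p hp
  obtain ⟨i, hi, rfl⟩ := Finset.mem_image.1 hp
  rw [Finset.mem_range] at hi
  exact Finset.mem_product.2 ⟨Finset.mem_range.2 ((Nat.unpair_left_le i).trans_lt hi),
    Finset.mem_range.2 ((Nat.unpair_right_le i).trans_lt hi)⟩

/-- A sum with at most one nonzero term. -/
theorem sum_once {w : ℕ → ℝ} {b : ℝ} (hb : 0 ≤ b) (I : ℕ)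
    (h : ∀ t, w t ≠ 0 → w t ≤ b ∧ ∀ t', w t' ≠ 0 → t' = t) :
    ∑ t ∈ Finset.range I, w t ≤ b := by
  by_cases hc : ∃ t ∈ Finset.range I, w t ≠ 0
  · obtain ⟨t, ht, h0⟩ := hc
    rw [Finset.sum_eq_single_of_mem t ht]
    · exact (h t h0).1
    · intro t' _ hne
      by_contra h1
      exact hne ((h t h0).2 t' h1)
  · push Not at hc
    rw [Finset.sum_eq_zero hc]; exact hb

theorem transform {U : Str →. Str} (hU : OptimalPF U) {F : ℕ → Str → Str}
    (hF : Primrec fun p : ℕ × Str => F p.1 p.2) :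
    ∃ c : ℕ, ∀ a σ, KC U (F a σ) ≤ KC U σ + (a + c : ℕ) := by
  obtain ⟨cU, hc⟩ := exists_uc hU.1.1
  have hpf : PFD U := hU.1.2
  let g : ℕ → ℕ → ℕ → Option (ℕ × Str) := fun a t n =>
    (dc n).bind fun ρ => (us cU (t + 1) ρ).bind fun σ =>
      cond (us cU t ρ).isSome Option.none (Option.some (ρ.length, F a σ))
  have hg : Primrec fun q : ℕ × ℕ => g q.1 q.2.unpair.1 q.2.unpair.2 := by
    have : ∀ {α : Type} [Primcodable α] {a : α → ℕ} {b : α → Str}, Primrec a → Primrec b →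
      Primrec fun x => F (a x) (b x) := fun ha hb => hF.comp (ha.pair hb)
    have := this (α := ((ℕ × ℕ) × Str) × Str) (a := fun p => p.1.1.1) (b := fun p => p.2)
      (by fun_prop) (by fun_prop)
    simp only [g]
    fun_prop
  have hgs : ∀ a t n k σ, g a t n = Option.some (k, σ) → ∃ ρ τ, dc n = Option.some ρ ∧
      us cU (t + 1) ρ = Option.some τ ∧ us cU t ρ = Option.none ∧ k = ρ.length ∧ σ = F a τ := by
    intro a t n k σ h
    obtain ⟨ρ, h1, h⟩ := Option.bind_eq_some_iff.1 h
    obtain ⟨τ, h2, h⟩ := Option.bind_eq_some_iff.1 h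
    cases h3 : us cU t ρ with
    | none =>
      simp [h3] at h
      exact ⟨ρ, τ, h1, h2, h3, h.1.symm, h.2.symm⟩
    | some => simp [h3] at h
  have hsum : ∀ a I, ∑ i ∈ Finset.range I, wo (g a i.unpair.1 i.unpair.2) ≤ 1 := by
    intro a I
    refine (sum_unpair_le (w := fun t n => wo (g a t n)) (fun _ _ => wo_nonneg _) I).trans ?_
    rw [Finset.sum_comm]
    refine le_trans (Finset.sum_le_sum (g := fun n => (dc n).elim 0 (Set.univ.indicator (wU U)))
      fun n _ => ?_) ((sum_dc_le hpf Set.univ I).trans (mu_le_one hpf _))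
    refine sum_once ?_ I ?_
    · cases dc n with
      | none => simp
      | some ρ => simpa using wU_nonneg U ρ
    · intro t ht
      have : ∃ k σ, g a t n = Option.some (k, σ) := by
        cases h : g a t n with
        | none => simp [h] at ht
        | some p => exact ⟨p.1, p.2, rfl⟩
      obtain ⟨k, σ, h⟩ := this
      obtain ⟨ρ, τ, h1, h2, h3, rfl, rfl⟩ := hgs _ _ _ _ _ h
      constructor
      · rw [h, h1]
        simp [wU, hc.dom h2]
      · intro t' ht'
        have : ∃ k σ, g a t' n = Option.some (k, σ) := by
          cases h : g a t' n with
          | none => simp [h] at ht'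
          | some p => exact ⟨p.1, p.2, rfl⟩
        obtain ⟨k', σ', h'⟩ := this
        obtain ⟨ρ', τ', h1', h2', h3', rfl, rfl⟩ := hgs _ _ _ _ _ h'
        have : ρ = ρ' := by rw [h1] at h1'; exact Option.some_injective _ h1'
        subst this
        rcases lt_trichotomy t t' with q | q | q
        · have := us_mono (show t + 1 ≤ t' by omega) h2
          rw [h3'] at this; cases this
        · exact q.symm
        · have := us_mono (show t' + 1 ≤ t by omega) h2'
          rw [h3] at this; cases this
  obtain ⟨c, hcc⟩ := kraft_chaitin hU (f := fun a i => g a i.unpair.1 i.unpair.2) hg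
  refine ⟨c, fun a σ => ?_⟩
  have key : ∀ ρ, σ ∈ U ρ → KC U (F a σ) ≤ (ρ.length + a + c : ℕ) := by
    intro ρ hρ
    have hex := (hc ρ σ).1 hρ
    have hmin : ∃ t, us cU (t + 1) ρ = Option.some σ ∧ us cU t ρ = Option.none := by
      have h1 := Nat.find_spec hex
      have h2 := fun t => Nat.find_min hex (m := t)
      set T := Nat.find hex
      obtain ⟨t, ht⟩ : ∃ t, T = t + 1 := Nat.exists_eq_succ_of_ne_zero (by
        intro h; have := us_bound h1; omega)
      rw [ht] at h1
      refine ⟨t, h1, ?_⟩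
      cases h3 : us cU t ρ with
      | none => rfl
      | some τ =>
        have := us_uniq h1 h3
        subst this
        exact absurd h3 (h2 t (by omega))
    obtain ⟨t, h1, h2⟩ := hmin
    have hgg : g a t (Encodable.encode ρ) = Option.some (ρ.length, F a σ) := by
      simp [g, dc_iff.2 rfl, h1, h2]
    refine hcc a (Nat.pair t (Encodable.encode ρ)) _ _ (by simpa using hgg) ?_
    have := hsum a (Nat.pair t (Encodable.encode ρ) + 1)
    rw [Finset.sum_range_succ] at this
    simp only [Nat.unpair_pair, hgg, wo_some] at this
    exact this
  by_cases htop : KC U σ = ⊤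
  · rw [htop]; simp
  · obtain ⟨n, hn⟩ := ENat.ne_top_iff_exists.1 htop
    obtain ⟨ρ, h1, h2⟩ := KC_exists hn.symm.le
    rw [← hn]
    refine (key ρ h1).trans ?_
    norm_cast
    omega

/-! ### The stack machine -/

/-- The codes for the universal machine and the two c.e. sets. -/
structure Cds where
  /-- universal machine -/
  U : Nat.Partrec.Code
  /-- first set -/
  A : Nat.Partrec.Code
  /-- second set -/
  D : Nat.Partrec.Code

/-- Ledger entries: string, length, start, end. -/
abbrev Ent := Str × ℕ × ℕ × ℕ
/-- Frames: level, start, quota exponent, counter, ledger, pending. -/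
abbrev Frame := ℕ × ℕ × ℕ × ℕ × List Ent × Option (Str × ℕ × ℕ)
/-- States: elements of the set, requests, stack. -/
abbrev Stt := List ℕ × List (ℕ × ℕ) × List Frame

/-- Membership in a list as a Boolean. -/
def inl (xs : List ℕ) (i : ℕ) : Bool := xs.any fun x => decide (x = i)

@[fun_prop] theorem inl_prim {α : Type*} [Primcodable α] {f : α → List ℕ} {g : α → ℕ}
    (hf : Primrec f) (hg : Primrec g) : Primrec fun a => inl (f a) (g a) := by
  unfold inl; fun_prop

theorem inl_iff {xs : List ℕ} {i : ℕ} : inl xs i = true ↔ i ∈ xs := by simp [inl]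

/-- The relevant set for a layer. -/
def zc (P : Cds) (lv : ℕ) : Nat.Partrec.Code := cond (decide (lv % 3 = 2)) P.D P.A

@[fun_prop] theorem zc_prim {α : Type*} [Primcodable α] (P : Cds) {f : α → ℕ}
    (hf : Primrec f) : Primrec fun a => zc P (f a) := by
  unfold zc; fun_prop

/-- The gap parameter. -/
def gp (a : ℕ) : ℕ := 4 * a
/-- The number of levels. -/
def jp (a : ℕ) : ℕ := 3 * 2 ^ (2 * gp a + 3)
/-- The shrinking parameter. -/
def rp (a : ℕ) : ℕ := jp a + 2

@[fun_prop] theorem gp_prim {α : Type*} [Primcodable α] {f : α → ℕ}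
    (hf : Primrec f) : Primrec fun a => gp (f a) := by
  unfold gp; fun_prop
@[fun_prop] theorem jp_prim {α : Type*} [Primcodable α] {f : α → ℕ}
    (hf : Primrec f) : Primrec fun a => jp (f a) := by
  unfold jp; fun_prop
@[fun_prop] theorem rp_prim {α : Type*} [Primcodable α] {f : α → ℕ}
    (hf : Primrec f) : Primrec fun a => rp (f a) := by
  unfold rp; fun_prop

/-- Fulfilment of one request. -/
def goodR (P : Cds) (a T : ℕ) (xs : List ℕ) (q : ℕ × ℕ) : Bool :=
  (List.range T).any fun n => (dc n).elim false fun ρ =>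
    decide (ρ.length ≤ q.1 + gp a) &&
      decide (us P.U T ρ = Option.some (restrSeq (inl xs) q.2))

@[fun_prop] theorem goodR_prim {α : Type*} [Primcodable α] (P : Cds) {a T : α → ℕ}
    {xs : α → List ℕ} {q : α → ℕ × ℕ} (ha : Primrec a) (hT : Primrec T) (hxs : Primrec xs)
    (hq : Primrec q) : Primrec fun x => goodR P (a x) (T x) (xs x) (q x) := by
  unfold goodR; fun_prop

/-- All requests beyond `s` are fulfilled. -/
def good (P : Cds) (a T : ℕ) (xs : List ℕ) (reqs : List (ℕ × ℕ)) (s : ℕ) : Bool :=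
  reqs.all fun q => decide (q.2 ≤ s) || goodR P a T xs q

@[fun_prop] theorem good_prim {α : Type*} [Primcodable α] (P : Cds) {a T s : α → ℕ}
    {xs : α → List ℕ} {q : α → List (ℕ × ℕ)} (ha : Primrec a) (hT : Primrec T) (hxs : Primrec xs)
    (hq : Primrec q) (hs : Primrec s) :
    Primrec fun x => good P (a x) (T x) (xs x) (q x) (s x) := by
  unfold good; fun_prop

/-- Strings describing initial segments of a set beyond `s`. -/
def covS (P : Cds) (c : Nat.Partrec.Code) (T s : ℕ) : List Str :=
  (List.range T).filterMap fun n => (dc n).bind fun ρ => (us P.U T ρ).bind fun σ =>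
    cond (decide (s < σ.length) && decide (σ.length ≤ T) &&
      decide (σ = restrSeq (en c T) σ.length))
      (Option.some ρ) Option.none

@[fun_prop] theorem covS_prim {α : Type*} [Primcodable α] (P : Cds) (c : Nat.Partrec.Code)
    {T s : α → ℕ} (hT : Primrec T) (hs : Primrec s) :
    Primrec fun x => covS P c (T x) (s x) := by
  unfold covS; fun_prop

/-- The coverage is small. -/
def small (P : Cds) (a T s k : ℕ) : Bool :=
  leW ((covS P P.A T s).map List.length ++ (covS P P.D T s).map List.length) [k + 2 * gp a]

@[fun_prop] theorem small_prim {α : Type*} [Primcodable α] (P : Cds)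
    {a T s k : α → ℕ} (ha : Primrec a) (hT : Primrec T) (hs : Primrec s) (hk : Primrec k) :
    Primrec fun x => small P (a x) (T x) (s x) (k x) := by
  unfold small
  have h1 : Primrec fun x => (covS P P.A (T x) (s x)).map (fun ρ => ρ.length) := by fun_prop
  have h2 : Primrec fun x => (covS P P.D (T x) (s x)).map (fun ρ => ρ.length) := by fun_prop
  fun_prop

/-- The requests beyond `s`. -/
def rqs (reqs : List (ℕ × ℕ)) (s : ℕ) : List (ℕ × ℕ) := reqs.filter fun q => decide (s < q.2)

/-- The requests beyond `s` have enough weight. -/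
def heavy (reqs : List (ℕ × ℕ)) (s k : ℕ) : Bool := leW [k] ((rqs reqs s).map fun q => q.1)

@[fun_prop] theorem heavy_prim {α : Type*} [Primcodable α]
    {q : α → List (ℕ × ℕ)} {s k : α → ℕ} (hq : Primrec q) (hs : Primrec s) (hk : Primrec k) :
    Primrec fun x => heavy (q x) (s x) (k x) := by
  unfold heavy rqs; fun_prop

/-- Stale ledger entries. -/
def stale (c : Nat.Partrec.Code) (T : ℕ) (e : Ent) : Bool :=
  !decide (restrSeq (en c T) e.2.1 = restrSeq (en c e.2.2.2) e.2.1)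

@[fun_prop] theorem stale_prim {α : Type*} [Primcodable α] {c : α → Nat.Partrec.Code}
    {T : α → ℕ} {e : α → Ent} (hc : Primrec c) (hT : Primrec T) (he : Primrec e) :
    Primrec fun x => stale (c x) (T x) (e x) := by
  unfold stale; fun_prop

/-- Nominal exponents of ledger entries. -/
def nom (j : ℕ) (led : List Ent) : List ℕ := led.map fun e => e.1.length + j

/-- The bag is full. -/
def full (c : Nat.Partrec.Code) (T k j : ℕ) (led : List Ent) : Bool :=
  leW [k] (nom j (led.filter fun e => stale c T e))

@[fun_prop] theorem full_prim {α : Type*} [Primcodable α] {c : α → Nat.Partrec.Code}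
    {T k j : α → ℕ} {l : α → List Ent} (hc : Primrec c) (hT : Primrec T) (hk : Primrec k)
    (hj : Primrec j) (hl : Primrec l) :
    Primrec fun x => full (c x) (T x) (k x) (j x) (l x) := by
  unfold full nom; fun_prop

/-- The next string to work with. -/
def pick (P : Cds) (c : Nat.Partrec.Code) (T cnt : ℕ) (led : List Ent) : Option (Str × ℕ) :=
  (dc cnt.unpair.1).bind fun ρ => (us P.U T ρ).bind fun σ =>
    cond (decide (σ = zeroStr σ.length) && decide (σ.length ≤ T) &&
      led.all fun e => !decide (e.1 = ρ) || stale c T e) (Option.some (ρ, σ.length)) Option.none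

@[fun_prop] theorem pick_prim {α : Type*} [Primcodable α] (P : Cds) {c : α → Nat.Partrec.Code}
    {T k : α → ℕ} {l : α → List Ent} (hc : Primrec c) (hT : Primrec T) (hk : Primrec k)
    (hl : Primrec l) :
    Primrec fun x => pick P (c x) (T x) (k x) (l x) := by
  unfold pick zeroStr; fun_prop

/-- Step for request frames. -/
def step0 (T : ℕ) (S : Stt) (fr : Frame) : Stt := (S.1, (fr.2.2.1, T) :: S.2.1, S.2.2.tail)

/-- Step for testing frames. -/
def stepT (P : Cds) (a T : ℕ) (S : Stt) (fr : Frame) : Stt :=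
  cond (decide (fr.2.2.2.1 = 0))
    (S.1, S.2.1, (fr.1 - 1, T + 1, fr.2.2.1, 0, [], Option.none) ::
      (fr.1, fr.2.1, fr.2.2.1, 1, [], Option.none) :: S.2.2.tail)
    (cond (good P a T S.1 S.2.1 fr.2.1)
      (cond (small P a T fr.2.1 fr.2.2.1 && heavy S.2.1 fr.2.1 fr.2.2.1) (fr.2.1 :: S.1) S.1,
        S.2.1, S.2.2.tail) S)

/-- Step for layer frames. -/
def stepL (P : Cds) (a T : ℕ) (S : Stt) (fr : Frame) : Stt :=
  fr.2.2.2.2.2.elim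
    (cond (full (zc P fr.1) T fr.2.2.1 (fr.2.2.1 + rp a) fr.2.2.2.2.1) (S.1, S.2.1, S.2.2.tail)
      ((pick P (zc P fr.1) T fr.2.2.2.1 fr.2.2.2.2.1).elim
        (S.1, S.2.1, (fr.1, fr.2.1, fr.2.2.1, fr.2.2.2.1 + 1, fr.2.2.2.2.1, Option.none) ::
          S.2.2.tail)
        fun q => (S.1, S.2.1, (fr.1 - 1, T + 1, q.1.length + (fr.2.2.1 + rp a), 0, [], Option.none) ::
          (fr.1, fr.2.1, fr.2.2.1, fr.2.2.2.1 + 1, fr.2.2.2.2.1,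
            Option.some (q.1, q.2, T + 1)) :: S.2.2.tail)))
    fun p => (S.1, S.2.1, (fr.1, fr.2.1, fr.2.2.1, fr.2.2.2.1, (p.1, p.2.1, p.2.2, T) ::
      fr.2.2.2.2.1, Option.none) :: S.2.2.tail)

/-- One step. -/
def stp (P : Cds) (a T : ℕ) (S : Stt) : Stt :=
  S.2.2.head?.elim S fun fr => cond (decide (fr.1 = 0)) (step0 T S fr)
    (cond (decide (fr.1 % 3 = 1)) (stepT P a T S fr) (stepL P a T S fr))

/-- The state before stage `T`. -/
def st (P : Cds) (a T : ℕ) : Stt :=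
  Nat.rec ([], [], [(jp a, 0, 1, 0, [], Option.none)]) (fun T S => stp P a T S) T

theorem step0_prim {α : Type} [Primcodable α] {T : α → ℕ} {S : α → Stt} {fr : α → Frame}
    (hT : Primrec T) (hS : Primrec S) (hfr : Primrec fr) :
    Primrec fun x => step0 (T x) (S x) (fr x) := by
  unfold step0; fun_prop

set_option maxHeartbeats 1000000 in
theorem stepT_prim {α : Type} [Primcodable α] (P : Cds) {a T : α → ℕ} {S : α → Stt} {fr : α → Frame}
    (ha : Primrec a) (hT : Primrec T) (hS : Primrec S) (hfr : Primrec fr) :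
    Primrec fun x => stepT P (a x) (T x) (S x) (fr x) := by
  unfold stepT; fun_prop

set_option maxHeartbeats 1000000 in
theorem stepL_prim {α : Type} [Primcodable α] (P : Cds) {a T : α → ℕ} {S : α → Stt} {fr : α → Frame}
    (ha : Primrec a) (hT : Primrec T) (hS : Primrec S) (hfr : Primrec fr) :
    Primrec fun x => stepL P (a x) (T x) (S x) (fr x) := by
  unfold stepL; fun_prop

attribute [fun_prop] step0_prim stepT_prim stepL_prim

theorem stp_prim {α : Type} [Primcodable α] (P : Cds) {a T : α → ℕ} {S : α → Stt}
    (ha : Primrec a) (hT : Primrec T) (hS : Primrec S) :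
    Primrec fun x => stp P (a x) (T x) (S x) := by
  unfold stp; fun_prop

attribute [fun_prop] stp_prim

theorem st_prim {α : Type} [Primcodable α] (P : Cds) {a T : α → ℕ}
    (ha : Primrec a) (hT : Primrec T) :
    Primrec fun x => st P (a x) (T x) := by
  unfold st; fun_prop

attribute [fun_prop] st_prim

/-! Step lemmas -/

theorem st_zero (P : Cds) (a : ℕ) : st P a 0 = ([], [], [(jp a, 0, 1, 0, [], Option.none)]) := rfl
theorem st_succ (P : Cds) (a T : ℕ) : st P a (T + 1) = stp P a T (st P a T) := rfl

section
variable {P : Cds} {a T : ℕ} {xs : List ℕ} {reqs : List (ℕ × ℕ)} {lv s k cnt : ℕ}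
  {led : List Ent} {pen : Option (Str × ℕ × ℕ)} {tl : List Frame}

theorem stp_nil : stp P a T (xs, reqs, []) = (xs, reqs, []) := rfl

theorem stp_0 : stp P a T (xs, reqs, (0, s, k, cnt, led, pen) :: tl) = (xs, (k, T) :: reqs, tl) := by
  simp [stp, step0]

theorem stp_T0 (h : lv % 3 = 1) : stp P a T (xs, reqs, (lv, s, k, 0, led, pen) :: tl) =
    (xs, reqs, (lv - 1, T + 1, k, 0, [], Option.none) :: (lv, s, k, 1, [], Option.none) :: tl) := by
  have : lv ≠ 0 := by rintro rfl; simp at h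
  simp [stp, stepT, h, this]

theorem stp_T1 (h : lv % 3 = 1) : stp P a T (xs, reqs, (lv, s, k, cnt + 1, led, pen) :: tl) =
    cond (good P a T xs reqs s) (cond (small P a T s k && heavy reqs s k) (s :: xs) xs, reqs, tl)
      (xs, reqs, (lv, s, k, cnt + 1, led, pen) :: tl) := by
  have : lv ≠ 0 := by rintro rfl; simp at h
  simp [stp, stepT, h, this]

theorem stp_Lp (h0 : lv ≠ 0) (h : lv % 3 ≠ 1) (p : Str × ℕ × ℕ) :
    stp P a T (xs, reqs, (lv, s, k, cnt, led, Option.some p) :: tl) =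
    (xs, reqs, (lv, s, k, cnt, (p.1, p.2.1, p.2.2, T) :: led, Option.none) :: tl) := by
  simp [stp, stepL, h, h0]

theorem stp_Lv (h0 : lv ≠ 0) (h : lv % 3 ≠ 1) :
    stp P a T (xs, reqs, (lv, s, k, cnt, led, Option.none) :: tl) =
    cond (full (zc P lv) T k (k + rp a) led) (xs, reqs, tl)
      ((pick P (zc P lv) T cnt led).elim
        (xs, reqs, (lv, s, k, cnt + 1, led, Option.none) :: tl)
        fun q => (xs, reqs, (lv - 1, T + 1, q.1.length + (k + rp a), 0, [], Option.none) ::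
          (lv, s, k, cnt + 1, led, Option.some (q.1, q.2, T + 1)) :: tl)) := by
  simp [stp, stepL, h, h0]

end

/-! ### Unconditional invariants -/

/-- The basic invariant of the stack machine. -/
structure Binv (T : ℕ) (S : Stt) : Prop where
  xlt : ∀ x ∈ S.1, x < T
  rlt : ∀ q ∈ S.2.1, q.2 < T
  rnd : S.2.1.Pairwise fun q q' => q.2 ≠ q'.2
  sle : ∀ f ∈ S.2.2, f.2.1 ≤ T
  sdec : S.2.2.Pairwise fun f f' => f'.2.1 < f.2.1
  snx : ∀ f ∈ S.2.2, f.2.1 ∉ S.1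

/-- How one step can look like. -/
inductive Stp (P : Cds) (a T : ℕ) : Stt → Stt → Prop
  | same (S : Stt) : Stp P a T S S
  | req (xs rq fr tl) : Stp P a T (xs, rq, fr :: tl) (xs, (fr.2.2.1, T) :: rq, tl)
  | repl (xs rq fr fr' tl) (h : fr'.2.1 = fr.2.1) : Stp P a T (xs, rq, fr :: tl) (xs, rq, fr' :: tl)
  | push (xs rq fr fr' nw tl) (h : fr'.2.1 = fr.2.1) (h' : nw.2.1 = T + 1) :
      Stp P a T (xs, rq, fr :: tl) (xs, rq, nw :: fr' :: tl)
  | pop (xs rq fr tl) : Stp P a T (xs, rq, fr :: tl) (xs, rq, tl)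
  | chg (xs rq fr tl) (h1 : good P a T xs rq fr.2.1 = true)
      (h2 : small P a T fr.2.1 fr.2.2.1 = true) (h3 : heavy rq fr.2.1 fr.2.2.1 = true) :
      Stp P a T (xs, rq, fr :: tl) (fr.2.1 :: xs, rq, tl)

theorem stp_cases (P : Cds) (a T : ℕ) (S : Stt) : Stp P a T S (stp P a T S) := by
  obtain ⟨xs, rq, sk⟩ := S
  cases sk with
  | nil => exact Stp.same _
  | cons fr tl =>
    obtain ⟨lv, s, k, cnt, led, pen⟩ := fr
    by_cases h0 : lv = 0
    · subst h0; rw [stp_0]; exact Stp.req xs rq _ tl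
    by_cases h1 : lv % 3 = 1
    · cases cnt with
      | zero => rw [stp_T0 h1]; exact Stp.push _ _ _ _ _ _ rfl rfl
      | succ cnt =>
        rw [stp_T1 h1]
        cases hg : good P a T xs rq s
        · exact Stp.same _
        · cases hs : (small P a T s k && heavy rq s k)
          · exact Stp.pop _ _ _ _
          · rw [Bool.and_eq_true] at hs
            exact Stp.chg xs rq (lv, s, k, cnt + 1, led, pen) tl hg hs.1 hs.2
    · cases pen with
      | some p => rw [stp_Lp h0 h1]; exact Stp.repl _ _ _ _ _ rfl
      | none =>
        rw [stp_Lv h0 h1]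
        cases full (zc P lv) T k (k + rp a) led
        · cases pick P (zc P lv) T cnt led with
          | none => exact Stp.repl _ _ _ _ _ rfl
          | some q => exact Stp.push _ _ _ _ _ _ rfl rfl
        · exact Stp.pop _ _ _ _

theorem binv (P : Cds) (a T : ℕ) : Binv T (st P a T) := by
  induction T with
  | zero => rw [st_zero]; constructor <;> simp
  | succ T ih =>
    rw [st_succ]
    have h := stp_cases P a T (st P a T)
    generalize st P a T = S at *
    generalize stp P a T S = S' at *
    obtain ⟨i1, i2, i3, i4, i5, i6⟩ := ih
    cases h with
    | same =>
      exact ⟨fun x hx => (i1 x hx).trans (Nat.lt_succ_self _),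
        fun x hx => (i2 x hx).trans (Nat.lt_succ_self _), i3,
        fun x hx => (i4 x hx).trans (Nat.le_succ _), i5, i6⟩
    | req xs rq fr tl =>
      refine ⟨fun x hx => (i1 x hx).trans (Nat.lt_succ_self _), ?_, ?_,
        fun x hx => (i4 x (List.mem_cons_of_mem _ hx)).trans (Nat.le_succ _),
        (List.pairwise_cons.1 i5).2, fun f hf => i6 f (List.mem_cons_of_mem _ hf)⟩
      · intro q hq
        rcases List.mem_cons.1 hq with rfl | hq
        · exact Nat.lt_succ_self _
        · exact (i2 q hq).trans (Nat.lt_succ_self _)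
      · refine List.pairwise_cons.2 ⟨fun q hq => ?_, i3⟩
        have := i2 q hq
        simp only [ne_eq]; omega
    | repl xs rq fr fr' tl h =>
      refine ⟨fun x hx => (i1 x hx).trans (Nat.lt_succ_self _),
        fun x hx => (i2 x hx).trans (Nat.lt_succ_self _), i3, ?_, ?_, ?_⟩
      · intro f hf
        rcases List.mem_cons.1 hf with rfl | hf
        · rw [h]; exact (i4 fr (by simp)).trans (Nat.le_succ _)
        · exact (i4 f (List.mem_cons_of_mem _ hf)).trans (Nat.le_succ _)
      · refine List.pairwise_cons.2 ⟨fun q hq => ?_, (List.pairwise_cons.1 i5).2⟩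
        rw [h]; exact (List.pairwise_cons.1 i5).1 q hq
      · intro f hf
        rcases List.mem_cons.1 hf with rfl | hf
        · rw [h]; exact i6 fr (by simp)
        · exact i6 f (List.mem_cons_of_mem _ hf)
    | push xs rq fr fr' nw tl h h' =>
      have j4 : ∀ f ∈ fr' :: tl, f.2.1 ≤ T := by
        intro f hf
        rcases List.mem_cons.1 hf with rfl | hf
        · rw [h]; exact (i4 fr (by simp))
        · exact (i4 f (List.mem_cons_of_mem _ hf))
      refine ⟨fun x hx => (i1 x hx).trans (Nat.lt_succ_self _),
        fun x hx => (i2 x hx).trans (Nat.lt_succ_self _), i3, ?_, ?_, ?_⟩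
      · intro f hf
        rcases List.mem_cons.1 hf with rfl | hf
        · rw [h']
        · exact (j4 f hf).trans (Nat.le_succ _)
      · refine List.pairwise_cons.2 ⟨fun q hq => ?_,
          List.pairwise_cons.2 ⟨fun q hq => ?_, (List.pairwise_cons.1 i5).2⟩⟩
        · rw [h']; exact Nat.lt_succ_of_le (j4 q hq)
        · rw [h]; exact (List.pairwise_cons.1 i5).1 q hq
      · intro f hf
        rcases List.mem_cons.1 hf with rfl | hf
        · rw [h']; intro hx; have := i1 _ hx; omega
        rcases List.mem_cons.1 hf with rfl | hf
        · rw [h]; exact i6 fr (by simp)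
        · exact i6 f (List.mem_cons_of_mem _ hf)
    | pop xs rq fr tl =>
      exact ⟨fun x hx => (i1 x hx).trans (Nat.lt_succ_self _),
        fun x hx => (i2 x hx).trans (Nat.lt_succ_self _), i3,
        fun x hx => (i4 x (List.mem_cons_of_mem _ hx)).trans (Nat.le_succ _),
        (List.pairwise_cons.1 i5).2, fun f hf => i6 f (List.mem_cons_of_mem _ hf)⟩
    | chg xs rq fr tl h1 h2 h3 =>
      refine ⟨?_,
        fun x hx => (i2 x hx).trans (Nat.lt_succ_self _), i3,
        fun x hx => (i4 x (List.mem_cons_of_mem _ hx)).trans (Nat.le_succ _),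
        (List.pairwise_cons.1 i5).2, fun f hf => ?_⟩
      · intro x hx
        rcases List.mem_cons.1 hx with rfl | hx
        · exact Nat.lt_succ_of_le (i4 fr (by simp))
        · exact (i1 x hx).trans (Nat.lt_succ_self _)
      · have h1 := (List.pairwise_cons.1 i5).1 f hf
        have h2 := i6 f (List.mem_cons_of_mem _ hf)
        simp only [List.mem_cons, not_or]
        exact ⟨by omega, h2⟩

/-- The approximation to the constructed set. -/
def eX (P : Cds) (a T i : ℕ) : Bool := inl (st P a T).1 i

theorem eX_mon (P : Cds) (a : ℕ) : Mon (eX P a) := by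
  intro s t i hst h
  induction t, hst using Nat.le_induction with
  | base => exact h
  | succ t _ ih =>
    unfold eX at *
    rw [inl_iff] at *
    rw [st_succ]
    have h := stp_cases P a t (st P a t)
    generalize st P a t = S at *
    generalize stp P a t S = S' at *
    cases h with
    | chg => exact List.mem_cons_of_mem _ ih
    | _ => exact ih

/-- Total request weight. -/
noncomputable def rW (P : Cds) (a T : ℕ) : ℝ := lw ((st P a T).2.1.map fun q => q.1)

theorem rW_nonneg (P : Cds) (a T : ℕ) : 0 ≤ rW P a T := lw_nonneg _

/-- The request list grows by at most one. -/
theorem rq_succ (P : Cds) (a T : ℕ) : (st P a (T + 1)).2.1 = (st P a T).2.1 ∨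
    ∃ k, (st P a (T + 1)).2.1 = (k, T) :: (st P a T).2.1 := by
  rw [st_succ]
  have h := stp_cases P a T (st P a T)
  generalize st P a T = S at *
  generalize stp P a T S = S' at *
  cases h with
  | req xs rq fr tl => right; exact ⟨_, rfl⟩
  | _ => left; rfl

theorem rW_mono (P : Cds) (a : ℕ) {s t : ℕ} (h : s ≤ t) : rW P a s ≤ rW P a t := by
  refine monotone_nat_of_le_succ (f := rW P a) (fun T => ?_) h
  unfold rW
  rcases rq_succ P a T with h | ⟨k, h⟩ <;> rw [h]
  rw [List.map_cons, lw_cons]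
  have : (0 : ℝ) < (1 / 2) ^ k := by positivity
  linarith

theorem rqs_weight (P : Cds) (a s t : ℕ) (h : s + 1 ≤ t) :
    lw ((rqs (st P a t).2.1 s).map fun q => q.1) = rW P a t - rW P a (s + 1) := by
  induction t, h using Nat.le_induction with
  | base =>
    have : rqs (st P a (s + 1)).2.1 s = [] := by
      unfold rqs
      rw [List.filter_eq_nil_iff]
      intro q hq
      have := (binv P a (s + 1)).rlt q hq
      simp; omega
    rw [this]; simp
  | succ t hst ih =>
    rcases rq_succ P a t with h | ⟨k, h⟩
    · unfold rW at *; rw [h, ih]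
    · unfold rW at *
      rw [h]
      have : rqs ((k, t) :: (st P a t).2.1) s = (k, t) :: rqs (st P a t).2.1 s := by
        unfold rqs; rw [List.filter_cons_of_pos]; simp; omega
      rw [this, List.map_cons, lw_cons, ih, List.map_cons, lw_cons]; ring

/-- Where a request comes from. -/
theorem rq_from (P : Cds) (a t : ℕ) (q : ℕ × ℕ) (hq : q ∈ (st P a t).2.1) :
    q.2 < t ∧ (st P a (q.2 + 1)).2.1 = q :: (st P a q.2).2.1 := by
  induction t with
  | zero => simp [st_zero] at hq
  | succ t ih =>
    rcases rq_succ P a t with h | ⟨k, h⟩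
    · rw [h] at hq
      exact ⟨(ih hq).1.trans (Nat.lt_succ_self _), (ih hq).2⟩
    · rw [h] at hq
      rcases List.mem_cons.1 hq with rfl | hq
      · exact ⟨Nat.lt_succ_self _, h⟩
      · exact ⟨(ih hq).1.trans (Nat.lt_succ_self _), (ih hq).2⟩

/-! ### Coverage measures -/

theorem covS_mem {P : Cds} {c : Nat.Partrec.Code} {T s : ℕ} {ρ : Str} :
    ρ ∈ covS P c T s ↔ ∃ m, s < m ∧ m ≤ T ∧ us P.U T ρ = Option.some (restrSeq (en c T) m) := by
  unfold covS
  rw [List.mem_filterMap]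
  constructor
  · rintro ⟨n, -, h⟩
    obtain ⟨ρ', h1, h⟩ := Option.bind_eq_some_iff.1 h
    obtain ⟨σ, h2, h⟩ := Option.bind_eq_some_iff.1 h
    by_cases hc : (decide (s < σ.length) && decide (σ.length ≤ T) &&
      decide (σ = restrSeq (en c T) σ.length)) = true
    · rw [hc] at h
      simp only [cond_true, Option.some.injEq] at h
      subst h
      simp only [Bool.and_eq_true, decide_eq_true_eq] at hc
      exact ⟨σ.length, hc.1.1, hc.1.2, by rw [h2]; exact congrArg _ hc.2⟩
    · rw [Bool.not_eq_true] at hc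
      rw [hc] at h; simp at h
  · rintro ⟨m, hm, hm', h⟩
    refine ⟨Encodable.encode ρ, List.mem_range.2 (us_bound h), ?_⟩
    rw [dc_iff.2 rfl, Option.bind_some, h, Option.bind_some]
    simp [restrSeq_length, hm, hm']

theorem covS_nodup (P : Cds) (c : Nat.Partrec.Code) (T s : ℕ) : (covS P c T s).Nodup := by
  unfold covS
  refine List.Nodup.filterMap ?_ List.nodup_range
  have key : ∀ n ρ, ρ ∈ ((dc n).bind fun ρ => (us P.U T ρ).bind fun σ =>
    cond (decide (s < σ.length) && decide (σ.length ≤ T) &&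
      decide (σ = restrSeq (en c T) σ.length))
      (Option.some ρ) Option.none) → n = Encodable.encode ρ := by
    intro n ρ h
    obtain ⟨ρ', h1, h⟩ := Option.bind_eq_some_iff.1 h
    obtain ⟨σ, h2, h⟩ := Option.bind_eq_some_iff.1 h
    cases hc : (decide (s < σ.length) && decide (σ.length ≤ T) &&
      decide (σ = restrSeq (en c T) σ.length))
    · rw [hc] at h; simp at h
    · rw [hc] at h; simp at h; subst h; exact dc_iff.1 h1
  intro n n' ρ h1 h2
  rw [key _ _ h1, key _ _ h2]

/-- Strings describing current initial segments beyond `s`. -/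
def cvS (P : Cds) (e : ℕ → ℕ → Bool) (T s : ℕ) : Set Str :=
  {ρ | ∃ m, s < m ∧ m ≤ T ∧ us P.U T ρ = Option.some (restrSeq (e T) m)}


theorem cov_mu {U : Str →. Str} {P : Cds} (hpf : PFD U) (huc : UC U P.U)
    (c : Nat.Partrec.Code) (T s : ℕ) :
    lw ((covS P c T s).map List.length) = mu U (cvS P (en c) T s) := by
  rw [mu_list hpf _ (covS_nodup P c T s)]
  · congr 1; ext ρ; exact covS_mem
  · intro ρ hρ
    obtain ⟨m, -, -, h⟩ := covS_mem.1 hρ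
    exact huc.dom h

theorem small_iff {U : Str →. Str} {P : Cds} (hpf : PFD U) (huc : UC U P.U)
    (a T s k : ℕ) : small P a T s k = true ↔
    mu U (cvS P (en P.A) T s) + mu U (cvS P (en P.D) T s) ≤ (1 / 2 : ℝ) ^ (k + 2 * gp a) := by
  unfold small
  rw [leW_iff, lw_append, cov_mu hpf huc, cov_mu hpf huc]
  simp

theorem good_mu_aux {U : Str →. Str} {P : Cds} (hpf : PFD U) (huc : UC U P.U)
    (g T : ℕ) (x : ℕ → Bool) (l : List (ℕ × ℕ))
    (hn : l.Pairwise fun q q' => q.2 ≠ q'.2)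
    (h : ∀ q ∈ l, ∃ ρ : Str, ρ.length ≤ q.1 + g ∧ us P.U T ρ = Option.some (restrSeq x q.2)) :
    lw (l.map fun q => q.1) * (1 / 2) ^ g ≤
      mu U {ρ | ∃ q ∈ l, us P.U T ρ = Option.some (restrSeq x q.2)} := by
  induction l with
  | nil => simpa using mu_nonneg _
  | cons q l ih =>
    have ih := ih (List.pairwise_cons.1 hn).2 fun q' hq' => h q' (List.mem_cons_of_mem _ hq')
    obtain ⟨ρ, h1, h2⟩ := h q (by simp)
    have h3 := mu_add_le hpf (P := {ρ})
      (Q := {ρ | ∃ q ∈ l, us P.U T ρ = Option.some (restrSeq x q.2)})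
      (R := {ρ | ∃ q' ∈ q :: l, us P.U T ρ = Option.some (restrSeq x q'.2)})
      (by rintro _ rfl; exact ⟨q, by simp, h2⟩)
      (by rintro τ ⟨q', hq', h⟩; exact ⟨q', List.mem_cons_of_mem _ hq', h⟩)
      (by
        rintro _ rfl ⟨q', hq', h⟩
        have := restrSeq_inj (us_uniq h2 h)
        exact (List.pairwise_cons.1 hn).1 q' hq' this)
    rw [mu_single (huc.dom h2)] at h3
    rw [List.map_cons, lw_cons, add_mul, ← pow_add]
    have : (1 / 2 : ℝ) ^ (q.1 + g) ≤ (1 / 2) ^ ρ.length :=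
      pow_le_pow_of_le_one (by norm_num) (by norm_num) h1
    linarith

theorem good_iff {U : Str →. Str} {P : Cds} (hpf : PFD U) (huc : UC U P.U)
    (a T s : ℕ) (xs : List ℕ) (rq : List (ℕ × ℕ)) :
    good P a T xs rq s = true ↔ ∀ q ∈ rqs rq s, ∃ ρ : Str, ρ.length ≤ q.1 + gp a ∧
      us P.U T ρ = Option.some (restrSeq (inl xs) q.2) := by
  unfold good
  rw [List.all_eq_true]
  have key : ∀ q, goodR P a T xs q = true ↔ ∃ ρ : Str, ρ.length ≤ q.1 + gp a ∧
      us P.U T ρ = Option.some (restrSeq (inl xs) q.2) := by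
    intro q
    unfold goodR
    rw [List.any_eq_true]
    constructor
    · rintro ⟨n, -, h⟩
      cases hd : dc n with
      | none => rw [hd] at h; simp at h
      | some ρ =>
        rw [hd] at h
        simp only [Option.elim_some, Bool.and_eq_true, decide_eq_true_eq] at h
        exact ⟨ρ, h⟩
    · rintro ⟨ρ, h1, h2⟩
      refine ⟨Encodable.encode ρ, List.mem_range.2 (us_bound h2), ?_⟩
      rw [dc_iff.2 rfl]
      simp [h1, h2]
  simp only [Bool.or_eq_true, decide_eq_true_eq, key, rqs, List.mem_filter]
  constructor
  · rintro h q ⟨hq, hs⟩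
    exact (h q hq).resolve_left (by omega)
  · intro h q hq
    by_cases hs : q.2 ≤ s
    · exact Or.inl hs
    · exact Or.inr (h q ⟨hq, by omega⟩)

/-- Strings describing requested initial segments at a good stage. -/
theorem good_mu {U : Str →. Str} {P : Cds} (hpf : PFD U) (huc : UC U P.U)
    (a T s : ℕ) (xs : List ℕ) (rq : List (ℕ × ℕ))
    (hn : rq.Pairwise fun q q' => q.2 ≠ q'.2) (h : good P a T xs rq s = true) :
    lw ((rqs rq s).map fun q => q.1) * (1 / 2) ^ gp a ≤
      mu U {ρ | ∃ q ∈ rq, s < q.2 ∧ us P.U T ρ = Option.some (restrSeq (inl xs) q.2)} := by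
  refine (good_mu_aux hpf huc (gp a) T (inl xs) (rqs rq s) (hn.sublist List.filter_sublist)
    ((good_iff hpf huc a T s xs rq).1 h)).trans (mu_mono hpf ?_)
  rintro ρ ⟨q, hq, h⟩
  have := List.mem_filter.1 hq
  exact ⟨q, this.1, by simpa using this.2, h⟩


/-! ### Accounting -/

/-- Strings seen to describe initial segments with length in an interval (and, when `v` is false,
which have changed since). -/
def vS (P : Cds) (v : Bool) (e : ℕ → ℕ → Bool) (T lo hi : ℕ) : Set Str :=
  {ρ | ∃ r < T, ∃ m, lo ≤ m ∧ m < hi ∧ us P.U r ρ = Option.some (restrSeq (e r) m) ∧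
    (v = false → restrSeq (e T) m ≠ restrSeq (e r) m)}

/-- Measure of the above. -/
noncomputable def acc (U : Str →. Str) (P : Cds) (v : Bool) (e : ℕ → ℕ → Bool) (T lo hi : ℕ) : ℝ :=
  mu U (vS P v e T lo hi)


theorem vS_mono {U : Str →. Str} {P : Cds} (hpf : PFD U) {e : ℕ → ℕ → Bool} (he : Mon e)
    {v v' : Bool} {T T' lo lo' hi hi' : ℕ} (hv : v' = false → v = false) (hT : T ≤ T')
    (hl : lo' ≤ lo) (hh : hi ≤ hi') : vS P v e T lo hi ⊆ vS P v' e T' lo' hi' := by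
  rintro ρ ⟨r, hr, m, h1, h2, h3, h4⟩
  refine ⟨r, by omega, m, by omega, by omega, h3, fun hf hc => ?_⟩
  exact h4 (hv hf) (he.mid' hr.le hT hc.symm).symm

theorem acc_mono {U : Str →. Str} {P : Cds} (hpf : PFD U) {e : ℕ → ℕ → Bool} (he : Mon e)
    {v v' : Bool} {T T' lo lo' hi hi' : ℕ} (hv : v' = false → v = false) (hT : T ≤ T')
    (hl : lo' ≤ lo) (hh : hi ≤ hi') : acc U P v e T lo hi ≤ acc U P v' e T' lo' hi' :=
  mu_mono hpf (vS_mono hpf he hv hT hl hh)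

theorem acc_add {U : Str →. Str} {P : Cds} (hpf : PFD U) {e : ℕ → ℕ → Bool} (he : Mon e)
    {v : Bool} {T lo mid hi : ℕ} (h1 : lo ≤ mid) (h2 : mid ≤ hi) :
    acc U P v e T lo mid + acc U P v e T mid hi ≤ acc U P v e T lo hi := by
  refine mu_add_le hpf (vS_mono hpf he id le_rfl le_rfl h2) (vS_mono hpf he id le_rfl h1 le_rfl) ?_
  rintro ρ ⟨r, hr, m, h1, h2, h3, h4⟩ ⟨r', hr', m', h1', h2', h3', h4'⟩
  have := restrSeq_inj (us_uniq h3 h3')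
  omega

theorem acc_stale {U : Str →. Str} {P : Cds} (hpf : PFD U) {e : ℕ → ℕ → Bool} (he : Mon e)
    {v : Bool} {b T lo hi hi' m : ℕ} (hb : b ≤ T) (hm : m ≤ lo) (hh : hi ≤ hi')
    (hs : restrSeq (e T) m ≠ restrSeq (e b) m) :
    acc U P v e b lo hi ≤ acc U P false e T lo hi' := by
  refine mu_mono hpf ?_
  rintro ρ ⟨r, hr, m', h1, h2, h3, h4⟩
  refine ⟨r, by omega, m', h1, by omega, h3, fun _ hc => hs ?_⟩
  exact (he.mid hr.le hb (restrSeq_le (by omega) hc.symm)).symm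

theorem acc_le_one {U : Str →. Str} {P : Cds} (hpf : PFD U) {e : ℕ → ℕ → Bool}
    (v : Bool) (T lo hi : ℕ) : acc U P v e T lo hi ≤ 1 := mu_le_one hpf _

/-- Gain from coverage. -/
theorem acc_cov {U : Str →. Str} {P : Cds} (hpf : PFD U) {e : ℕ → ℕ → Bool} (he : Mon e)
    {t T s s' : ℕ} (ht : t ≤ T) (hs : s ≤ s') :
    acc U P false e t s' t + mu U (cvS P e T s) ≤ acc U P true e (T + 1) s (T + 1) := by
  refine mu_add_le hpf (vS_mono hpf he (by simp) (by omega) hs (by omega)) ?_ ?_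
  · rintro ρ ⟨m, hm, hm', h⟩
    exact ⟨T, by omega, m, by omega, by omega, h, by simp⟩
  · rintro ρ ⟨r, hr, m, h1, h2, h3, h4⟩ ⟨m', hm', -, h'⟩
    have h5 := us_uniq h3 h'
    have := restrSeq_inj h5
    subst this
    exact h4 rfl (he.mid' hr.le ht h5).symm

/-! ### The main claim -/

/-- The limit of an approximation. -/
noncomputable def lim (e : ℕ → ℕ → Bool) (i : ℕ) : Bool := decide (∃ t, e t i = true)

theorem Mon.stab {e : ℕ → ℕ → Bool} (he : Mon e) (m : ℕ) :
    ∃ T, ∀ t, T ≤ t → restrSeq (e t) m = restrSeq (lim e) m := by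
  induction m with
  | zero => exact ⟨0, fun t _ => rfl⟩
  | succ m ih =>
    obtain ⟨T, hT⟩ := ih
    by_cases h : ∃ t, e t m = true
    · obtain ⟨t', ht'⟩ := h
      refine ⟨max T t', fun t ht => ?_⟩
      have h1 := hT t ((le_max_left _ _).trans ht)
      rw [restrSeq_eq] at *
      intro i hi
      rcases Nat.lt_succ_iff_lt_or_eq.1 hi with hi | rfl
      · exact h1 i hi
      · have h2 := he t' t i ((le_max_right _ _).trans ht) ht'
        rw [h2]; unfold lim
        exact (decide_eq_true ⟨t', ht'⟩).symm
    · refine ⟨T, fun t ht => ?_⟩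
      have h1 := hT t ht
      rw [restrSeq_eq] at *
      intro i hi
      rcases Nat.lt_succ_iff_lt_or_eq.1 hi with hi | rfl
      · exact h1 i hi
      · have h2 : lim e i = false := decide_eq_false h
        rw [h2]
        by_contra hc
        exact h ⟨t, by simpa using hc⟩

theorem en_mon (c : Nat.Partrec.Code) : Mon (en c) := fun _ _ _ h hs => en_mono h hs

/-- The standing hypotheses. -/
structure Hyp (U : Str →. Str) (P : Cds) (a : ℕ) : Prop where
  hU : OptimalPF U
  huc : UC U P.U
  nA : ¬ ∃ c : ℕ, ∀ n, KC U (restrSeq (lim (en P.A)) n) ≤ KC U (zeroStr n) + c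
  nD : ¬ ∃ c : ℕ, ∀ n, KC U (restrSeq (lim (en P.D)) n) ≤ KC U (zeroStr n) + c
  hcov : ∀ t, ∀ q ∈ (st P a t).2.1, rW P a (q.2 + 1) ≤ 1 →
    ∃ ρ : Str, ρ.length ≤ q.1 + gp a ∧ restrSeq (lim (eX P a)) q.2 ∈ U ρ

theorem Hyp.pf {U : Str →. Str} {P : Cds} {a : ℕ} (H : Hyp U P a) : PFD U := H.hU.1.2

/-- Overhead factor. -/
noncomputable def be (a : ℕ) : ℝ := 1 + (1 / 2) ^ rp a

theorem be_one (a : ℕ) : 1 ≤ be a := by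
  unfold be; have : (0 : ℝ) < (1 / 2) ^ rp a := by positivity
  linarith

/-- Gain factor. -/
noncomputable def kap (a j : ℕ) : ℝ := ((j + 2) / 3 : ℕ) * (1 / 2) ^ (2 * gp a)

theorem kap_nonneg (a j : ℕ) : 0 ≤ kap a j := by unfold kap; positivity

theorem kap_T (a j : ℕ) (h : (j + 1) % 3 = 1) :
    kap a (j + 1) = kap a j + (1 / 2) ^ (2 * gp a) := by
  unfold kap
  have : (j + 1 + 2) / 3 = (j + 2) / 3 + 1 := by omega
  rw [this]; push_cast; ring

theorem kap_L (a j : ℕ) (h : (j + 1) % 3 ≠ 1) : kap a (j + 1) = kap a j := by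
  unfold kap
  have : (j + 1 + 2) / 3 = (j + 2) / 3 := by omega
  rw [this]

/-- Total account. -/
noncomputable def GG (U : Str →. Str) (P : Cds) (a j T lo hi : ℕ) : ℝ :=
  acc U P (decide (j % 3 ≠ 0)) (en P.A) T lo hi + acc U P (decide (j % 3 = 1)) (en P.D) T lo hi +
    acc U P false (eX P a) T lo hi

theorem GG_mono {U : Str →. Str} {P : Cds} (hpf : PFD U) {a j T T' lo lo' hi hi' : ℕ} (hT : T ≤ T')
    (hl : lo' ≤ lo) (hh : hi ≤ hi') : GG U P a j T lo hi ≤ GG U P a j T' lo' hi' := by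
  unfold GG
  have h1 := acc_mono (P := P) hpf (en_mon P.A) (v := decide (j % 3 ≠ 0)) id hT hl hh
  have h2 := acc_mono (P := P) hpf (en_mon P.D) (v := decide (j % 3 = 1)) id hT hl hh
  have h3 := acc_mono (P := P) hpf (eX_mon P a) (v := false) id hT hl hh
  linarith

theorem GG_add {U : Str →. Str} {P : Cds} (hpf : PFD U) {a j T lo mid hi : ℕ} (h1 : lo ≤ mid)
    (h2 : mid ≤ hi) : GG U P a j T lo mid + GG U P a j T mid hi ≤ GG U P a j T lo hi := by
  unfold GG
  have h3 := acc_add (P := P) hpf (en_mon P.A) (v := decide (j % 3 ≠ 0)) (T := T) h1 h2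
  have h4 := acc_add (P := P) hpf (en_mon P.D) (v := decide (j % 3 = 1)) (T := T) h1 h2
  have h5 := acc_add (P := P) hpf (eX_mon P a) (v := false) (T := T) h1 h2
  linarith

theorem GG_stale {U : Str →. Str} {P : Cds} (hpf : PFD U) {a j b T lo hi hi' m : ℕ}
    (hj : (j + 1) % 3 ≠ 1) (hb : b ≤ T) (hm : m ≤ lo) (hh : hi ≤ hi')
    (hs : restrSeq (en (zc P (j + 1)) T) m ≠ restrSeq (en (zc P (j + 1)) b) m) :
    GG U P a j b lo hi ≤ GG U P a (j + 1) T lo hi' := by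
  unfold GG
  have h3 := acc_mono (P := P) hpf (eX_mon P a) (v := false) id hb (le_refl lo) hh
  by_cases h2 : (j + 1) % 3 = 2
  · have e1 : decide ((j + 1) % 3 ≠ 0) = true := by rw [decide_eq_true_iff]; omega
    have e2 : decide ((j + 1) % 3 = 1) = false := by rw [decide_eq_false_iff_not]; omega
    have e3 : zc P (j + 1) = P.D := by unfold zc; simp [h2]
    rw [e3] at hs
    rw [e1, e2]
    have h1 := acc_mono (P := P) hpf (en_mon P.A) (v := decide (j % 3 ≠ 0)) (v' := true) (by simp)
      hb (le_refl lo) hh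
    have h4 := acc_stale (P := P) hpf (en_mon P.D) (v := decide (j % 3 = 1)) hb hm hh hs
    linarith
  · have e1 : decide ((j + 1) % 3 ≠ 0) = false := by rw [decide_eq_false_iff_not]; omega
    have e2 : decide ((j + 1) % 3 = 1) = false := by rw [decide_eq_false_iff_not]; omega
    have e4 : decide (j % 3 = 1) = false := by rw [decide_eq_false_iff_not]; omega
    have e3 : zc P (j + 1) = P.A := by unfold zc; simp [h2]
    rw [e3] at hs
    rw [e1, e2, e4]
    have h1 := acc_mono (P := P) hpf (en_mon P.D) (v := false) id hb (le_refl lo) hh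
    have h4 := acc_stale (P := P) hpf (en_mon P.A) (v := decide (j % 3 ≠ 0)) hb hm hh hs
    linarith

/-- A successful return of a frame. -/
def Ret (U : Str →. Str) (P : Cds) (a j s k : ℕ) (rest : List Frame) : Prop :=
  ∃ t, s < t ∧ (st P a t).2.2 = rest ∧
    (∀ u, s ≤ u → u < t → rest.length < (st P a u).2.2.length) ∧
    (1 / 2) ^ k ≤ rW P a t - rW P a s ∧ rW P a t - rW P a s ≤ be a ^ j * (1 / 2) ^ k ∧
    kap a j * (1 / 2) ^ k ≤ GG U P a j t s t

/-- The claim for level `j`. -/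
def Clm (U : Str →. Str) (P : Cds) (a j : ℕ) : Prop :=
  ∀ s k rest, (st P a s).2.2 = (j, s, k, 0, [], Option.none) :: rest →
    rW P a s + be a ^ j * (1 / 2) ^ k ≤ 1 → Ret U P a j s k rest

theorem st_eta {P : Cds} {a T : ℕ} {l : List Frame} (h : (st P a T).2.2 = l) :
    st P a T = ((st P a T).1, (st P a T).2.1, l) := Prod.ext rfl (Prod.ext rfl h)

theorem st_next {P : Cds} {a T : ℕ} {l : List Frame} (h : (st P a T).2.2 = l) :
    st P a (T + 1) = stp P a T ((st P a T).1, (st P a T).2.1, l) := by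
  rw [st_succ]; exact congrArg _ (st_eta h)

theorem GG_nonneg (U : Str →. Str) (P : Cds) (a j T lo hi : ℕ) : 0 ≤ GG U P a j T lo hi := by
  unfold GG acc
  have := mu_nonneg (U := U)
  exact add_nonneg (add_nonneg (this _) (this _)) (this _)

theorem clm_zero (U : Str →. Str) (P : Cds) (a : ℕ) : Clm U P a 0 := by
  intro s k rest h hw
  have h1 := st_next h
  rw [stp_0] at h1
  have h2 : rW P a (s + 1) = (1 / 2) ^ k + rW P a s := by
    unfold rW; rw [h1]; simp
  refine ⟨s + 1, by omega, by rw [h1], ?_, by rw [h2]; simp, by rw [h2]; simp, ?_⟩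
  · intro u hu1 hu2
    have : u = s := by omega
    subst this; rw [h]; simp
  · have : kap a 0 = 0 := by simp [kap]
    rw [this]; simpa using GG_nonneg U P a 0 _ _ _

section
variable {U : Str →. Str} {P : Cds} {a : ℕ}

/-- The waiting phase of a testing frame ends. -/
theorem wait_ends (H : Hyp U P a) {j s k t : ℕ} {rest : List Frame} (hj : j % 3 = 1)
    (ht : (st P a t).2.2 = (j, s, k, 1, [], Option.none) :: rest) (hw : rW P a t ≤ 1) :
    ∃ T, t ≤ T ∧ st P a T = st P a t ∧ (∀ u, t ≤ u → u ≤ T → st P a u = st P a t) ∧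
      good P a T (st P a t).1 (st P a t).2.1 s = true := by
  by_contra hc
  have hconst : ∀ u, t ≤ u → st P a u = st P a t := by
    intro u hu
    induction u using Nat.strong_induction_on with
    | _ u ih =>
      rcases hu.eq_or_lt with rfl | hu
      · rfl
      obtain ⟨u, rfl⟩ : ∃ v, u = v + 1 := ⟨u - 1, by omega⟩
      have ihu := ih u (by omega) (by omega)
      have hg : ¬ good P a u (st P a t).1 (st P a t).2.1 s = true := fun hg =>
        hc ⟨u, by omega, ihu, fun v h1 h2 => ih v (by omega) h1, hg⟩
      rw [st_succ, ihu, st_eta ht, stp_T1 (cnt := 0) hj]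
      rw [Bool.not_eq_true] at hg
      rw [hg]; rfl
  have hlim : lim (eX P a) = inl (st P a t).1 := by
    funext i
    unfold lim
    cases hi : inl (st P a t).1 i
    · refine decide_eq_false ?_
      rintro ⟨u, hu⟩
      have h1 := eX_mon P a u (max u t) i (le_max_left _ _) hu
      unfold eX at h1
      rw [hconst _ (le_max_right _ _), hi] at h1
      exact absurd h1 (by simp)
    · exact decide_eq_true ⟨t, hi⟩
  have hq : ∀ q : ℕ × ℕ, ∃ T0, q ∈ (st P a t).2.1 → ∀ T, T0 ≤ T →
      ∃ ρ : Str, ρ.length ≤ q.1 + gp a ∧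
        us P.U T ρ = Option.some (restrSeq (inl (st P a t).1) q.2) := by
    intro q
    by_cases hq : q ∈ (st P a t).2.1
    · have h1 := rq_from P a t q hq
      obtain ⟨ρ, h2, h3⟩ := H.hcov t q hq ((rW_mono P a (by omega)).trans hw)
      rw [hlim] at h3
      obtain ⟨T0, h4⟩ := (H.huc _ _).1 h3
      exact ⟨T0, fun _ T hT => ⟨ρ, h2, us_mono hT h4⟩⟩
    · exact ⟨0, fun h => absurd h hq⟩
  choose F hF using hq
  set T := max t (((st P a t).2.1.map F).sum) with hT
  refine hc ⟨T, le_max_left _ _, hconst _ (le_max_left _ _), fun u hu _ => hconst u hu, ?_⟩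
  rw [good_iff H.pf H.huc]
  intro q hq
  have hq := (List.mem_filter.1 hq).1
  exact hF q hq T ((List.le_sum_of_mem (List.mem_map_of_mem hq)).trans (le_max_right _ _))

theorem clm_T (H : Hyp U P a) {j : ℕ} (hj : (j + 1) % 3 = 1) (ih : Clm U P a j) :
    Clm U P a (j + 1) := by
  intro s k rest h hw
  have hpf := H.pf
  have h1 := st_next h
  rw [stp_T0 hj, Nat.add_sub_cancel] at h1
  have hr1 : rW P a (s + 1) = rW P a s := by unfold rW; rw [h1]
  have hbe : be a ^ j ≤ be a ^ (j + 1) := pow_le_pow_right₀ (be_one a) (Nat.le_succ _)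
  have hbk : be a ^ j * (1 / 2) ^ k ≤ be a ^ (j + 1) * (1 / 2) ^ k :=
    mul_le_mul_of_nonneg_right hbe (by positivity)
  obtain ⟨t, ht1, ht2, ht3, ht4, ht5, ht6⟩ := ih (s + 1) k _ (by rw [h1]) (by rw [hr1]; linarith)
  rw [hr1] at ht4 ht5
  obtain ⟨T, hT1, hT2, hT3, hT4⟩ := wait_ends H hj ht2 (by linarith)
  have hrT : rW P a T = rW P a t := by unfold rW; rw [hT2]
  have h2 := st_next (hT2 ▸ ht2 : (st P a T).2.2 = _)
  rw [stp_T1 (cnt := 0) hj, hT2, hT4, cond_true] at h2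
  have hrT1 : rW P a (T + 1) = rW P a t := by unfold rW; rw [h2]
  have hhv : heavy (st P a t).2.1 s k = true := by
    unfold heavy
    rw [leW_iff, ← hT2, rqs_weight P a s T (by omega), hrT, hr1]
    simpa using ht4
  refine ⟨T + 1, by omega, by rw [h2], ?_, by rw [hrT1]; linarith, by rw [hrT1]; linarith, ?_⟩
  · intro u hu1 hu2
    rcases hu1.eq_or_lt with rfl | hu1
    · rw [h]; simp
    by_cases hut : u < t
    · have := ht3 u hu1 hut
      simp at this; omega
    · rw [hT3 u (by omega) (by omega), ht2]; simp
  rw [kap_T a j hj, add_mul, ← pow_add]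
  have e1 : decide ((j + 1) % 3 ≠ 0) = true := by rw [decide_eq_true_iff]; omega
  have e2 : decide ((j + 1) % 3 = 1) = true := by rw [decide_eq_true_iff]; omega
  have e3 : decide (j % 3 ≠ 0) = false := by rw [decide_eq_false_iff_not]; omega
  have e4 : decide (j % 3 = 1) = false := by rw [decide_eq_false_iff_not]; omega
  unfold GG at ht6 ⊢
  rw [e3, e4] at ht6
  rw [e1, e2]
  have a1 := acc_cov (P := P) hpf (en_mon P.A) hT1 (Nat.le_succ s)
  have a2 := acc_cov (P := P) hpf (en_mon P.D) hT1 (Nat.le_succ s)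
  by_cases hs : small P a T s k = true
  · rw [hs, hhv, Bool.and_self, cond_true] at h2
    have b1 := mu_nonneg (U := U) (cvS P (en P.A) T s)
    have b2 := mu_nonneg (U := U) (cvS P (en P.D) T s)
    have bi := binv P a t
    have hsx : s ∉ (st P a t).1 := bi.snx (j + 1, s, k, 1, [], Option.none) (by rw [ht2]; simp)
    have g1 := good_mu hpf H.huc a T s (st P a t).1 (st P a t).2.1 bi.rnd hT4
    rw [← hT2, rqs_weight P a s T (by omega), hrT, hr1, hT2] at g1
    have g2 : acc U P false (eX P a) t (s + 1) t + mu U {ρ | ∃ q ∈ (st P a t).2.1, s < q.2 ∧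
        us P.U T ρ = Option.some (restrSeq (inl (st P a t).1) q.2)} ≤
        acc U P false (eX P a) (T + 1) s (T + 1) := by
      refine mu_add_le hpf (vS_mono hpf (eX_mon P a) id (by omega) (by omega) (by omega)) ?_ ?_
      · rintro ρ ⟨q, hq, hq1, hq2⟩
        have := bi.rlt q hq
        refine ⟨T, by omega, q.2, by omega, by omega, by unfold eX; rw [hT2]; exact hq2, fun _ he => ?_⟩
        have he := restrSeq_eq.1 he s hq1
        unfold eX at he
        rw [h2, hT2] at he
        have t1 : inl (s :: (st P a t).1) s = true := inl_iff.2 (by simp)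
        have t2 : ¬ inl (st P a t).1 s = true := fun h => hsx (inl_iff.1 h)
        exact t2 (he ▸ t1)
      · rintro ρ ⟨r, hr, m, m1, m2, m3, m4⟩ ⟨q, hq, hq1, hq2⟩
        have h5 := us_uniq m3 hq2
        have := restrSeq_inj h5
        subst this
        refine m4 rfl ?_
        exact h5.symm
    have g3 : (1 / 2 : ℝ) ^ (2 * gp a + k) ≤ (rW P a t - rW P a s) * (1 / 2) ^ gp a := by
      have q1 : (1 / 2 : ℝ) ^ (2 * gp a + k) ≤ (1 / 2) ^ (k + gp a) :=
        pow_le_pow_of_le_one (by norm_num) (by norm_num) (by omega)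
      rw [pow_add _ k] at q1
      exact q1.trans (mul_le_mul_of_nonneg_right ht4 (by positivity))
    linarith
  · have hs' := lt_of_not_ge fun h => hs ((small_iff hpf H.huc a T s k).2 h)
    rw [add_comm k] at hs'
    have a3 := acc_mono (P := P) hpf (eX_mon P a) (v := false) (v' := false) id (T := t) (T' := T + 1)
      (lo := s + 1) (lo' := s) (hi := t) (hi' := T + 1) (by omega) (by omega) (by omega)
    linarith
end

/-! ### Layers -/

/-- The requests made by the waiting layer frame. -/
def lf (P : Cds) (a : ℕ) (c : Nat.Partrec.Code) (s h kr u : ℕ) : Option (ℕ × Str) :=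
  cond (decide (s ≤ u) && decide ((st P a u).2.2.length = h))
    ((st P a u).2.2.head?.bind fun fr => fr.2.2.2.2.2.map fun p =>
      (p.1.length + kr, restrSeq (en c u) p.2.1)) Option.none

theorem lf_prim (P : Cds) (a : ℕ) (c : Nat.Partrec.Code) (s h kr : ℕ) :
    Primrec fun u => lf P a c s h kr u := by
  unfold lf
  fun_prop

theorem lw_nom (kr : ℕ) (led : List Ent) :
    lw (nom kr led) = lw ((led.map fun e => e.1).map List.length) * (1 / 2) ^ kr := by
  rw [← lw_add]; unfold nom; simp [Function.comp_def]

theorem lw_nom_split (c : Nat.Partrec.Code) (T kr : ℕ) (led : List Ent) :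
    lw (nom kr led) = lw (nom kr (led.filter fun e => stale c T e)) +
      lw (nom kr (led.filter fun e => !stale c T e)) := by
  induction led with
  | nil => simp [nom]
  | cons e led ih =>
    unfold nom at *
    cases h : stale c T e <;> simp [h] at ih ⊢ <;> linarith

theorem stale_iff {c : Nat.Partrec.Code} {T : ℕ} {e : Ent} : stale c T e = true ↔
    restrSeq (en c T) e.2.1 ≠ restrSeq (en c e.2.2.2) e.2.1 := by
  unfold stale; simp

/-- Invariant at a visit of a layer frame of level `j + 1`. -/
structure LS (U : Str →. Str) (P : Cds) (a j s k : ℕ) (rest : List Frame) (T cnt : ℕ)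
    (led : List Ent) : Prop where
  sk : (st P a T).2.2 = (j + 1, s, k, cnt, led, Option.none) :: rest
  le : s ≤ T
  ht : ∀ u, s ≤ u → u < T → rest.length < (st P a u).2.2.length
  ent : ∀ e ∈ led, s ≤ e.2.2.1 ∧ e.2.1 ≤ e.2.2.1 ∧ e.2.2.1 ≤ e.2.2.2 ∧ e.2.2.2 < T ∧
    us P.U e.2.2.2 e.1 = Option.some (zeroStr e.2.1) ∧
    kap a j * (1 / 2) ^ (e.1.length + (k + rp a)) ≤ GG U P a j e.2.2.2 e.2.2.1 e.2.2.2 ∧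
    lf P a (zc P (j + 1)) s (rest.length + 1) (k + rp a) e.2.2.2 =
      Option.some (e.1.length + (k + rp a), restrSeq (en (zc P (j + 1)) e.2.2.2) e.2.1)
  pw : led.Pairwise fun e e' => e'.2.2.2 ≤ e.2.2.1 ∧
    (e'.1 = e.1 → restrSeq (en (zc P (j + 1)) e.2.2.2) e'.2.1 ≠
      restrSeq (en (zc P (j + 1)) e'.2.2.2) e'.2.1)
  w1 : lw (nom (k + rp a) led) ≤ rW P a T - rW P a s
  w2 : rW P a T - rW P a s ≤ be a ^ j * lw (nom (k + rp a) led)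
  w3 : lw (nom (k + rp a) led) ≤ (1 / 2) ^ k + (1 / 2) ^ (k + rp a)
  wf : ∑ u ∈ Finset.range T, wo (lf P a (zc P (j + 1)) s (rest.length + 1) (k + rp a) u) =
    lw (nom (k + rp a) led)

section
variable {U : Str →. Str} {P : Cds} {a j s k : ℕ} {rest : List Frame}

theorem LS.start (h : (st P a s).2.2 = (j + 1, s, k, 0, [], Option.none) :: rest) :
    LS U P a j s k rest s 0 [] := by
  refine ⟨h, le_rfl, fun u h1 h2 => by omega, by simp, List.Pairwise.nil, by simp [nom],
    by simp [nom], by simp [nom]; positivity, ?_⟩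
  rw [Finset.sum_eq_zero]
  · simp [nom]
  · intro u hu
    have : ¬ s ≤ u := by simpa using hu
    simp [lf, this]

/-- The strings of fresh entries have bounded weight. -/
theorem LS.fresh (hpf : PFD U) (huc : UC U P.U) {T cnt : ℕ} {led : List Ent}
    (L : LS U P a j s k rest T cnt led) (ρ : Str) (hρ : (U ρ).Dom)
    (hst : ∀ e ∈ led, e.1 = ρ → stale (zc P (j + 1)) T e = true) :
    (1 / 2 : ℝ) ^ (ρ.length + (k + rp a)) +
      lw (nom (k + rp a) (led.filter fun e => !stale (zc P (j + 1)) T e)) ≤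
      (1 / 2) ^ (k + rp a) := by
  have h1 : lw ((ρ :: (led.filter fun e => !stale (zc P (j + 1)) T e).map fun e => e.1).map
      List.length) ≤ 1 := by
    rw [mu_list hpf]
    · exact mu_le_one hpf _
    · rw [List.nodup_cons]
      constructor
      · intro hm
        obtain ⟨e, he, he2⟩ := List.mem_map.1 hm
        have := List.mem_filter.1 he
        rw [hst e this.1 he2] at this
        simp at this
      · rw [List.Nodup, List.pairwise_map]
        refine ((L.pw.sublist List.filter_sublist).imp_of_mem ?_)
        intro e e' he he' hp hee
        have h1 := List.mem_filter.1 he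
        have h2 := List.mem_filter.1 he'
        refine hp.2 hee.symm ?_
        have h3 : ¬ stale (zc P (j + 1)) T e' = true := by simpa using h2.2
        rw [stale_iff, not_not] at h3
        have e1 := L.ent e h1.1
        exact ((en_mon _).mid' (hp.1.trans e1.2.2.1) e1.2.2.2.1.le h3.symm).symm
    · intro τ hτ
      rcases List.mem_cons.1 hτ with rfl | hτ
      · exact hρ
      · obtain ⟨e, he, rfl⟩ := List.mem_map.1 hτ
        exact huc.dom (L.ent e (List.mem_filter.1 he).1).2.2.2.2.1
  rw [List.map_cons, lw_cons] at h1
  rw [lw_nom, pow_add, ← add_mul]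
  exact mul_le_of_le_one_left (by positivity) h1

theorem LS.next (hpf : PFD U) (huc : UC U P.U) (hj : (j + 1) % 3 ≠ 1) (ih : Clm U P a j)
    (hw : rW P a s + be a ^ (j + 1) * (1 / 2) ^ k ≤ 1)
    {T cnt : ℕ} {led : List Ent}
    (L : LS U P a j s k rest T cnt led)
    (hf : full (zc P (j + 1)) T k (k + rp a) led = false) :
    ∃ T' led', T < T' ∧ LS U P a j s k rest T' (cnt + 1) led' ∧
      ∀ ρ m, dc cnt.unpair.1 = Option.some ρ → us P.U T ρ = Option.some (zeroStr m) → m ≤ T →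
        ∃ e ∈ led', e.1 = ρ ∧ (restrSeq (en (zc P (j + 1)) T) e.2.1 =
          restrSeq (en (zc P (j + 1)) e.2.2.2) e.2.1 ∨ T ≤ e.2.2.2) := by
  have h1 := st_next L.sk
  rw [stp_Lv (lv := j + 1) (Nat.succ_ne_zero j) hj, hf, cond_false] at h1
  set c := zc P (j + 1) with hc
  have lfT : ∀ u (fr : Frame) tl, (st P a u).2.2 = fr :: tl → fr.2.2.2.2.2 = Option.none →
      lf P a c s (rest.length + 1) (k + rp a) u = Option.none := by
    intro u fr tl hu hfr
    unfold lf; rw [hu, List.head?_cons, Option.bind_some, hfr]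
    simp
  have hT : ∀ u, s ≤ u → u < T + 1 → rest.length < (st P a u).2.2.length := by
    intro u hu1 hu2
    rcases Nat.lt_succ_iff_lt_or_eq.1 hu2 with h | rfl
    · exact L.ht u hu1 h
    · rw [L.sk]; simp
  cases hp : pick P c T cnt led with
  | none =>
    rw [hp, Option.elim_none] at h1
    have hr : rW P a (T + 1) = rW P a T := by unfold rW; rw [h1]
    refine ⟨T + 1, led, by omega, ⟨by rw [h1], L.le.trans (by omega), hT, ?_, L.pw, by rw [hr]; exact L.w1,
      by rw [hr]; exact L.w2, L.w3, ?_⟩, ?_⟩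
    · intro e he
      obtain ⟨a1, a2, a3, a4, a5⟩ := L.ent e he
      exact ⟨a1, a2, a3, by omega, a5⟩
    · rw [Finset.sum_range_succ, L.wf, lfT T _ _ L.sk rfl]; simp
    · intro ρ m hd hu hm
      by_contra hcon
      push Not at hcon
      unfold pick at hp
      rw [hd, Option.bind_some, hu, Option.bind_some] at hp
      have : (decide (zeroStr m = zeroStr (zeroStr m).length) && decide ((zeroStr m).length ≤ T) &&
        led.all fun e => !decide (e.1 = ρ) || stale c T e) = true := by
        simp only [Bool.and_eq_true, decide_eq_true_eq, List.all_eq_true, Bool.or_eq_true,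
          Bool.not_eq_true', decide_eq_false_iff_not]
        refine ⟨⟨by simp [zeroStr], by simpa [zeroStr] using hm⟩, fun e he => ?_⟩
        by_cases h : e.1 = ρ
        · right; rw [stale_iff]; exact (hcon e he h).1
        · left; exact h
      rw [this] at hp
      simp at hp
  | some q =>
    rw [hp, Option.elim_some, Nat.add_sub_cancel] at h1
    -- unpack the choice
    have hq : us P.U T q.1 = Option.some (zeroStr q.2) ∧ q.2 ≤ T ∧ dc cnt.unpair.1 = Option.some q.1 ∧
        ∀ e ∈ led, e.1 = q.1 → stale c T e = true := by
      unfold pick at hp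
      obtain ⟨ρ, p1, hp⟩ := Option.bind_eq_some_iff.1 hp
      obtain ⟨σ, p2, hp⟩ := Option.bind_eq_some_iff.1 hp
      cases hb : (decide (σ = zeroStr σ.length) && decide (σ.length ≤ T) &&
        led.all fun e => !decide (e.1 = ρ) || stale c T e)
      · rw [hb] at hp; simp at hp
      · rw [hb] at hp
        simp only [cond_true, Option.some.injEq] at hp
        subst hp
        simp only [Bool.and_eq_true, decide_eq_true_eq, List.all_eq_true, Bool.or_eq_true,
          Bool.not_eq_true', decide_eq_false_iff_not] at hb
        exact ⟨by rw [p2]; exact congrArg _ hb.1.1, hb.1.2, p1,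
          fun e he h => (hb.2 e he).resolve_left (not_not.2 h)⟩
    obtain ⟨q1, q2, q3, q4⟩ := hq
    have hr : rW P a (T + 1) = rW P a T := by unfold rW; rw [h1]
    have hfr := L.fresh hpf huc q.1 (huc.dom q1) q4
    have hns : lw (nom (k + rp a) (led.filter fun e => stale c T e)) < (1 / 2) ^ k := by
      by_contra hcon
      rw [not_lt] at hcon
      have : full c T k (k + rp a) led = true := by
        unfold full; rw [leW_iff]; simpa using hcon
      rw [hf] at this; exact absurd this (by simp)
    have hN : (1 / 2 : ℝ) ^ (q.1.length + (k + rp a)) + lw (nom (k + rp a) led) ≤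
        (1 / 2) ^ k + (1 / 2) ^ (k + rp a) := by
      rw [lw_nom_split c T]; linarith
    have hbp : (1 : ℝ) ≤ be a ^ j := one_le_pow₀ (be_one a)
    have hbN : be a ^ j * ((1 / 2 : ℝ) ^ (q.1.length + (k + rp a)) + lw (nom (k + rp a) led)) ≤
        be a ^ (j + 1) * (1 / 2) ^ k := by
      refine (mul_le_mul_of_nonneg_left hN (by linarith)).trans (le_of_eq ?_)
      rw [pow_succ, pow_add (1 / 2 : ℝ) k]; unfold be; ring
    have w2 := L.w2
    obtain ⟨t, ht1, ht2, ht3, ht4, ht5, ht6⟩ := ih (T + 1) _ _ (by rw [h1])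
      (by rw [hr]; linarith)
    rw [hr] at ht4 ht5
    have h2 := st_next ht2
    rw [stp_Lp (lv := j + 1) (Nat.succ_ne_zero j) hj] at h2
    have hr2 : rW P a (t + 1) = rW P a t := by unfold rW; rw [h2]
    have hlft : lf P a c s (rest.length + 1) (k + rp a) t =
        Option.some (q.1.length + (k + rp a), restrSeq (en c t) q.2) := by
      have : s ≤ t := L.le.trans (by omega)
      unfold lf; rw [ht2]; simp [this]
    have hsum : ∀ v, T + 1 ≤ v → v ≤ t →
        ∑ u ∈ Finset.range v, wo (lf P a c s (rest.length + 1) (k + rp a) u) =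
          lw (nom (k + rp a) led) := by
      intro v hv
      induction v, hv using Nat.le_induction with
      | base => intro _; rw [Finset.sum_range_succ, L.wf, lfT T _ _ L.sk rfl]; simp
      | succ v hv ihv =>
        intro hvt
        rw [Finset.sum_range_succ, ihv (by omega)]
        have h3 := ht3 v hv (by omega)
        have : ¬ (st P a v).2.2.length = rest.length + 1 := by
          simp at h3; omega
        simp [lf, this]
    have hnc : ∀ n m b, lw (nom (k + rp a) ((q.1, n, m, b) :: led)) =
        (1 / 2 : ℝ) ^ (q.1.length + (k + rp a)) + lw (nom (k + rp a) led) := by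
      intro n m b; simp [nom]
    refine ⟨t + 1, (q.1, q.2, T + 1, t) :: led, by omega, ⟨by rw [h2], L.le.trans (by omega), ?_, ?_, ?_,
      ?_, ?_, ?_, ?_⟩, ?_⟩
    · intro u hu1 hu2
      by_cases hu3 : u < T + 1
      · exact hT u hu1 hu3
      by_cases hu4 : u < t
      · have := ht3 u (by omega) hu4
        simp at this; omega
      · have : u = t := by omega
        subst this; rw [ht2]; simp
    · intro e he
      rcases List.mem_cons.1 he with rfl | he
      · exact ⟨L.le.trans (by simp), by simp; omega, by simp; omega, by simp,
          us_mono (by simp; omega) q1, ht6, hlft⟩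
      · obtain ⟨a1, a2, a3, a4, a5⟩ := L.ent e he
        exact ⟨a1, a2, a3, by omega, a5⟩
    · refine List.pairwise_cons.2 ⟨fun e he => ?_, L.pw⟩
      obtain ⟨a1, a2, a3, a4, a5⟩ := L.ent e he
      refine ⟨by simp; omega, fun hee hst => ?_⟩
      have := stale_iff.1 (q4 e he hee)
      exact this ((en_mon _).mid' a4.le (by simp; omega) hst.symm).symm
    · rw [hnc, hr2]; linarith [L.w1]
    · rw [hnc, hr2, mul_add]; linarith [L.w2]
    · rw [hnc]; exact hN
    · rw [hnc, Finset.sum_range_succ, hsum t (by omega) le_rfl, hlft, wo_some]; ring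
    · intro ρ m hd hu hm
      rw [q3] at hd
      exact ⟨_, List.mem_cons_self, by simpa using hd, Or.inr (by simp; omega)⟩

/-- Accounting over the ledger. -/
theorem led_sum (hpf : PFD U) (hj : (j + 1) % 3 ≠ 1) (T : ℕ) (led : List Ent) (hi kr : ℕ)
    (hsh : s ≤ hi)
    (hent : ∀ e ∈ led, s ≤ e.2.2.1 ∧ e.2.1 ≤ e.2.2.1 ∧ e.2.2.1 ≤ e.2.2.2 ∧ e.2.2.2 ≤ T ∧
      e.2.2.2 ≤ hi ∧ kap a j * (1 / 2) ^ (e.1.length + kr) ≤ GG U P a j e.2.2.2 e.2.2.1 e.2.2.2)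
    (hpw : led.Pairwise fun e e' => e'.2.2.2 ≤ e.2.2.1) :
    kap a j * lw (nom kr (led.filter fun e => stale (zc P (j + 1)) T e)) ≤
      GG U P a (j + 1) T s hi := by
  induction led generalizing hi with
  | nil => simpa [nom] using GG_nonneg U P a (j + 1) T s hi
  | cons e led ih =>
    obtain ⟨a1, a2, a3, a4, a5, a6⟩ := hent e (by simp)
    have hpw' := List.pairwise_cons.1 hpw
    have ih := ih e.2.2.1 a1 (fun e' he' => by
      obtain ⟨b1, b2, b3, b4, b5, b6⟩ := hent e' (List.mem_cons_of_mem _ he')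
      exact ⟨b1, b2, b3, b4, hpw'.1 e' he', b6⟩) hpw'.2
    have hadd := GG_add (P := P) hpf (a := a) (j := j + 1) (T := T) a1 (a3.trans a5)
    cases hst : stale (zc P (j + 1)) T e
    · rw [List.filter_cons_of_neg (by simp [hst])]
      linarith [GG_nonneg U P a (j + 1) T e.2.2.1 hi]
    · rw [List.filter_cons_of_pos hst]
      have : lw (nom kr (e :: led.filter fun e => stale (zc P (j + 1)) T e)) =
        (1 / 2) ^ (e.1.length + kr) + lw (nom kr (led.filter fun e => stale (zc P (j + 1)) T e)) := by
        simp [nom]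
      rw [this, mul_add]
      have := GG_stale (P := P) hpf (a := a) hj a4 a2 a5 (stale_iff.1 hst)
      linarith

theorem clm_L (H : Hyp U P a) {j : ℕ} (hj : (j + 1) % 3 ≠ 1) (ih : Clm U P a j) :
    Clm U P a (j + 1) := by
  intro s k rest h hw
  have hpf := H.pf
  by_cases hfull : ∃ T cnt led, LS U P a j s k rest T cnt led ∧
      full (zc P (j + 1)) T k (k + rp a) led = true
  · obtain ⟨T, cnt, led, L, hf⟩ := hfull
    have h1 := st_next L.sk
    rw [stp_Lv (lv := j + 1) (Nat.succ_ne_zero j) hj, hf, cond_true] at h1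
    have hr : rW P a (T + 1) = rW P a T := by unfold rW; rw [h1]
    unfold full at hf
    rw [leW_iff] at hf
    simp only [lw_cons, lw_nil, add_zero] at hf
    have hfn := lw_nonneg (nom (k + rp a) (led.filter fun e => !stale (zc P (j + 1)) T e))
    have hsp := lw_nom_split (zc P (j + 1)) T (k + rp a) led
    have hbp : (1 : ℝ) ≤ be a ^ j := one_le_pow₀ (be_one a)
    have hbN : be a ^ j * lw (nom (k + rp a) led) ≤ be a ^ (j + 1) * (1 / 2) ^ k := by
      refine (mul_le_mul_of_nonneg_left L.w3 (by linarith)).trans (le_of_eq ?_)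
      rw [pow_succ, pow_add (1 / 2 : ℝ) k]; unfold be; ring
    refine ⟨T + 1, Nat.lt_succ_of_le L.le, by rw [h1], ?_, by rw [hr]; linarith [L.w1],
      by rw [hr]; linarith [L.w2], ?_⟩
    · intro u hu1 hu2
      rcases Nat.lt_succ_iff_lt_or_eq.1 hu2 with h | rfl
      · exact L.ht u hu1 h
      · rw [L.sk]; simp
    · have h2 := led_sum (U := U) (P := P) (a := a) (s := s) hpf hj T led T (k + rp a) L.le
        (fun e he => by
          obtain ⟨b1, b2, b3, b4, b5, b6, b7⟩ := L.ent e he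
          exact ⟨b1, b2, b3, b4.le, b4.le, b6⟩) (L.pw.imp fun h => h.1)
      rw [kap_L a j hj]
      have h3 := GG_mono (P := P) hpf (a := a) (j := j + 1) (Nat.le_succ T) (le_refl s) (Nat.le_succ T)
      exact (mul_le_mul_of_nonneg_left hf (kap_nonneg a j)).trans (h2.trans h3)
  · exfalso
    have hnf : ∀ T cnt led, LS U P a j s k rest T cnt led →
        full (zc P (j + 1)) T k (k + rp a) led = false := by
      intro T cnt led L
      by_contra hc
      exact hfull ⟨T, cnt, led, L, by simpa using hc⟩
    have hall : ∀ n, ∃ T led, n ≤ T ∧ LS U P a j s k rest T n led := by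
      intro n
      induction n with
      | zero => exact ⟨s, [], Nat.zero_le _, LS.start h⟩
      | succ n ihn =>
        obtain ⟨T, led, hT, L⟩ := ihn
        obtain ⟨T', led', h1, h2, -⟩ := L.next hpf H.huc hj ih hw (hnf _ _ _ L)
        exact ⟨T', led', by omega, h2⟩
    set c := zc P (j + 1) with hc
    have hnt : ¬ ∃ c' : ℕ, ∀ n, KC U (restrSeq (lim (en c)) n) ≤ KC U (zeroStr n) + c' := by
      rw [hc]; unfold zc
      cases decide ((j + 1) % 3 = 2)
      · exact H.nA
      · exact H.nD
    refine hnt ?_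
    obtain ⟨c0, hc0⟩ := kraft_chaitin H.hU
      (f := fun _ u => lf P a c s (rest.length + 1) (k + rp a) u)
      ((lf_prim P a c s (rest.length + 1) (k + rp a)).comp Primrec.snd)
    refine ⟨k + rp a + c0, fun m => ?_⟩
    by_cases hK : KC U (zeroStr m) = ⊤
    · rw [hK]; simp
    obtain ⟨n0, hn0⟩ := ENat.ne_top_iff_exists.1 hK
    obtain ⟨ρ, hρ, hρl⟩ := KC_exists (n := n0) hn0.ge
    obtain ⟨t0, ht0⟩ := (H.huc _ _).1 hρ
    obtain ⟨t1, ht1⟩ := (en_mon c).stab m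
    obtain ⟨T, led, hT, L⟩ := hall (Nat.pair (Encodable.encode ρ) (max (max t0 t1) m))
    obtain ⟨T', led', hT', L', hcv⟩ := L.next hpf H.huc hj ih hw (hnf _ _ _ L)
    have hge := Nat.right_le_pair (Encodable.encode ρ) (max (max t0 t1) m)
    have hm0 : m ≤ max (max t0 t1) m := le_max_right _ _
    have hm1 : t0 ≤ max (max t0 t1) m := (le_max_left _ _).trans (le_max_left _ _)
    have hm2 : t1 ≤ max (max t0 t1) m := (le_max_right _ _).trans (le_max_left _ _)
    obtain ⟨e, he, heρ, heb⟩ := hcv ρ m (by rw [Nat.unpair_pair]; exact dc_iff.2 rfl)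
      (us_mono (by omega) ht0) (by omega)
    obtain ⟨b1, b2, b3, b4, b5, b6, b7⟩ := L'.ent e he
    rw [heρ] at b5
    have hem : m = e.2.1 := by
      have := congrArg List.length (us_uniq ht0 b5)
      simpa [zeroStr] using this
    rw [← hem] at heb b7
    have hfin : restrSeq (en c e.2.2.2) m = restrSeq (lim (en c)) m := by
      rcases heb with heb | heb
      · rw [← heb]; exact ht1 T (by omega)
      · exact ht1 _ (by omega)
    rw [hfin, heρ] at b7
    have hsum : (∑ u ∈ Finset.range e.2.2.2, wo (lf P a c s (rest.length + 1) (k + rp a) u)) +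
        (1 / 2) ^ (ρ.length + (k + rp a)) ≤ 1 := by
      have h1 : (∑ u ∈ Finset.range e.2.2.2, wo (lf P a c s (rest.length + 1) (k + rp a) u)) +
        (1 / 2) ^ (ρ.length + (k + rp a)) =
        ∑ u ∈ Finset.range (e.2.2.2 + 1), wo (lf P a c s (rest.length + 1) (k + rp a) u) := by
        rw [Finset.sum_range_succ, b7, wo_some]
      rw [h1]
      refine (Finset.sum_le_sum_of_subset_of_nonneg (Finset.range_mono b4)
        (fun _ _ _ => wo_nonneg _)).trans ?_
      rw [L'.wf]
      refine L'.w3.trans ?_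
      have h2 := rW_nonneg P a s
      have h3 : (1 / 2 : ℝ) ^ k + (1 / 2) ^ (k + rp a) = be a ^ 1 * (1 / 2) ^ k := by
        unfold be; rw [pow_add]; ring
      have h4 : be a ^ 1 ≤ be a ^ (j + 1) := pow_le_pow_right₀ (be_one a) (by omega)
      have h5 := mul_le_mul_of_nonneg_right h4 (by positivity : (0 : ℝ) ≤ (1 / 2) ^ k)
      linarith
    have := hc0 0 e.2.2.2 _ _ b7 hsum
    refine this.trans ?_
    rw [← hn0]
    have : ρ.length + (k + rp a) + 0 + c0 ≤ n0 + (k + rp a + c0) := by omega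
    exact_mod_cast this

theorem clm_all (H : Hyp U P a) (j : ℕ) : Clm U P a j := by
  induction j with
  | zero => exact clm_zero U P a
  | succ j ih =>
    by_cases hj : (j + 1) % 3 = 1
    · exact clm_T H hj ih
    · exact clm_L H hj ih

/-- The hypotheses are contradictory. -/
theorem no_hyp (H : Hyp U P a) : False := by
  have hpf := H.pf
  have hb : be a ^ jp a ≤ 2 := by
    have h1 : be a ≤ Real.exp ((1 / 2) ^ rp a) := by
      unfold be; linarith [Real.add_one_le_exp ((1 / 2 : ℝ) ^ rp a)]
    have h2 : be a ^ jp a ≤ Real.exp ((jp a : ℝ) * (1 / 2) ^ rp a) := by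
      rw [Real.exp_nat_mul]
      exact pow_le_pow_left₀ (by linarith [be_one a]) h1 _
    have h3 : (jp a : ℝ) * (1 / 2) ^ rp a ≤ 1 / 2 := by
      have h4 : (jp a : ℝ) ≤ 2 ^ jp a := by exact_mod_cast (Nat.lt_two_pow_self).le
      unfold rp
      rw [pow_add, one_div_pow, one_div_pow]
      have h5 : (0 : ℝ) < 2 ^ jp a := by positivity
      rw [show (jp a : ℝ) * (1 / 2 ^ jp a * (1 / 2 ^ 2)) = (jp a / 2 ^ jp a) * (1 / 4) by
        field_simp; norm_num]
      have := (div_le_one h5).2 h4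
      linarith
    refine h2.trans ((Real.exp_le_exp.2 h3).trans ?_)
    have h6 := Real.exp_bound_div_one_sub_of_interval (x := 1 / 2) (by norm_num) (by norm_num)
    norm_num at h6 ⊢
    exact h6
  obtain ⟨t, -, -, -, -, -, h⟩ := clm_all H (jp a) 0 1 [] rfl (by
    have : rW P a 0 = 0 := by simp [rW, st_zero]
    rw [this]; linarith)
  have h1 : kap a (jp a) = 8 := by
    unfold kap jp
    have : (3 * 2 ^ (2 * gp a + 3) + 2) / 3 = 2 ^ (2 * gp a + 3) := by omega
    rw [this]; push_cast
    rw [pow_add, mul_right_comm, ← mul_pow]; norm_num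
  rw [h1] at h
  have h2 : GG U P a (jp a) t 0 t ≤ 3 := by
    unfold GG
    have := fun v e => acc_le_one (P := P) (e := e) hpf v t 0 t
    linarith [this (decide (jp a % 3 ≠ 0)) (en P.A), this (decide (jp a % 3 = 1)) (en P.D),
      this false (eX P a)]
  norm_num at h
  linarith
end

/-! ### Assembly -/

/-- One change of the set at a stage. -/
def CH (P : Cds) (a T s k : ℕ) : Prop :=
  (st P a (T + 1)).1 = s :: (st P a T).1 ∧ s ∉ (st P a T).1 ∧
    good P a T (st P a T).1 (st P a T).2.1 s = true ∧
    small P a T s k = true ∧ heavy (st P a T).2.1 s k = true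

theorem ch_cases (P : Cds) (a T : ℕ) : (st P a (T + 1)).1 = (st P a T).1 ∨ ∃ s k, CH P a T s k := by
  have hb := (binv P a T).snx
  unfold CH
  rw [st_succ]
  have h := stp_cases P a T (st P a T)
  generalize st P a T = S at *
  generalize stp P a T S = S' at *
  cases h with
  | chg xs rq fr tl h1 h2 h3 => right; exact ⟨_, _, rfl, hb fr (by simp), h1, h2, h3⟩
  | _ => left; rfl

/-- Wasted strings. -/
def WS (P : Cds) (a T : ℕ) : Set Str :=
  {ρ | ∃ s k, CH P a T s k ∧ ∃ q ∈ (st P a T).2.1, s < q.2 ∧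
    us P.U T ρ = Option.some (restrSeq (inl (st P a T).1) q.2)}

/-- Strings affected by a change. -/
def CV (P : Cds) (c : Nat.Partrec.Code) (a T : ℕ) : Set Str :=
  {ρ | ∃ s k, CH P a T s k ∧ ρ ∈ cvS P (en c) T s}

section
variable {U : Str →. Str} {P : Cds}

theorem WS_sum (hpf : PFD U) (a N : ℕ) : ∑ T ∈ Finset.range N, mu U (WS P a T) ≤ 1 := by
  have key : ∀ T T' ρ, T < T' → ρ ∈ WS P a T → ρ ∉ WS P a T' := by
    rintro T T' ρ hT ⟨s, k, hc, q, hq, hs, hu⟩ ⟨s', k', hc', q', hq', hs', hu'⟩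
    have h1 := us_uniq hu hu'
    have h2 := restrSeq_inj h1
    rw [← h2] at h1
    have h3 : restrSeq (eX P a T) q.2 = restrSeq (eX P a (T + 1)) q.2 :=
      (eX_mon P a).mid' (Nat.le_succ T) hT h1
    have h4 := restrSeq_eq.1 h3 s hs
    unfold eX at h4
    rw [hc.1] at h4
    have t1 : inl (s :: (st P a T).1) s = true := inl_iff.2 (by simp)
    rw [← h4, inl_iff] at t1
    exact hc.2.1 t1
  refine (mu_sum_le hpf _ (WS P a) Set.univ (fun _ _ => Set.subset_univ _) ?_).trans
    (mu_le_one hpf _)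
  intro T _ T' _ hne ρ h1 h2
  rcases lt_or_gt_of_ne hne with h | h
  · exact key T T' ρ h h1 h2
  · exact key T' T ρ h h2 h1

theorem CV_mu (hpf : PFD U) (huc : UC U P.U) {c : Nat.Partrec.Code} (hc : c = P.A ∨ c = P.D)
    (a T : ℕ) : mu U (CV P c a T) ≤ (1 / 2) ^ gp a * mu U (WS P a T) := by
  by_cases h : ∃ s k, CH P a T s k
  · obtain ⟨s, k, h⟩ := h
    have h1 : mu U (CV P c a T) ≤ mu U (cvS P (en c) T s) := by
      refine mu_mono hpf ?_
      rintro ρ ⟨s', k', h', hρ⟩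
      have := h.1.symm.trans h'.1
      have e : s = s' := (List.cons.inj this).1
      rw [e]; exact hρ
    have h2 := (small_iff hpf huc a T s k).1 h.2.2.2.1
    have h3 : mu U (cvS P (en c) T s) ≤ (1 / 2 : ℝ) ^ (k + 2 * gp a) := by
      have b1 := mu_nonneg (U := U) (cvS P (en P.A) T s)
      have b2 := mu_nonneg (U := U) (cvS P (en P.D) T s)
      rcases hc with rfl | rfl <;> linarith
    have h4 := good_mu hpf huc a T s (st P a T).1 (st P a T).2.1 (binv P a T).rnd h.2.2.1
    have h5 := h.2.2.2.2
    unfold heavy at h5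
    rw [leW_iff] at h5
    simp only [lw_cons, lw_nil, add_zero] at h5
    have h6 : mu U {ρ | ∃ q ∈ (st P a T).2.1, s < q.2 ∧
        us P.U T ρ = Option.some (restrSeq (inl (st P a T).1) q.2)} ≤ mu U (WS P a T) :=
      mu_mono hpf fun ρ hρ => ⟨s, k, h, hρ⟩
    have h7 := mul_le_mul_of_nonneg_right h5 (by positivity : (0 : ℝ) ≤ (1 / 2) ^ gp a)
    have h8 := mul_le_mul_of_nonneg_left (h7.trans (h4.trans h6))
      (by positivity : (0 : ℝ) ≤ (1 / 2) ^ gp a)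
    have h9 : (1 / 2 : ℝ) ^ (k + 2 * gp a) = (1 / 2) ^ gp a * ((1 / 2) ^ k * (1 / 2) ^ gp a) := by
      rw [two_mul, pow_add, pow_add]; ring
    linarith
  · have : CV P c a T = ∅ := by
      ext ρ; constructor
      · rintro ⟨s, k, h', -⟩; exact absurd ⟨s, k, h'⟩ h
      · intro h; exact absurd h (by simp)
    rw [this, mu_empty]
    exact mul_nonneg (by positivity) (mu_nonneg _)

theorem CV_sum (hpf : PFD U) (huc : UC U P.U) {c : Nat.Partrec.Code} (hc : c = P.A ∨ c = P.D)
    (N M : ℕ) : ∑ T ∈ Finset.range N, ∑ a ∈ Finset.range M, mu U (CV P c a T) ≤ 2 := by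
  rw [Finset.sum_comm]
  have h1 : ∀ a, ∑ T ∈ Finset.range N, mu U (CV P c a T) ≤ (1 / 2) ^ a := by
    intro a
    refine (Finset.sum_le_sum fun T _ => CV_mu hpf huc hc a T).trans ?_
    rw [← Finset.mul_sum]
    refine (mul_le_of_le_one_right (by positivity) (WS_sum hpf a N)).trans ?_
    exact pow_le_pow_of_le_one (by norm_num) (by norm_num) (by unfold gp; omega)
  refine (Finset.sum_le_sum fun a _ => h1 a).trans ?_
  exact (sum_geometric_two_le M)

/-- The joint set. -/
def eY (P : Cds) (t i : ℕ) : Bool := eX P i.unpair.1 t i.unpair.2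

theorem eY_mon (P : Cds) : Mon (eY P) := fun s t i h => eX_mon P i.unpair.1 s t i.unpair.2 h

@[fun_prop] theorem eY_prim {α : Type} [Primcodable α] (P : Cds) {f g : α → ℕ} (hf : Primrec f)
    (hg : Primrec g) : Primrec fun x => eY P (f x) (g x) := by
  unfold eY eX; fun_prop

/-- Validity. -/
def vl (P : Cds) (c : Nat.Partrec.Code) (t : ℕ) (ρ : Str) : Bool :=
  (us P.U t ρ).elim false fun σ => decide (σ.length ≤ t) && decide (σ = restrSeq (en c t) σ.length)

@[fun_prop] theorem vl_prim {α : Type*} [Primcodable α] (P : Cds) (c : Nat.Partrec.Code)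
    {t : α → ℕ} {ρ : α → Str} (ht : Primrec t) (hρ : Primrec ρ) :
    Primrec fun x => vl P c (t x) (ρ x) := by
  unfold vl; fun_prop

theorem vl_iff {c : Nat.Partrec.Code} {t : ℕ} {ρ : Str} : vl P c t ρ = true ↔
    ∃ m, m ≤ t ∧ us P.U t ρ = Option.some (restrSeq (en c t) m) := by
  unfold vl
  cases h : us P.U t ρ with
  | none => simp
  | some σ =>
    simp only [Option.elim_some, Bool.and_eq_true, decide_eq_true_eq, Option.some.injEq]
    constructor
    · rintro ⟨h1, h2⟩; exact ⟨_, h1, h2⟩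
    · rintro ⟨m, h1, rfl⟩; rw [restrSeq_length]; exact ⟨h1, rfl⟩

theorem vl_mid {c : Nat.Partrec.Code} {r u t : ℕ} {ρ : Str} (h1 : r ≤ u) (h2 : u ≤ t)
    (hr : vl P c r ρ = true) (ht : vl P c t ρ = true) : vl P c u ρ = true := by
  rw [vl_iff] at *
  obtain ⟨m, m1, m2⟩ := hr
  obtain ⟨m', m1', m2'⟩ := ht
  have h3 := us_uniq m2 m2'
  have := restrSeq_inj h3
  subst this
  exact ⟨m, by omega, by rw [us_mono h1 m2, (en_mon c).mid' h1 h2 h3]⟩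

/-- Requests for the reduction. -/
def rdq (P : Cds) (c : Nat.Partrec.Code) (t n : ℕ) : Option (ℕ × Str) :=
  (dc n).bind fun ρ => (us P.U t ρ).bind fun σ =>
    cond (vl P c t ρ && !(decide (t ≠ 0) && vl P c (t - 1) ρ &&
      decide (restrSeq (eY P (t - 1)) σ.length = restrSeq (eY P t) σ.length)))
    (Option.some (ρ.length + 2, restrSeq (eY P t) σ.length)) Option.none

@[fun_prop] theorem rY_prim {α : Type} [Primcodable α] (P : Cds) {f g : α → ℕ} (hf : Primrec f)
    (hg : Primrec g) : Primrec fun x => restrSeq (eY P (f x)) (g x) :=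
  restrSeq_prim (e := fun x => eY P (f x)) (by fun_prop) hg

@[fun_prop] theorem dne_prim {α : Type} [Primcodable α] {f : α → ℕ} (hf : Primrec f) :
    Primrec fun x => decide (f x ≠ 0) := by
  have : (fun x => decide (f x ≠ 0)) = fun x => !decide (f x = 0) := by funext x; simp
  rw [this]; fun_prop

set_option maxHeartbeats 1000000 in
theorem rdq_prim (P : Cds) (c : Nat.Partrec.Code) :
    Primrec fun q : ℕ × ℕ => rdq P c q.2.unpair.1 q.2.unpair.2 := by
  unfold rdq
  fun_prop

/-- First validity. -/
def FV (P : Cds) (c : Nat.Partrec.Code) (t : ℕ) : Set Str :=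
  {ρ | vl P c t ρ = true ∧ ¬ (t ≠ 0 ∧ vl P c (t - 1) ρ = true)}

/-- Changes. -/
def CG (P : Cds) (c : Nat.Partrec.Code) (t : ℕ) : Set Str :=
  {ρ | vl P c t ρ = true ∧ ∃ m, us P.U t ρ = Option.some (restrSeq (en c t) m) ∧
    t ≠ 0 ∧ vl P c (t - 1) ρ = true ∧ restrSeq (eY P (t - 1)) m ≠ restrSeq (eY P t) m}

theorem rdq_le (huc : UC U P.U) (c : Nat.Partrec.Code) (t n : ℕ) : wo (rdq P c t n) ≤
    (1 / 4) * ((dc n).elim 0 ((FV P c t).indicator (wU U)) +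
      (dc n).elim 0 ((CG P c t).indicator (wU U))) := by
  have i0 : ∀ (S : Set Str) ρ, 0 ≤ S.indicator (wU U) ρ := fun S ρ =>
    Set.indicator_nonneg (fun x _ => wU_nonneg U x) ρ
  unfold rdq
  cases hd : dc n with
  | none => simp
  | some ρ =>
    rw [Option.bind_some, Option.elim_some, Option.elim_some]
    cases hu : us P.U t ρ with
    | none => simp only [Option.bind_none, wo_none]; linarith [i0 (FV P c t) ρ, i0 (CG P c t) ρ]
    | some σ =>
      rw [Option.bind_some]
      have hw : wU U ρ = (1 / 2) ^ ρ.length := by unfold wU; rw [if_pos (huc.dom hu)]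
      cases hb : (vl P c t ρ && !(decide (t ≠ 0) && vl P c (t - 1) ρ &&
        decide (restrSeq (eY P (t - 1)) σ.length = restrSeq (eY P t) σ.length)))
      · simp only [cond_false, wo_none]; linarith [i0 (FV P c t) ρ, i0 (CG P c t) ρ]
      · rw [cond_true, wo_some]
        simp only [Bool.and_eq_true, Bool.not_eq_true', Bool.and_eq_false_iff,
          decide_eq_false_iff_not] at hb
        have e : (1 / 2 : ℝ) ^ (ρ.length + 2) = 1 / 4 * wU U ρ := by rw [hw, pow_add]; ring
        rw [e]
        by_cases hF : ρ ∈ FV P c t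
        · rw [Set.indicator_of_mem hF]; linarith [i0 (CG P c t) ρ]
        · have hG : ρ ∈ CG P c t := by
            have hF' : t ≠ 0 ∧ vl P c (t - 1) ρ = true := by
              by_contra hcon; exact hF ⟨hb.1, hcon⟩
            obtain ⟨m, hm, hum⟩ := vl_iff.1 hb.1
            have : σ = restrSeq (en c t) m := us_uniq hu hum
            have hl : σ.length = m := by rw [this, restrSeq_length]
            refine ⟨hb.1, m, hum, hF'.1, hF'.2, ?_⟩
            rw [← hl]
            rcases hb.2 with (h | h) | h
            · exact absurd hF'.1 h
            · rw [hF'.2] at h; exact absurd h (by simp)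
            · exact h
          rw [Set.indicator_of_mem hG]; linarith [i0 (FV P c t) ρ]

theorem FV_sum (hpf : PFD U) (c : Nat.Partrec.Code) (I : ℕ) :
    ∑ t ∈ Finset.range I, ∑ n ∈ Finset.range I, (dc n).elim 0 ((FV P c t).indicator (wU U)) ≤ 1 := by
  rw [Finset.sum_comm]
  refine le_trans ?_ ((sum_dc_le hpf Set.univ I).trans (mu_le_one hpf _))
  refine Finset.sum_le_sum fun n _ => ?_
  cases hd : dc n with
  | none => simp
  | some ρ =>
    simp only [Option.elim_some, Set.indicator_univ]
    have key : ∀ t t', t < t' → ρ ∈ FV P c t → ρ ∉ FV P c t' := by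
      rintro t t' h ⟨h1, -⟩ ⟨h2, h3⟩
      exact h3 ⟨by omega, vl_mid (by omega) (by omega) h1 h2⟩
    refine sum_once (wU_nonneg U ρ) I fun t ht => ?_
    have ht := Set.mem_of_indicator_ne_zero ht
    refine ⟨by rw [Set.indicator_of_mem ht], fun t' ht' => ?_⟩
    have ht' := Set.mem_of_indicator_ne_zero ht'
    rcases lt_trichotomy t t' with h | h | h
    · exact absurd ht' (key t t' h ht)
    · exact h.symm
    · exact absurd ht (key t' t h ht')

theorem CG_sub (c : Nat.Partrec.Code) (T : ℕ) :
    CG P c (T + 1) ⊆ ⋃ a ∈ Finset.range T, CV P c a T := by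
  rintro ρ ⟨h1, m, h2, -, h4, h5⟩
  rw [Nat.add_sub_cancel] at h4 h5
  obtain ⟨m', hm', h6⟩ := vl_iff.1 h4
  have : m' = m := restrSeq_inj (us_uniq h6 h2)
  subst this
  rw [ne_eq, restrSeq_eq] at h5
  push Not at h5
  obtain ⟨i, hi, h5⟩ := h5
  unfold eY eX at h5
  have hle1 := Nat.unpair_left_le i
  have hle2 := Nat.unpair_right_le i
  simp only [Set.mem_iUnion, Finset.mem_range]
  refine ⟨i.unpair.1, by omega, ?_⟩
  rcases ch_cases P i.unpair.1 T with hc | ⟨s, k, hc⟩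
  · rw [hc] at h5; exact absurd rfl h5
  · refine ⟨s, k, hc, m', ?_, hm', h6⟩
    rw [hc.1] at h5
    have : i.unpair.2 = s := by
      by_contra hne
      apply h5
      rw [Bool.eq_iff_iff, inl_iff, inl_iff]
      simp [hne]
    omega

theorem mu_biUnion_le (hpf : PFD U) (S : Finset ℕ) (F : ℕ → Set Str) :
    mu U (⋃ a ∈ S, F a) ≤ ∑ a ∈ S, mu U (F a) := by
  induction S using Finset.induction_on with
  | empty => simp [mu_empty]
  | insert x S hx ih =>
    rw [Finset.set_biUnion_insert, Finset.sum_insert hx]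
    linarith [mu_union_le hpf (F x) (⋃ a ∈ S, F a)]

theorem CG_sum (hpf : PFD U) (huc : UC U P.U) {c : Nat.Partrec.Code} (hc : c = P.A ∨ c = P.D)
    (I : ℕ) :
    ∑ t ∈ Finset.range I, ∑ n ∈ Finset.range I, (dc n).elim 0 ((CG P c t).indicator (wU U)) ≤ 2 := by
  refine (Finset.sum_le_sum fun t _ => sum_dc_le hpf (CG P c t) I).trans ?_
  refine (Finset.sum_le_sum_of_subset_of_nonneg (Finset.range_mono (Nat.le_succ I))
    (fun _ _ _ => mu_nonneg _)).trans ?_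
  rw [Finset.sum_range_succ']
  have h0 : CG P c 0 = ∅ := by
    ext ρ; constructor
    · rintro ⟨-, m, -, h, -⟩; exact absurd rfl h
    · intro h; exact absurd h (by simp)
  rw [h0, mu_empty, add_zero]
  refine le_trans (Finset.sum_le_sum fun T hT => ?_) (CV_sum hpf huc hc I I)
  refine (mu_mono hpf (CG_sub c T)).trans ((mu_biUnion_le hpf _ _).trans ?_)
  exact Finset.sum_le_sum_of_subset_of_nonneg
    (Finset.range_mono (Finset.mem_range.1 hT).le) (fun _ _ _ => mu_nonneg _)

theorem rdq_sum (hpf : PFD U) (huc : UC U P.U) {c : Nat.Partrec.Code} (hc : c = P.A ∨ c = P.D)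
    (I : ℕ) : ∑ i ∈ Finset.range I, wo (rdq P c i.unpair.1 i.unpair.2) ≤ 1 := by
  refine (sum_unpair_le (w := fun t n => wo (rdq P c t n)) (fun _ _ => wo_nonneg _) I).trans ?_
  refine (Finset.sum_le_sum fun t _ => Finset.sum_le_sum fun n _ => rdq_le huc c t n).trans ?_
  simp_rw [← Finset.mul_sum, Finset.sum_add_distrib]
  linarith [FV_sum (P := P) hpf c I, CG_sum (P := P) hpf huc hc I]

/-- The joint set is below both sets. -/
theorem Y_le (hU : OptimalPF U) (huc : UC U P.U) {c : Nat.Partrec.Code} (hc : c = P.A ∨ c = P.D) :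
    ∃ d : ℕ, ∀ m, KC U (restrSeq (lim (eY P)) m) ≤ KC U (restrSeq (lim (en c)) m) + d := by
  obtain ⟨c0, hc0⟩ := kraft_chaitin hU (f := fun _ i => rdq P c i.unpair.1 i.unpair.2)
    (rdq_prim P c)
  refine ⟨2 + c0, fun m => ?_⟩
  by_cases hK : KC U (restrSeq (lim (en c)) m) = ⊤
  · rw [hK]; simp
  obtain ⟨n0, hn0⟩ := ENat.ne_top_iff_exists.1 hK
  obtain ⟨ρ, hρ, hρl⟩ := KC_exists (n := n0) hn0.ge
  obtain ⟨t0, ht0⟩ := (huc _ _).1 hρ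
  obtain ⟨t1, ht1⟩ := (en_mon c).stab m
  obtain ⟨t2, ht2⟩ := (eY_mon P).stab m
  have hex : ∃ t, vl P c t ρ = true ∧ restrSeq (eY P t) m = restrSeq (lim (eY P)) m := by
    refine ⟨t0 + t1 + t2 + m, vl_iff.2 ⟨m, by omega, ?_⟩, ht2 _ (by omega)⟩
    rw [us_mono (by omega) ht0, ht1 _ (by omega)]
  have hmin := fun t => Nat.find_min hex (m := t)
  obtain ⟨hv, he⟩ := Nat.find_spec hex
  set t := Nat.find hex with htdef
  obtain ⟨m', hm', hum⟩ := vl_iff.1 hv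
  have hmm : m = m' := restrSeq_inj (us_uniq ht0 hum)
  subst hmm
  have hr : rdq P c (Nat.pair t (Encodable.encode ρ)).unpair.1
      (Nat.pair t (Encodable.encode ρ)).unpair.2 =
      Option.some (ρ.length + 2, restrSeq (lim (eY P)) m) := by
    rw [Nat.unpair_pair]
    unfold rdq
    rw [dc_iff.2 rfl, Option.bind_some, hum, Option.bind_some, restrSeq_length, hv]
    have : (decide (t ≠ 0) && vl P c (t - 1) ρ &&
      decide (restrSeq (eY P (t - 1)) m = restrSeq (eY P t) m)) = false := by
      rw [← Bool.not_eq_true]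
      intro hcon
      simp only [Bool.and_eq_true, decide_eq_true_eq] at hcon
      exact hmin (t - 1) (by omega) ⟨hcon.1.2, hcon.2.trans he⟩
    rw [this, he]; rfl
  have hs := rdq_sum (P := P) hU.1.2 huc hc (Nat.pair t (Encodable.encode ρ) + 1)
  rw [Finset.sum_range_succ, hr, wo_some] at hs
  refine (hc0 0 _ _ _ hr hs).trans ?_
  rw [← hn0]
  have : ρ.length + 2 + 0 + c0 ≤ n0 + (2 + c0) := by omega
  exact_mod_cast this

/-- The requests as a Kraft-Chaitin set. -/
def rqf (P : Cds) (a T : ℕ) : Option (ℕ × Str) :=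
  (st P a (T + 1)).2.1.head?.bind fun q =>
    cond (decide (q.2 = T)) (Option.some (q.1, zeroStr T)) Option.none

theorem rqf_prim (P : Cds) : Primrec fun q : ℕ × ℕ => rqf P q.1 q.2 := by
  unfold rqf zeroStr
  fun_prop

theorem rqf_sum (P : Cds) (a T : ℕ) : ∑ u ∈ Finset.range T, wo (rqf P a u) = rW P a T := by
  induction T with
  | zero => simp [rW, st_zero]
  | succ T ih =>
    rw [Finset.sum_range_succ, ih]
    rcases rq_succ P a T with h | ⟨k, h⟩
    · have h0 : rqf P a T = Option.none := by
        unfold rqf; rw [h]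
        cases hl : (st P a T).2.1 with
        | nil => rfl
        | cons q l =>
          have := (binv P a T).rlt q (by rw [hl]; simp)
          have hne : ¬ q.2 = T := by omega
          simp [hne]
      rw [h0]; unfold rW; rw [h]; simp
    · have h0 : rqf P a T = Option.some (k, zeroStr T) := by
        unfold rqf; rw [h]; simp
      rw [h0]; unfold rW; rw [h]; simp; ring

theorem lim_eY (P : Cds) (a i : ℕ) : lim (eY P) (Nat.pair a i) = lim (eX P a) i := by
  unfold lim eY; simp

/-- If the joint set were trivial, the hypothesis would hold. -/
theorem Y_triv (hU : OptimalPF U)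
    (ht : ∃ d : ℕ, ∀ m, KC U (restrSeq (lim (eY P)) m) ≤ KC U (zeroStr m) + d) :
    ∃ a, ∀ t, ∀ q ∈ (st P a t).2.1, rW P a (q.2 + 1) ≤ 1 →
      ∃ ρ : Str, ρ.length ≤ q.1 + gp a ∧ restrSeq (lim (eX P a)) q.2 ∈ U ρ := by
  obtain ⟨d, hd⟩ := ht
  obtain ⟨c1, h1⟩ := transform hU (F := fun a σ => (List.range σ.length.unpair.2).map fun i =>
    (σ.drop (Nat.pair a i)).head?.getD false) (by fun_prop)
  obtain ⟨c2, h2⟩ := transform hU (F := fun a σ => zeroStr (Nat.pair a σ.length))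
    (by unfold zeroStr; fun_prop)
  obtain ⟨c3, h3⟩ := kraft_chaitin hU (rqf_prim P)
  refine ⟨d + c1 + c2 + c3, fun t q hq hw => ?_⟩
  set a := d + c1 + c2 + c3 with ha
  obtain ⟨hqt, hqr⟩ := rq_from P a t q hq
  have e3 := h3 a q.2 q.1 (zeroStr q.2) (by unfold rqf; rw [hqr]; simp) (by
    rw [rqf_sum]
    have : rW P a (q.2 + 1) = (1 / 2) ^ q.1 + rW P a q.2 := by unfold rW; rw [hqr]; simp
    linarith)
  have e2 := h2 a (zeroStr q.2)
  have hz : (zeroStr q.2).length = q.2 := by simp [zeroStr]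
  rw [hz] at e2
  have e1 := h1 a (restrSeq (lim (eY P)) (Nat.pair a q.2))
  have hF : (List.range (restrSeq (lim (eY P)) (Nat.pair a q.2)).length.unpair.2).map (fun i =>
      ((restrSeq (lim (eY P)) (Nat.pair a q.2)).drop (Nat.pair a i)).head?.getD false) =
      restrSeq (lim (eX P a)) q.2 := by
    rw [restrSeq_length, Nat.unpair_pair]
    show _ = (List.range q.2).map _
    refine List.map_congr_left fun i hi => ?_
    have hi := List.mem_range.1 hi
    have hlt := Nat.pair_lt_pair_right a hi
    rw [List.head?_drop, ← lim_eY]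
    simp [restrSeq, hlt]
  rw [hF] at e1
  have e4 := hd (Nat.pair a q.2)
  have e5 : KC U (restrSeq (lim (eY P)) (Nat.pair a q.2)) + ((a + c1 : ℕ) : ℕ∞) ≤
      ((q.1 + a + c3 : ℕ) + (a + c2 : ℕ)) + (d : ℕ∞) + ((a + c1 : ℕ) : ℕ∞) := by
    gcongr
    refine e4.trans ?_
    gcongr
    refine e2.trans ?_
    gcongr
  have e6 : q.1 + a + c3 + (a + c2) + d + (a + c1) ≤ q.1 + gp a := by unfold gp; omega
  obtain ⟨ρ, r1, r2⟩ := KC_exists (n := q.1 + gp a)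
    (e1.trans (e5.trans (by exact_mod_cast e6)))
  exact ⟨ρ, r2, r1⟩
end

theorem part2 (U : Str →. Str) (hU : OptimalPF U) :
    ¬ (∃ A D : Set ℕ, CESet A ∧ CESet D ∧ ¬ KTrivialSet U A ∧ ¬ KTrivialSet U D ∧
        ∀ X : Set ℕ, CESet X → KLeSet U X A → KLeSet U X D → KTrivialSet U X) := by
  rintro ⟨A, D, hA, hD, hnA, hnD, h⟩
  obtain ⟨cA, hcA⟩ := hA.code
  obtain ⟨cD, hcD⟩ := hD.code
  obtain ⟨cU, huc⟩ := exists_uc hU.1.1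
  let P : Cds := ⟨cU, cA, cD⟩
  have eA : seqOfSet A = lim (en P.A) := by
    funext i; unfold seqOfSet lim; rw [decide_eq_decide]; exact hcA i
  have eD : seqOfSet D = lim (en P.D) := by
    funext i; unfold seqOfSet lim; rw [decide_eq_decide]; exact hcD i
  let X : Set ℕ := {i | ∃ t, eY P t i = true}
  have eX' : seqOfSet X = lim (eY P) := by
    funext i; unfold seqOfSet lim; rw [decide_eq_decide]; exact Iff.rfl
  have hX : CESet X := ceset_of_primrec (e := eY P) (by fun_prop) (fun n => Iff.rfl)
  have hXA : KLeSet U X A := by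
    unfold KLeSet; simp only [restrSet_eq, eX', eA]; exact Y_le hU huc (Or.inl rfl)
  have hXD : KLeSet U X D := by
    unfold KLeSet; simp only [restrSet_eq, eX', eD]; exact Y_le hU huc (Or.inr rfl)
  have hT := h X hX hXA hXD
  unfold KTrivialSet at hT hnA hnD
  simp only [restrSet_eq, eX', eA, eD] at hT hnA hnD
  obtain ⟨a, ha⟩ := Y_triv hU hT
  exact no_hyp (U := U) (P := P) (a := a) ⟨hU, huc, hnA, hnD, ha⟩

/-- The Solovay degrees of c.e. sets and the `K`-degrees of c.e. sets
are not elementarily equivalent: the former contain a minimal pair, the latter do not. -/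
theorem stmt8 (U : Str →. Str) (hU : OptimalPF U) :
    (∃ A D : Set ℕ, CESet A ∧ CESet D ∧ ¬ SolovayLeastSet A ∧ ¬ SolovayLeastSet D ∧
        ∀ X : Set ℕ, CESet X → SolovayLeSet X A → SolovayLeSet X D → SolovayLeastSet X) ∧
    ¬ (∃ A D : Set ℕ, CESet A ∧ CESet D ∧ ¬ KTrivialSet U A ∧ ¬ KTrivialSet U D ∧
        ∀ X : Set ℕ, CESet X → KLeSet U X A → KLeSet U X D → KTrivialSet U X) := by
  exact ⟨MP.minimal_pair, part2 U hU⟩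

end KPaper
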